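/- Let G be chosen uniformly at random from Φ(K_n^↔). Let ℰ be the event that for all v, c ∈ [n], G contains a well-spread collection of at least n²/2¹⁰⁰ (v,c)-absorbing gadgets, and let 𝒞 be the event that for every colour c ∈ [n], at most n/10⁹ loops of G have colour c. Then there exist constants a, a' > 0 and n₀ such that for all n ≥ n₀: P[ℰ | 𝒞] ≥ 1 − exp(−a·n²), and P[ℰ] ≥ 1 − exp(−a'·n·log n). -/

import Mathlib

open scoped Classical

noncomputable section

namespace RandomLatin

/-- `φ` is a proper `n`-arc-colouring of the complete digraph with loops on `Fin n`:
`φ i j` is the colour of the arc `i → j`, and no two arcs of the same colour share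
a common tail or a common head. -/
def IsProper {n : ℕ} (φ : Fin n → Fin n → Fin n) : Prop :=
  (∀ i j j' : Fin n, φ i j = φ i j' → j = j') ∧
  (∀ i i' j : Fin n, φ i j = φ i' j → i = i')

/-- The set `Φ(K_n^↔)` of proper `n`-arc-colourings of the complete digraph with loops. -/
abbrev Colouring (n : ℕ) : Type := {φ : Fin n → Fin n → Fin n // IsProper φ}

/-- `L` is an `n × n` Latin square with symbols `Fin n`. -/
def IsLatin {n : ℕ} (L : Fin n → Fin n → Fin n) : Prop :=
  (∀ i, Function.Bijective (L i)) ∧ (∀ j, Function.Bijective fun i => L i j)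

abbrev LatinSquare (n : ℕ) : Type := {L : Fin n → Fin n → Fin n // IsLatin L}

/-- The set of positions `{(i, σ i) : i}` is a (full) transversal of `L`. -/
def IsTransversal {n : ℕ} (L : Fin n → Fin n → Fin n) (σ : Equiv.Perm (Fin n)) : Prop :=
  Function.Bijective fun i => L i (σ i)

/-- A transversal is Hamilton if its arc set `{i → σ i}` is a directed Hamilton cycle. -/
def IsHamiltonTransversal {n : ℕ} (L : Fin n → Fin n → Fin n) (σ : Equiv.Perm (Fin n)) :
    Prop :=
  IsTransversal L σ ∧ σ.IsCycle ∧ σ.support = Finset.univ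

def hamTransversalCount {n : ℕ} (L : Fin n → Fin n → Fin n) : ℕ :=
  Nat.card {σ : Equiv.Perm (Fin n) // IsHamiltonTransversal L σ}

/-- The number of rainbow directed Hamilton cycles of a coloured `K_n^↔`. -/
def rainbowHamCycleCount {n : ℕ} (φ : Fin n → Fin n → Fin n) : ℕ :=
  Nat.card {σ : Equiv.Perm (Fin n) //
    Function.Injective (fun i => φ i (σ i)) ∧ σ.IsCycle ∧ σ.support = Finset.univ}

/-- The maximum number of appearances of a symbol on the leading diagonal. -/
def diagMax {n : ℕ} (L : Fin n → Fin n → Fin n) : ℕ :=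
  Finset.univ.sup fun s : Fin n => (Finset.univ.filter fun i : Fin n => L i i = s).card

/-! ### The spaces `𝒢_D` -/

/-- `𝒢_D`: proper arc-colourings, with colour set `D`, of spanning subdigraphs of `K_n^↔`
in which every vertex has in- and out-degree `|D|`.  `f d i` is the head of the unique
`d`-coloured arc with tail `i`. -/
def GD (n : ℕ) (D : Finset (Fin n)) : Type :=
  {f : {d : Fin n // d ∈ D} → Fin n → Fin n //
    (∀ d, Function.Bijective (f d)) ∧ ∀ i : Fin n, Function.Injective fun d => f d i}

/-- `comp H`: the number of completions of `H ∈ 𝒢_D` to an element of `Φ(K_n^↔)`,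
i.e. the number of `g ∈ 𝒢_{Dᶜ}` whose arc set is disjoint from that of `H`. -/
def completionCount {n : ℕ} {D : Finset (Fin n)} (H : GD n D) : ℕ :=
  Nat.card {g : GD n Dᶜ //
    ∀ (d : {d : Fin n // d ∈ D}) (d' : {d : Fin n // d ∈ Dᶜ}) (i : Fin n),
      H.1 d i ≠ g.1 d' i}

/-- `e_H(A₁, A₂)`: the number of arcs of `H` with tail in `A₁` and head in `A₂`. -/
def eArcs {n : ℕ} {D : Finset (Fin n)} (H : GD n D) (A₁ A₂ : Finset (Fin n)) : ℕ :=
  Nat.card {p : {d : Fin n // d ∈ D} × Fin n // p.2 ∈ A₁ ∧ H.1 p.1 p.2 ∈ A₂}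

/-! ### Absorbing gadgets -/

/-- A `(v,c)`-absorbing gadget, recorded by its vertices `x 0 = x₁, …, x 5 = x₆`. -/
def IsAbsGadget {n : ℕ} (φ : Fin n → Fin n → Fin n) (v c : Fin n) (x : Fin 6 → Fin n) :
    Prop :=
  ([v, x 0, x 1, x 2, x 3, x 4, x 5] : List (Fin n)).Nodup ∧
  φ (x 0) v = φ (x 3) (x 5) ∧
  φ v (x 1) = φ (x 2) (x 4) ∧
  φ (x 0) (x 1) = φ (x 2) (x 3) ∧
  φ (x 4) (x 5) = c ∧
  ([φ (x 0) v, φ v (x 1), φ (x 0) (x 1), c] : List (Fin n)).Nodup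

def absGadgetVerts {n : ℕ} (v : Fin n) (x : Fin 6 → Fin n) : Finset (Fin n) :=
  insert v (Finset.image x Finset.univ)

/-- The gadget contains an arc of colour `d`. -/
def absGadgetHasColour {n : ℕ} (φ : Fin n → Fin n → Fin n) (v : Fin n)
    (x : Fin 6 → Fin n) (d : Fin n) : Prop :=
  d = φ (x 0) v ∨ d = φ v (x 1) ∨ d = φ (x 0) (x 1) ∨ d = φ (x 2) (x 3) ∨
  d = φ (x 2) (x 4) ∨ d = φ (x 3) (x 5) ∨ d = φ (x 4) (x 5)

def WellSpreadAbsGadgets {n : ℕ} (φ : Fin n → Fin n → Fin n) (v c : Fin n)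
    (𝒜 : Finset (Fin 6 → Fin n)) : Prop :=
  (∀ u : Fin n, u ≠ v → (𝒜.filter fun x => u ∈ absGadgetVerts v x).card ≤ n) ∧
  (∀ d : Fin n, d ≠ c → (𝒜.filter fun x => absGadgetHasColour φ v x d).card ≤ n)

/-! ### Bridging gadgets (with respect to a full colouring) -/

/-- A `(y,z)`-bridging gadget, recorded by its vertices `w 0 = w₁, …, w 5 = w₆`. -/
def IsBridgeGadget {n : ℕ} (φ : Fin n → Fin n → Fin n) (y z : Fin n)
    (w : Fin 6 → Fin n) : Prop :=
  ([y, z, w 0, w 1, w 2, w 3, w 4, w 5] : List (Fin n)).Nodup ∧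
  φ y (w 0) = φ (w 5) (w 4) ∧
  φ (w 1) (w 0) = φ (w 5) z ∧
  φ (w 3) y = φ (w 1) (w 2) ∧
  φ (w 3) (w 4) = φ z (w 2) ∧
  ([φ y (w 0), φ (w 1) (w 0), φ (w 3) y, φ (w 3) (w 4)] : List (Fin n)).Nodup

def bridgeVerts {n : ℕ} (y z : Fin n) (w : Fin 6 → Fin n) : Finset (Fin n) :=
  insert y (insert z (Finset.image w Finset.univ))

def bridgeHasColour {n : ℕ} (φ : Fin n → Fin n → Fin n) (y z : Fin n)
    (w : Fin 6 → Fin n) (d : Fin n) : Prop :=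
  d = φ y (w 0) ∨ d = φ (w 1) (w 0) ∨ d = φ (w 1) (w 2) ∨ d = φ z (w 2) ∨
  d = φ (w 3) y ∨ d = φ (w 3) (w 4) ∨ d = φ (w 5) (w 4) ∨ d = φ (w 5) z

def WellSpreadBridgeGadgets {n : ℕ} (φ : Fin n → Fin n → Fin n) (y z : Fin n)
    (ℬ : Finset (Fin 6 → Fin n)) : Prop :=
  (∀ u : Fin n, u ≠ y → u ≠ z → (ℬ.filter fun w => u ∈ bridgeVerts y z w).card ≤ n) ∧
  (∀ d : Fin n, (ℬ.filter fun w => bridgeHasColour φ y z w d).card ≤ n)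


/-- The number of loops of colour `c`. -/
def loopCount {n : ℕ} (φ : Fin n → Fin n → Fin n) (c : Fin n) : ℕ :=
  Nat.card {i : Fin n // φ i i = c}

/-- For all `v, c`, a well-spread collection of at least `n²/2¹⁰⁰` `(v,c)`-absorbing
gadgets exists. -/
def HasAbsGadgets {n : ℕ} (φ : Fin n → Fin n → Fin n) : Prop :=
  ∀ v c : Fin n, ∃ 𝒜 : Finset (Fin 6 → Fin n),
    (∀ x ∈ 𝒜, IsAbsGadget φ v c x) ∧ WellSpreadAbsGadgets φ v c 𝒜 ∧
    (n : ℝ) ^ 2 / 2 ^ 100 ≤ 𝒜.card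

/-- For all distinct `y, z`, a well-spread collection of at least `n²/10⁵⁰`
`(y,z)`-bridging gadgets exists. -/
def HasBridgeGadgets {n : ℕ} (φ : Fin n → Fin n → Fin n) : Prop :=
  ∀ y z : Fin n, y ≠ z → ∃ ℬ : Finset (Fin 6 → Fin n),
    (∀ w ∈ ℬ, IsBridgeGadget φ y z w) ∧ WellSpreadBridgeGadgets φ y z ℬ ∧
    (n : ℝ) ^ 2 / 10 ^ 50 ≤ ℬ.card

/-! ### `(y,z,𝒫)`-bridges in `𝒢_D` -/

/-- `(D₁, …, D₆)` is an equitable ordered partition of `D` into six parts. -/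
def IsEquitableSixPartition {n : ℕ} (D : Finset (Fin n)) (P : Fin 6 → Finset (Fin n)) :
    Prop :=
  (∀ i, P i ⊆ D) ∧ (∀ i j, i ≠ j → Disjoint (P i) (P j)) ∧
  (Finset.univ.biUnion P = D) ∧ (∀ i j, (P i).card ≤ (P j).card + 1)

/-- A `(y,z,𝒫)`-bridge in `H ∈ 𝒢_D`. -/
def IsBridge {n : ℕ} {D : Finset (Fin n)} (H : GD n D) (y z : Fin n)
    (P : Fin 6 → Finset (Fin n)) (w : Fin 6 → Fin n) : Prop :=
  ([y, z, w 0, w 1, w 2, w 3, w 4, w 5] : List (Fin n)).Nodup ∧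
  ∃ d₁ d₂ d₃ d₄ d₅ d₆ : {d : Fin n // d ∈ D},
    (d₁ : Fin n) ∈ P 0 ∧ (d₂ : Fin n) ∈ P 1 ∧ (d₃ : Fin n) ∈ P 2 ∧
    (d₄ : Fin n) ∈ P 3 ∧ (d₅ : Fin n) ∈ P 4 ∧ (d₆ : Fin n) ∈ P 5 ∧
    H.1 d₁ y = w 0 ∧ H.1 d₁ (w 5) = w 4 ∧
    H.1 d₂ (w 1) = w 0 ∧ H.1 d₂ (w 5) = z ∧
    H.1 d₃ (w 3) = y ∧ H.1 d₃ (w 1) = w 2 ∧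
    H.1 d₄ (w 3) = w 4 ∧ H.1 d₄ z = w 2 ∧
    H.1 d₅ y = w 1 ∧ H.1 d₆ z = w 4

/-- The ten arcs of a `(y,z,𝒫)`-bridge. -/
def bridgeArcsOf {n : ℕ} (y z : Fin n) (w : Fin 6 → Fin n) : Finset (Fin n × Fin n) :=
  {(y, w 0), (w 1, w 0), (w 1, w 2), (z, w 2), (w 3, y), (w 3, w 4), (w 5, w 4), (w 5, z),
   (y, w 1), (z, w 4)}

/-- The four arcs `w₂→w₁, w₂→w₃, w₄→w₅, w₆→w₅` of a bridge. -/
def keyArcsOf {n : ℕ} (w : Fin 6 → Fin n) : Finset (Fin n × Fin n) :=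
  {(w 1, w 0), (w 1, w 2), (w 3, w 4), (w 5, w 4)}

/-- A distinguishable `(y,z,𝒫)`-bridge: the only bridge containing any of its four key arcs. -/
def IsDistinguishableBridge {n : ℕ} {D : Finset (Fin n)} (H : GD n D) (y z : Fin n)
    (P : Fin 6 → Finset (Fin n)) (w : Fin 6 → Fin n) : Prop :=
  IsBridge H y z P w ∧
  ∀ w' : Fin 6 → Fin n, IsBridge H y z P w' →
    ¬ Disjoint (keyArcsOf w) (bridgeArcsOf y z w') → w' = w

/-- `r_{(y,z,𝒫)}(H)`: the number of distinguishable `(y,z,𝒫)`-bridges in `H`. -/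
def distBridgeCount {n : ℕ} {D : Finset (Fin n)} (H : GD n D) (y z : Fin n)
    (P : Fin 6 → Finset (Fin n)) : ℕ :=
  Nat.card {w : Fin 6 → Fin n // IsDistinguishableBridge H y z P w}

/-- Membership in `Q̂_D^{(y,z,𝒫)} = ⋃_{s=0}^{n|D|} M_s^{(y,z,𝒫)}`. -/
def InQhat {n : ℕ} {D : Finset (Fin n)} (H : GD n D) (y z : Fin n)
    (P : Fin 6 → Finset (Fin n)) : Prop :=
  distBridgeCount H y z P ≤ n * D.card ∧
  ∀ A₁ A₂ : Finset (Fin n), A₁.card = D.card → A₂.card = D.card →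
    (eArcs H A₁ A₂ : ℝ) ≤ 2 * (D.card : ℝ) ^ 3 / n + 12 * distBridgeCount H y z P

/-- A `(y,z)`-bridging gadget of `H ∈ 𝒢_D`. -/
def IsBridgeGadgetGD {n : ℕ} {D : Finset (Fin n)} (H : GD n D) (y z : Fin n)
    (w : Fin 6 → Fin n) : Prop :=
  ([y, z, w 0, w 1, w 2, w 3, w 4, w 5] : List (Fin n)).Nodup ∧
  ∃ d₁ d₂ d₃ d₄ : {d : Fin n // d ∈ D},
    ([(d₁ : Fin n), (d₂ : Fin n), (d₃ : Fin n), (d₄ : Fin n)] : List (Fin n)).Nodup ∧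
    H.1 d₁ y = w 0 ∧ H.1 d₁ (w 5) = w 4 ∧
    H.1 d₂ (w 1) = w 0 ∧ H.1 d₂ (w 5) = z ∧
    H.1 d₃ (w 3) = y ∧ H.1 d₃ (w 1) = w 2 ∧
    H.1 d₄ (w 3) = w 4 ∧ H.1 d₄ z = w 2

/-- The gadget (in `H ∈ 𝒢_D`) contains an arc of colour `d`. -/
def bridgeGadgetGDHasColour {n : ℕ} {D : Finset (Fin n)} (H : GD n D) (y z : Fin n)
    (w : Fin 6 → Fin n) (d : Fin n) : Prop :=
  ∃ d' : {d : Fin n // d ∈ D}, (d' : Fin n) = d ∧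
    (H.1 d' y = w 0 ∨ H.1 d' (w 1) = w 0 ∨ H.1 d' (w 1) = w 2 ∨ H.1 d' z = w 2 ∨
     H.1 d' (w 3) = y ∨ H.1 d' (w 3) = w 4 ∨ H.1 d' (w 5) = w 4 ∨ H.1 d' (w 5) = z)

def WellSpreadBridgeGadgetsGD {n : ℕ} {D : Finset (Fin n)} (H : GD n D) (y z : Fin n)
    (ℬ : Finset (Fin 6 → Fin n)) : Prop :=
  (∀ u : Fin n, u ≠ y → u ≠ z → (ℬ.filter fun w => u ∈ bridgeVerts y z w).card ≤ n) ∧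
  (∀ d : Fin n, (ℬ.filter fun w => bridgeGadgetGDHasColour H y z w d).card ≤ n)

/-! ### Directed paths, absorbers, `T`-absorbers -/

/-- The arcs of the directed path whose vertices are the entries of `p`, in order. -/
def pathArcs {n : ℕ} (p : List (Fin n)) : List (Fin n × Fin n) := p.zip p.tail

def pathColours {n : ℕ} (φ : Fin n → Fin n → Fin n) (p : List (Fin n)) : List (Fin n) :=
  (pathArcs p).map fun e => φ e.1 e.2

def internalVerts {n : ℕ} (p : List (Fin n)) : List (Fin n) := (p.drop 1).dropLast

set_option maxHeartbeats 1600000 in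
/-- A `(v,c)`-absorber: a `(v,c)`-absorbing gadget with vertices `x`, bridged by an
`(x₄,x₅)`-bridging gadget with vertices `w`, completed by four rainbow directed paths. -/
structure Absorber (n : ℕ) (φ : Fin n → Fin n → Fin n) (v c : Fin n) where
  x : Fin 6 → Fin n
  w : Fin 6 → Fin n
  P : Fin 4 → List (Fin n)
  gadget : IsAbsGadget φ v c x
  bridge : IsBridgeGadget φ (x 3) (x 4) w
  meetAB : absGadgetVerts v x ∩ bridgeVerts (x 3) (x 4) w = {x 3, x 4}
  colourDisjointAB :
    ∀ d : Fin n, absGadgetHasColour φ v x d → bridgeHasColour φ (x 3) (x 4) w d → False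
  pathNodup : ∀ i, (P i).Nodup
  pathEnds :
    (P 0).head? = some (x 1) ∧ (P 0).getLast? = some (x 2) ∧
    (P 1).head? = some (w 0) ∧ (P 1).getLast? = some (w 3) ∧
    (P 2).head? = some (w 4) ∧ (P 2).getLast? = some (w 1) ∧
    (P 3).head? = some (w 2) ∧ (P 3).getLast? = some (w 5)
  pathsDisjoint : ∀ i j, i ≠ j → ∀ a ∈ P i, a ∉ P j
  pathInternalDisjoint : ∀ i, ∀ a ∈ internalVerts (P i),
    a ∉ absGadgetVerts v x ∧ a ∉ bridgeVerts (x 3) (x 4) w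
  pathsRainbowEach : ∀ i, (pathColours φ (P i)).Nodup
  pathsRainbowPair : ∀ i j, i ≠ j → ∀ d ∈ pathColours φ (P i), d ∉ pathColours φ (P j)
  pathColoursNew : ∀ i, ∀ d ∈ pathColours φ (P i),
    ¬ absGadgetHasColour φ v x d ∧ ¬ bridgeHasColour φ (x 3) (x 4) w d

def Absorber.arcs {n : ℕ} {φ : Fin n → Fin n → Fin n} {v c : Fin n}
    (A : Absorber n φ v c) : Finset (Fin n × Fin n) :=
  ({(A.x 0, v), (v, A.x 1), (A.x 0, A.x 1), (A.x 2, A.x 3), (A.x 2, A.x 4),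
    (A.x 3, A.x 5), (A.x 4, A.x 5)} : Finset (Fin n × Fin n)) ∪
  ({(A.x 3, A.w 0), (A.w 1, A.w 0), (A.w 1, A.w 2), (A.x 4, A.w 2), (A.w 3, A.x 3),
    (A.w 3, A.w 4), (A.w 5, A.w 4), (A.w 5, A.x 4)} : Finset (Fin n × Fin n)) ∪
  Finset.univ.biUnion fun i : Fin 4 => (pathArcs (A.P i)).toFinset

def Absorber.verts {n : ℕ} {φ : Fin n → Fin n → Fin n} {v c : Fin n}
    (A : Absorber n φ v c) : Finset (Fin n) :=
  absGadgetVerts v A.x ∪ bridgeVerts (A.x 3) (A.x 4) A.w ∪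
    Finset.univ.biUnion fun i : Fin 4 => (A.P i).toFinset

def Absorber.colours {n : ℕ} {φ : Fin n → Fin n → Fin n} {v c : Fin n}
    (A : Absorber n φ v c) : Finset (Fin n) :=
  A.arcs.image fun e => φ e.1 e.2

def Absorber.initial {n : ℕ} {φ : Fin n → Fin n → Fin n} {v c : Fin n}
    (A : Absorber n φ v c) : Fin n := A.x 0

def Absorber.terminal {n : ℕ} {φ : Fin n → Fin n → Fin n} {v c : Fin n}
    (A : Absorber n φ v c) : Fin n := A.x 5

/-- A `T`-absorber inside the coloured `K_n^↔`, with arc set `H`. -/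
structure TAbsorber (n : ℕ) (φ : Fin n → Fin n → Fin n) {α β : Type}
    [Fintype α] [Fintype β] [DecidableEq α] [DecidableEq β]
    (T : Finset (α × β)) (H : Finset (Fin n × Fin n)) where
  fV : α → Fin n
  fC : β → Fin n
  fVinj : Function.Injective fV
  fCinj : Function.Injective fC
  fCrange : ∀ b : β, fC b ∈ H.image fun e : Fin n × Fin n => φ e.1 e.2
  Ab : (e : α × β) → e ∈ T → Absorber n φ (fV e.1) (fC e.2)
  AbSub : ∀ e he, (Ab e he).arcs ⊆ H
  AbUnique : ∀ e he (A' : Absorber n φ (fV e.1) (fC e.2)),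
    A'.arcs ⊆ H → A'.arcs = (Ab e he).arcs
  AbVertexDisjoint : ∀ e he e' he', e ≠ e' →
    ∀ u : Fin n, u ∈ (Ab e he).verts → u ∈ (Ab e' he').verts → e.1 = e'.1 ∧ u = fV e.1
  AbColourDisjoint : ∀ e he e' he', e ≠ e' →
    ∀ d : Fin n, d ∈ (Ab e he).colours → d ∈ (Ab e' he').colours → e.2 = e'.2 ∧ d = fC e.2
  es : Fin T.card → α × β
  esInj : Function.Injective es
  esMem : ∀ i, es i ∈ T
  link : Fin (T.card - 1) → List (Fin n)
  linkLen : ∀ i, (link i).length = 4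
  linkNodup : ∀ i, (link i).Nodup
  linkSub : ∀ i, ∀ e ∈ pathArcs (link i), e ∈ H
  linkPairwiseDisjoint : ∀ i j, i ≠ j → ∀ a ∈ link i, a ∉ link j
  linkRainbowEach : ∀ i, (pathColours φ (link i)).Nodup
  linkRainbowPair : ∀ i j, i ≠ j → ∀ d ∈ pathColours φ (link i), d ∉ pathColours φ (link j)
  linkColourNew : ∀ i, ∀ d ∈ pathColours φ (link i), ∀ e he, d ∉ (Ab e he).colours
  linkHead : ∀ i : Fin (T.card - 1),
    (link i).head? = some (Ab (es (Fin.castLE (Nat.sub_le _ _) i)) (esMem _)).terminal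
  linkLast : ∀ i : Fin (T.card - 1),
    (link i).getLast? =
      some (Ab (es ⟨i.1 + 1, by have := i.2; omega⟩) (esMem _)).initial
  linkInternalDisjoint : ∀ i, ∀ a ∈ internalVerts (link i), ∀ e he, a ∉ (Ab e he).verts
  minimal : H = (T.attach.biUnion fun e => (Ab e.1 e.2).arcs) ∪
      (Finset.univ.biUnion fun i => (pathArcs (link i)).toFinset)

def TAbsorber.initialVtx {n : ℕ} {φ : Fin n → Fin n → Fin n} {α β : Type}
    [Fintype α] [Fintype β] [DecidableEq α] [DecidableEq β]
    {T : Finset (α × β)} {H : Finset (Fin n × Fin n)} (𝔸 : TAbsorber n φ T H)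
    (h : 0 < T.card) : Fin n :=
  (𝔸.Ab (𝔸.es ⟨0, h⟩) (𝔸.esMem _)).initial

def TAbsorber.terminalVtx {n : ℕ} {φ : Fin n → Fin n → Fin n} {α β : Type}
    [Fintype α] [Fintype β] [DecidableEq α] [DecidableEq β]
    {T : Finset (α × β)} {H : Finset (Fin n × Fin n)} (𝔸 : TAbsorber n φ T H)
    (h : 0 < T.card) : Fin n :=
  (𝔸.Ab (𝔸.es ⟨T.card - 1, Nat.sub_lt h Nat.one_pos⟩) (𝔸.esMem _)).terminal

/-- `T` (bipartite, edge set a finset of `α × β`) is robustly matchable with respect to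
flexible sets `A'`, `B'`. -/
def RobustlyMatchable {α β : Type} [DecidableEq α] [DecidableEq β]
    (T : Finset (α × β)) (A' : Finset α) (B' : Finset β) : Prop :=
  ∀ X : Finset α, ∀ Y : Finset β, X ⊆ A' → Y ⊆ B' → X.card = Y.card →
    (X.card : ℝ) ≤ min ((A'.card : ℝ) / 2) ((B'.card : ℝ) / 2) →
    ∃ M : Finset (α × β), M ⊆ T ∧ (∀ e ∈ M, e.1 ∉ X ∧ e.2 ∉ Y) ∧
      (∀ a : α, a ∉ X → ∃! e, e ∈ M ∧ e.1 = a) ∧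
      (∀ b : β, b ∉ Y → ∃! e, e ∈ M ∧ e.2 = b)

def arcVerts {n : ℕ} (H : Finset (Fin n × Fin n)) : Finset (Fin n) :=
  H.image Prod.fst ∪ H.image Prod.snd

/-- `H` (an arc set in the coloured `K_n^↔`) is robustly rainbow-Hamiltonian with respect
to flexible sets `Vf`, `Cf` and initial and terminal vertices `u`, `v`. -/
def RobustlyRainbowHam {n : ℕ} (φ : Fin n → Fin n → Fin n) (H : Finset (Fin n × Fin n))
    (Vf Cf : Finset (Fin n)) (u v : Fin n) : Prop :=
  ∀ X Y : Finset (Fin n), X ⊆ Vf → Y ⊆ Cf → X.card = Y.card →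
    (X.card : ℝ) ≤ min ((Vf.card : ℝ) / 2) ((Cf.card : ℝ) / 2) →
    ∃ p : List (Fin n), p.Nodup ∧ p.head? = some u ∧ p.getLast? = some v ∧
      (∀ e ∈ pathArcs p, e ∈ H) ∧
      (∀ a ∈ p, a ∉ X) ∧
      p.toFinset = arcVerts H \ X ∧
      (pathColours φ p).Nodup ∧
      (∀ d ∈ pathColours φ p, d ∉ Y)

/-! ### Lower-quasirandomness and rainbow directed path forests -/

/-- `e_{G,D}(U₁,U₂)`: the number of arcs with tail in `U₁`, head in `U₂`, colour in `D`. -/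
def colArcCount {n : ℕ} (φ : Fin n → Fin n → Fin n) (U₁ U₂ D : Finset (Fin n)) : ℕ :=
  Nat.card {p : Fin n × Fin n // p.1 ∈ U₁ ∧ p.2 ∈ U₂ ∧ φ p.1 p.2 ∈ D}

def LowerQuasirandom {n : ℕ} (φ : Fin n → Fin n → Fin n) : Prop :=
  ∀ U₁ U₂ D : Finset (Fin n),
    (U₁.card : ℝ) * U₂.card * D.card / n - (n : ℝ) ^ (5 / 3 : ℝ) ≤ colArcCount φ U₁ U₂ D

/-- The arc set `Q` contains a directed cycle (a loop counts as a cycle of length one). -/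
def HasDiCycle {n : ℕ} (Q : Finset (Fin n × Fin n)) : Prop :=
  ∃ (a : Fin n) (l : List (Fin n)), (a :: l).Nodup ∧
    List.Chain (fun u v : Fin n => (u, v) ∈ Q) a l ∧
    ((a :: l).getLast (List.cons_ne_nil a l), a) ∈ Q

/-- `Q` is (the arc set of) a spanning rainbow directed path forest of `G − U`, using no
colour of `D`, with at most `n^{9/10}` components. -/
def IsGoodPathForest {n : ℕ} (φ : Fin n → Fin n → Fin n) (U D : Finset (Fin n))
    (Q : Finset (Fin n × Fin n)) : Prop :=
  (∀ e ∈ Q, e.1 ∉ U ∧ e.2 ∉ U) ∧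
  (∀ e ∈ Q, ∀ e' ∈ Q, e ≠ e' → e.1 ≠ e'.1 ∧ e.2 ≠ e'.2) ∧
  ¬ HasDiCycle Q ∧
  Set.InjOn (fun e : Fin n × Fin n => φ e.1 e.2) (Q : Set (Fin n × Fin n)) ∧
  (∀ e ∈ Q, φ e.1 e.2 ∉ D) ∧
  ((n : ℝ) - U.card - Q.card ≤ (n : ℝ) ^ (9 / 10 : ℝ))


/-- The logarithm of `(r !) ^ (1 / r)`. -/
def lb (r : ℕ) : ℝ := Real.log (r.factorial) / r

lemma mul_lb (r : ℕ) : (r : ℝ) * lb r = Real.log r.factorial := by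
  rcases Nat.eq_zero_or_pos r with rfl | h
  · simp
  · have : (r : ℝ) ≠ 0 := by positivity
    unfold lb; field_simp

/-- Permutations agreeing with `σ₀` off `I` and lying in prescribed rows on `I`. -/
def permSet {n : ℕ} (I : Finset (Fin n)) (σ₀ : Equiv.Perm (Fin n))
    (R : Fin n → Finset (Fin n)) : Finset (Equiv.Perm (Fin n)) :=
  Finset.univ.filter fun σ => (∀ j, j ∉ I → σ j = σ₀ j) ∧ ∀ i ∈ I, σ i ∈ R i

lemma image_eq_of_agree {n : ℕ} {I : Finset (Fin n)} {σ τ : Equiv.Perm (Fin n)}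
    (h : ∀ j, j ∉ I → σ j = τ j) : I.image σ = I.image τ := by
  have key : ∀ {σ τ : Equiv.Perm (Fin n)}, (∀ j, j ∉ I → σ j = τ j) →
      I.image σ ⊆ I.image τ := by
    intro σ τ h k hk
    obtain ⟨i, hi, rfl⟩ := Finset.mem_image.1 hk
    refine Finset.mem_image.2 ⟨τ.symm (σ i), ?_, by simp⟩
    by_contra hc
    have := h _ hc
    simp only [Equiv.apply_symm_apply] at this
    have e := σ.injective this
    rw [e] at hc
    exact hc hi
  exact (key h).antisymm (key fun j hj => (h j hj).symm)

lemma sum_log_fiber_le {α β : Type*} [DecidableEq β] (S : Finset α) (f : α → β) (R : Finset β)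
    (hf : ∀ a ∈ S, f a ∈ R) :
    ∑ a ∈ S, (Real.log S.card - Real.log R.card -
      Real.log (S.filter fun b => f b = f a).card) ≤ 0 := by
  have h1 : ∀ a ∈ S, (Real.log S.card - Real.log R.card -
      Real.log (S.filter fun b => f b = f a).card) ≤
      (S.card : ℝ) / (R.card * (S.filter fun b => f b = f a).card) - 1 := by
    intro a ha
    have hS : (0 : ℝ) < S.card := by exact_mod_cast Finset.card_pos.2 ⟨a, ha⟩
    have hR : (0 : ℝ) < R.card := by exact_mod_cast Finset.card_pos.2 ⟨_, hf a ha⟩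
    have ht : (0 : ℝ) < (S.filter fun b => f b = f a).card := by
      exact_mod_cast Finset.card_pos.2 ⟨a, by simp [ha]⟩
    rw [sub_sub, ← Real.log_mul hR.ne' ht.ne', ← Real.log_div hS.ne' (by positivity)]
    exact Real.log_le_sub_one_of_pos (by positivity)
  refine (Finset.sum_le_sum h1).trans ?_
  rw [Finset.sum_sub_distrib, ← Finset.sum_fiberwise_of_maps_to hf]
  have h2 : ∀ k ∈ R, ∑ a ∈ S with f a = k,
      (S.card : ℝ) / (R.card * (S.filter fun b => f b = f a).card) ≤ S.card / R.card := by
    intro k hk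
    have hR : (0 : ℝ) < R.card := by exact_mod_cast Finset.card_pos.2 ⟨_, hk⟩
    rw [Finset.sum_congr rfl
      (g := fun _ => (S.card : ℝ) / (R.card * (S.filter fun b => f b = k).card))]
    · rw [Finset.sum_const, nsmul_eq_mul]
      rcases Nat.eq_zero_or_pos (S.filter fun b => f b = k).card with h0 | h0
      · rw [h0]; simp; positivity
      · have : (0 : ℝ) < (S.filter fun b => f b = k).card := by exact_mod_cast h0
        apply le_of_eq; field_simp
    · intro a ha; rw [(Finset.mem_filter.1 ha).2]
  have h3 := Finset.sum_le_sum h2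
  rw [Finset.sum_const, nsmul_eq_mul] at h3
  rcases Nat.eq_zero_or_pos R.card with h0 | h0
  · rw [h0] at h3; simp at h3 ⊢
    have : (0 : ℝ) ≤ S.card := by positivity
    have h4 := Finset.card_eq_zero.1 h0
    subst h4; simp
  · have hR : (0 : ℝ) < R.card := by exact_mod_cast h0
    have : (R.card : ℝ) * (S.card / R.card) = S.card := by field_simp
    simp only [Finset.sum_const, nsmul_eq_mul, mul_one]
    linarith

lemma sum_lb_erase {n : ℕ} (I : Finset (Fin n)) (ν : Equiv.Perm (Fin n)) (R : Finset (Fin n))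
    (hR : R ⊆ I.image ν) (j : Fin n) (hj : j ∈ I) (hν : ν j ∈ R) :
    Real.log R.card + ∑ i ∈ I.erase j, lb (R.erase (ν i)).card = I.card * lb R.card := by
  have hr : 0 < R.card := Finset.card_pos.2 ⟨_, hν⟩
  have h1 : ∑ i ∈ I.erase j, lb (R.erase (ν i)).card =
      ∑ i ∈ I.erase j, (if ν i ∈ R then lb (R.card - 1) else lb R.card) := by
    refine Finset.sum_congr rfl fun i _ => ?_
    split_ifs with h
    · rw [Finset.card_erase_of_mem h]
    · rw [Finset.erase_eq_of_notMem h]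
  have hc : ((I.erase j).filter fun i => ν i ∈ R).card = R.card - 1 := by
    have : ((I.erase j).filter fun i => ν i ∈ R).image ν = R.erase (ν j) := by
      ext k
      simp only [Finset.mem_image, Finset.mem_filter, Finset.mem_erase]
      constructor
      · rintro ⟨i, ⟨⟨h1, h2⟩, h3⟩, rfl⟩
        exact ⟨fun h => h1 (ν.injective h), h3⟩
      · rintro ⟨h1, h2⟩
        obtain ⟨i, hi, rfl⟩ := Finset.mem_image.1 (hR h2)
        exact ⟨i, ⟨⟨fun h => h1 (h ▸ rfl), hi⟩, h2⟩, rfl⟩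
    rw [← Finset.card_image_of_injective _ ν.injective, this, Finset.card_erase_of_mem hν]
  have hle : R.card ≤ I.card := (Finset.card_le_card hR).trans Finset.card_image_le
  have hc' : ((I.erase j).filter fun i => ¬ ν i ∈ R).card = I.card - R.card := by
    have := Finset.card_filter_add_card_filter_not (s := I.erase j) (fun i => ν i ∈ R)
    rw [Finset.card_erase_of_mem hj] at this
    omega
  rw [h1, Finset.sum_ite, Finset.sum_const, Finset.sum_const, hc, hc', nsmul_eq_mul, nsmul_eq_mul,
    mul_lb]
  rw [Nat.cast_sub hle]
  have h3 := mul_lb R.card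
  obtain ⟨r, hr'⟩ : ∃ r, R.card = r + 1 := ⟨R.card - 1, by omega⟩
  rw [hr'] at h3 ⊢
  rw [Nat.factorial_succ, Nat.cast_mul, Real.log_mul (by positivity) (by positivity)] at h3
  simp only [Nat.add_sub_cancel]
  linarith

/-- **Brègman's theorem**, in logarithmic form. -/
theorem log_card_permSet_le {n : ℕ} (u : ℕ) : ∀ (I : Finset (Fin n)) (σ₀ : Equiv.Perm (Fin n))
    (R : Fin n → Finset (Fin n)), I.card = u → (∀ i ∈ I, R i ⊆ I.image σ₀) →
    (permSet I σ₀ R).Nonempty →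
    Real.log (permSet I σ₀ R).card ≤ ∑ i ∈ I, lb (R i).card := by
  induction u with
  | zero =>
    intro I σ₀ R hI _ _
    rw [Finset.card_eq_zero] at hI
    subst hI
    have : (permSet ∅ σ₀ R).card ≤ 1 := by
      refine Finset.card_le_one.2 fun a ha b hb => ?_
      simp only [permSet, Finset.mem_filter] at ha hb
      ext j
      rw [ha.2.1 j (by simp), hb.2.1 j (by simp)]
    simp only [Finset.sum_empty]
    exact Real.log_nonpos (by positivity) (by exact_mod_cast this)
  | succ u ih =>
    intro I σ₀ R hI hR hne
    set S := permSet I σ₀ R with hS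
    have hmem : ∀ ν ∈ S, (∀ j, j ∉ I → ν j = σ₀ j) ∧ ∀ i ∈ I, ν i ∈ R i := fun ν hν =>
      (Finset.mem_filter.1 hν).2
    have hRν : ∀ ν ∈ S, ∀ i ∈ I, R i ⊆ I.image ν := fun ν hν i hi => by
      rw [image_eq_of_agree (hmem ν hν).1]; exact hR i hi
    have h1 : ∀ i ∈ I, ∑ ν ∈ S, (Real.log S.card - Real.log (R i).card -
        Real.log (S.filter fun μ => μ i = ν i).card) ≤ 0 := fun i hi =>
      sum_log_fiber_le S (fun ν => ν i) (R i) fun ν hν => (hmem ν hν).2 i hi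
    have h2 : ∀ i ∈ I, ∀ ν ∈ S, Real.log (S.filter fun μ => μ i = ν i).card ≤
        ∑ j ∈ I.erase i, lb ((R j).erase (ν i)).card := by
      intro i hi ν hν
      have hsub : (S.filter fun μ => μ i = ν i) ⊆
          permSet (I.erase i) ν (fun j => (R j).erase (ν i)) := by
        intro μ hμ
        obtain ⟨hμS, hμi⟩ := Finset.mem_filter.1 hμ
        have hm := hmem μ hμS
        refine Finset.mem_filter.2 ⟨Finset.mem_univ _, ?_, ?_⟩
        · intro j hj
          by_cases hji : j = i
          · rw [hji, hμi]
          · have : j ∉ I := fun h => hj (Finset.mem_erase.2 ⟨hji, h⟩)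
            rw [hm.1 j this, (hmem ν hν).1 j this]
        · intro j hj
          obtain ⟨hji, hjI⟩ := Finset.mem_erase.1 hj
          refine Finset.mem_erase.2 ⟨fun h => hji ?_, hm.2 j hjI⟩
          rw [← hμi] at h; exact μ.injective h
      have hne' : (S.filter fun μ => μ i = ν i).Nonempty := ⟨ν, by simp [hν]⟩
      refine (Real.log_le_log (by exact_mod_cast Finset.card_pos.2 hne')
        (by exact_mod_cast Finset.card_le_card hsub)).trans
        (ih _ _ _ (by rw [Finset.card_erase_of_mem hi, hI]; rfl) ?_ (hne'.mono hsub))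
      intro j hj k hk
      obtain ⟨hki, hkR⟩ := Finset.mem_erase.1 hk
      obtain ⟨l, hl, rfl⟩ := Finset.mem_image.1 (hRν ν hν j (Finset.mem_of_mem_erase hj) hkR)
      exact Finset.mem_image.2 ⟨l, Finset.mem_erase.2 ⟨fun h => hki (h ▸ rfl), hl⟩, rfl⟩
    have hp : (0 : ℝ) < S.card := by exact_mod_cast Finset.card_pos.2 hne
    have hI' : (0 : ℝ) < I.card := by rw [hI]; positivity
    have h3 : ∑ i ∈ I, ∑ ν ∈ S, (Real.log S.card - Real.log (R i).card -
        ∑ j ∈ I.erase i, lb ((R j).erase (ν i)).card) ≤ 0 :=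
      Finset.sum_nonpos fun i hi => le_trans (Finset.sum_le_sum fun ν hν => by
        have := h2 i hi ν hν; linarith) (h1 i hi)
    rw [Finset.sum_comm] at h3
    have h4 : ∀ ν ∈ S, ∑ i ∈ I, (Real.log S.card - Real.log (R i).card -
        ∑ j ∈ I.erase i, lb ((R j).erase (ν i)).card) =
        I.card * (Real.log S.card - ∑ j ∈ I, lb (R j).card) := by
      intro ν hν
      rw [Finset.sum_sub_distrib, Finset.sum_sub_distrib, Finset.sum_const, nsmul_eq_mul]
      have hcomm : ∑ i ∈ I, ∑ j ∈ I.erase i, lb ((R j).erase (ν i)).card =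
          ∑ j ∈ I, ∑ i ∈ I.erase j, lb ((R j).erase (ν i)).card := by
        refine Finset.sum_comm' fun x y => ?_
        simp only [Finset.mem_erase]; tauto
      have : ∑ j ∈ I, Real.log (R j).card + ∑ j ∈ I, ∑ i ∈ I.erase j,
          lb ((R j).erase (ν i)).card = I.card * ∑ j ∈ I, lb (R j).card := by
        rw [← Finset.sum_add_distrib, Finset.mul_sum]
        exact Finset.sum_congr rfl fun j hj =>
          sum_lb_erase I ν (R j) (hRν ν hν j hj) j hj ((hmem ν hν).2 j hj)
      rw [hcomm]; linarith
    rw [Finset.sum_congr rfl h4, Finset.sum_const, nsmul_eq_mul] at h3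
    have : Real.log S.card - ∑ j ∈ I, lb (R j).card ≤ 0 := by
      by_contra hc
      push Not at hc
      have := mul_pos hp (mul_pos hI' hc)
      linarith
    linarith

theorem card_perm_le {n : ℕ} (R : Fin n → Finset (Fin n)) :
    ((Finset.univ.filter fun σ : Equiv.Perm (Fin n) => ∀ i, σ i ∈ R i).card : ℝ) ≤
      Real.exp (∑ i, lb (R i).card) := by
  have h : (Finset.univ.filter fun σ : Equiv.Perm (Fin n) => ∀ i, σ i ∈ R i) =
      permSet Finset.univ 1 R := by
    simp [permSet]
  rw [h]
  rcases (permSet Finset.univ 1 R).eq_empty_or_nonempty with h0 | h0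
  · rw [h0]; simp; positivity
  · have := log_card_permSet_le n Finset.univ 1 R (by simp) (by simp) h0
    rw [← Real.exp_log (show (0 : ℝ) < (permSet Finset.univ 1 R).card by
      exact_mod_cast Finset.card_pos.2 h0)]
    exact Real.exp_le_exp.2 this

section Capacity

variable {n : ℕ}

/-- The restriction of `f` to the line through `x` in direction `m`, as a complex polynomial. -/
def lineRestrict (x : Fin n → ℂ) (m : Fin n) (f : MvPolynomial (Fin n) ℝ) : Polynomial ℂ :=
  MvPolynomial.aeval (fun i => Polynomial.C (x i) + if i = m then Polynomial.X else 0) f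

lemma eval_lineRestrict (x : Fin n → ℂ) (m : Fin n) (f : MvPolynomial (Fin n) ℝ) (z : ℂ) :
    (lineRestrict x m f).eval z =
      MvPolynomial.aeval (fun i => x i + if i = m then z else 0) f := by
  unfold lineRestrict
  induction f using MvPolynomial.induction_on with
  | C a => simp [IsScalarTower.algebraMap_apply ℝ ℂ (Polynomial ℂ)]
  | add p q hp hq => simp [hp, hq]
  | mul_X p i hp =>
    simp only [map_mul, Polynomial.eval_mul, hp, MvPolynomial.aeval_X, Polynomial.eval_add,
      Polynomial.eval_C]
    split_ifs <;> simp

lemma derivative_lineRestrict (x : Fin n → ℂ) (m : Fin n) (f : MvPolynomial (Fin n) ℝ) :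
    (lineRestrict x m f).derivative = lineRestrict x m (MvPolynomial.pderiv m f) := by
  unfold lineRestrict
  induction f using MvPolynomial.induction_on with
  | C a => simp [IsScalarTower.algebraMap_apply ℝ ℂ (Polynomial ℂ)]
  | add p q hp hq => simp [hp, hq]
  | mul_X p i hp =>
    simp only [map_mul, Polynomial.derivative_mul, hp, MvPolynomial.aeval_X, 
      Polynomial.derivative_C, Derivation.leibniz, smul_eq_mul, map_add, MvPolynomial.pderiv_X]
    by_cases h : i = m
    · subst h; simp; ring
    · simp [h]; ring

/-- Homogeneous polynomials with nonnegative coefficients not vanishing on the closed right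
half space, away from the imaginary subspace. -/
structure HStable (k : ℕ) (f : MvPolynomial (Fin n) ℝ) : Prop where
  hom : f.IsHomogeneous k
  nonneg : ∀ m, 0 ≤ f.coeff m
  ne_zero : ∀ x : Fin n → ℂ, (∀ i, 0 ≤ (x i).re) → (∃ i, 0 < (x i).re) →
    MvPolynomial.aeval x f ≠ 0

lemma aeval_smul_of_hom {k : ℕ} {f : MvPolynomial (Fin n) ℝ} (hf : f.IsHomogeneous k)
    (w : ℂ) (x : Fin n → ℂ) :
    MvPolynomial.aeval (fun i => w * x i) f = w ^ k * MvPolynomial.aeval x f := by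
  rw [MvPolynomial.aeval_def, MvPolynomial.aeval_def, MvPolynomial.eval₂_eq',
    MvPolynomial.eval₂_eq', Finset.mul_sum]
  refine Finset.sum_congr rfl fun d hd => ?_
  have h : ∑ i, d i = k := by
    have := hf (MvPolynomial.mem_support_iff.1 hd)
    rw [← this, Finsupp.weight_apply, Finsupp.sum_fintype]
    · simp
    · simp
  simp_rw [mul_pow]
  rw [Finset.prod_mul_distrib, Finset.prod_pow_eq_pow_sum, h]
  ring

lemma eval_nonneg {f : MvPolynomial (Fin n) ℝ} (hf : ∀ m, 0 ≤ f.coeff m) (x : Fin n → ℝ)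
    (hx : ∀ i, 0 ≤ x i) : 0 ≤ MvPolynomial.eval x f := by
  rw [MvPolynomial.eval_eq']
  exact Finset.sum_nonneg fun d _ => mul_nonneg (hf d)
    (Finset.prod_nonneg fun i _ => pow_nonneg (hx i) _)

lemma aeval_ofReal (f : MvPolynomial (Fin n) ℝ) (x : Fin n → ℝ) :
    MvPolynomial.aeval (fun i => (x i : ℂ)) f = ((MvPolynomial.eval x f : ℝ) : ℂ) := by
  induction f using MvPolynomial.induction_on with
  | C a => simp
  | add p q hp hq => simp [hp, hq]
  | mul_X p i hp => simp [hp]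

lemma HStable.eval_pos {k : ℕ} {f : MvPolynomial (Fin n) ℝ} (hf : HStable k f) (x : Fin n → ℝ)
    (hx : ∀ i, 0 ≤ x i) (hx' : ∃ i, 0 < x i) : 0 < MvPolynomial.eval x f := by
  refine lt_of_le_of_ne (eval_nonneg hf.nonneg x hx) fun h => ?_
  refine hf.ne_zero (fun i => (x i : ℂ)) (by simpa using hx) (by simpa using hx') ?_
  rw [aeval_ofReal, ← h]; simp

lemma HStable.pderiv {k : ℕ} {f : MvPolynomial (Fin n) ℝ} (hf : HStable (k + 1) f) (m : Fin n) :
    HStable k (MvPolynomial.pderiv m f) := by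
  refine ⟨by simpa using hf.hom.pderiv (i := m), fun d => ?_, fun x hx hx' => ?_⟩
  · rw [MvPolynomial.coeff_pderiv]
    exact mul_nonneg (hf.nonneg _) (by positivity)
  set G := lineRestrict x m f with hG
  have hroot : ∀ z, G.IsRoot z → z.re < 0 := by
    intro z hz
    by_contra hc
    push Not at hc
    rw [Polynomial.IsRoot, hG, eval_lineRestrict] at hz
    refine hf.ne_zero _ ?_ ?_ hz
    · intro i; split_ifs <;> simp [hx i]; linarith [hx i]
    · obtain ⟨i, hi⟩ := hx'
      refine ⟨i, ?_⟩
      split_ifs <;> simp [hi]; linarith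
  have hdeg : 0 < G.degree := by
    rw [← Polynomial.natDegree_pos_iff_degree_pos, Nat.pos_iff_ne_zero]
    intro h0
    obtain ⟨c, hc⟩ := Polynomial.natDegree_eq_zero.1 h0
    set H : Polynomial ℂ := MvPolynomial.aeval
      (fun i => Polynomial.C (x i) * Polynomial.X + if i = m then 1 else 0) f with hH
    have hHe : ∀ u, H.eval u =
        MvPolynomial.aeval (fun i => x i * u + if i = m then 1 else 0) f := by
      intro u
      rw [hH]
      clear_value G
      clear hH H hG hc hroot h0 hf
      induction f using MvPolynomial.induction_on with
      | C a => simp [IsScalarTower.algebraMap_apply ℝ ℂ (Polynomial ℂ)]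
      | add p q hp hq => simp [hp, hq]
      | mul_X p i hp =>
        simp only [map_mul, Polynomial.eval_mul, hp, MvPolynomial.aeval_X, Polynomial.eval_add,
          Polynomial.eval_C, Polynomial.eval_X]
        split_ifs <;> simp
    have hz : Polynomial.X * H = Polynomial.X * (Polynomial.C c * Polynomial.X ^ (k + 1)) := by
      refine Polynomial.funext fun u => ?_
      rcases eq_or_ne u 0 with rfl | hu
      · simp
      · have h1 : H.eval u = u ^ (k + 1) * c := by
          have h2 : G.eval (1 / u) = c := by rw [← hc]; simp
          rw [hG, eval_lineRestrict] at h2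
          rw [hHe, ← h2, ← aeval_smul_of_hom hf.hom]
          congr 2
          ext i
          split_ifs
          · field_simp
          · ring
        simp only [Polynomial.eval_mul, Polynomial.eval_X, h1, Polynomial.eval_C,
          Polynomial.eval_pow]
        ring
    have hz' := mul_left_cancel₀ Polynomial.X_ne_zero hz
    have h3 : H.eval 0 = 0 := by rw [hz']; simp
    rw [hHe] at h3
    refine hf.ne_zero _ ?_ ⟨m, ?_⟩ h3
    · intro i; split_ifs <;> simp
    · simp
  have hval : MvPolynomial.aeval x (MvPolynomial.pderiv m f) = G.derivative.eval 0 := by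
    rw [hG, derivative_lineRestrict, eval_lineRestrict]; simp
  rw [hval]
  intro h0
  have hd0 : G.derivative ≠ 0 := by
    intro h
    have := Polynomial.derivative_eq_zero.1 h
    rw [Polynomial.natDegree_pos_iff_degree_pos.symm] at hdeg
    omega
  have hmem : (0 : ℂ) ∈ G.derivative.rootSet ℂ := by
    rw [Polynomial.mem_rootSet]
    exact ⟨hd0, by simpa using h0⟩
  have hsub : convexHull ℝ (G.rootSet ℂ) ⊆ {z : ℂ | z.re < 0} := by
    refine convexHull_min ?_ (convex_halfSpace_re_lt 0)
    intro z hz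
    rw [Polynomial.mem_rootSet] at hz
    exact hroot z (by simpa [Polynomial.IsRoot] using hz.2)
  have := hsub (Polynomial.rootSet_derivative_subset_convexHull_rootSet hdeg hmem)
  simp at this

lemma prod_neg_roots (M : Multiset ℂ) : (∀ r ∈ M, ∃ s : ℝ, 0 < s ∧ r = -(s : ℂ)) →
    ∃ q L : ℝ, 0 < q ∧ ((M.map fun r => Polynomial.X - Polynomial.C r).prod).eval 0 = (q : ℂ) ∧
      ((M.map fun r => Polynomial.X - Polynomial.C r).prod).derivative.eval 0 = ((L * q : ℝ) : ℂ) ∧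
      ∀ t : ℝ, 0 ≤ t → ∃ y : ℝ, 0 ≤ y ∧
        ((M.map fun r => Polynomial.X - Polynomial.C r).prod).eval (t : ℂ) = (y : ℂ) ∧
        y ≤ q * Real.exp (t * L) := by
  induction M using Multiset.induction_on with
  | empty => intro _; exact ⟨1, 0, by simp, by simp, by simp, fun t _ => ⟨1, by simp⟩⟩
  | cons r M ih =>
    intro h
    obtain ⟨q, L, hq, h0, h1, h2⟩ := ih fun r hr => h r (Multiset.mem_cons_of_mem hr)
    obtain ⟨s, hs, rfl⟩ := h _ (Multiset.mem_cons_self _ _)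
    refine ⟨s * q, 1 / s + L, by positivity, ?_, ?_, fun t ht => ?_⟩
    · simp [h0]
    · simp only [Multiset.map_cons, Multiset.prod_cons, Polynomial.derivative_mul,
        Polynomial.eval_add, Polynomial.eval_mul, h0, h1]
      have : (s : ℂ) ≠ 0 := by exact_mod_cast hs.ne'
      simp
      field_simp
    · obtain ⟨y, hy, hy1, hy2⟩ := h2 t ht
      refine ⟨(t + s) * y, by positivity, by simp [hy1], ?_⟩
      have h3 : t / s + 1 ≤ Real.exp (t / s) := Real.add_one_le_exp _
      calc (t + s) * y = s * (t / s + 1) * y := by field_simp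
        _ ≤ s * Real.exp (t / s) * (q * Real.exp (t * L)) := by gcongr
        _ = s * q * Real.exp (t * (1 / s + L)) := by
          rw [mul_add, Real.exp_add]; ring_nf

lemma HStable.eval_line_le {k : ℕ} {f : MvPolynomial (Fin n) ℝ} (hf : HStable k f)
    (x : Fin n → ℝ) (hx : ∀ i, 0 ≤ x i) (hx' : ∃ i, 0 < x i) (m : Fin n) (t : ℝ) (ht : 0 ≤ t) :
    MvPolynomial.eval (fun i => x i + if i = m then t else 0) f ≤ MvPolynomial.eval x f *
      Real.exp (t * (MvPolynomial.eval x (MvPolynomial.pderiv m f) / MvPolynomial.eval x f)) := by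
  set G := lineRestrict (fun i => (x i : ℂ)) m f with hG
  have hpos := hf.eval_pos x hx hx'
  have hG0 : G.eval 0 = (MvPolynomial.eval x f : ℝ) := by
    rw [hG, eval_lineRestrict, ← aeval_ofReal]; simp
  have hGt : G.eval (t : ℂ) =
      (MvPolynomial.eval (fun i => x i + if i = m then t else 0) f : ℝ) := by
    rw [hG, eval_lineRestrict, ← aeval_ofReal]
    congr 2
    ext i
    split_ifs <;> simp
  have hGd : G.derivative.eval 0 = (MvPolynomial.eval x (MvPolynomial.pderiv m f) : ℝ) := by
    rw [hG, derivative_lineRestrict, eval_lineRestrict, ← aeval_ofReal]; simp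
  have hGne : G ≠ 0 := by
    intro h
    rw [h] at hG0
    simp at hG0
    exact hpos.ne (by exact_mod_cast hG0)
  have hroots : ∀ r ∈ G.roots, ∃ s : ℝ, 0 < s ∧ r = -(s : ℂ) := by
    intro z hz
    have hz0 := (Polynomial.mem_roots hGne).1 hz
    rw [Polynomial.IsRoot, hG, eval_lineRestrict] at hz0
    have key : ∀ w : ℂ, w.re = 1 → 0 ≤ (w * z).re → False := by
      intro w hw hwz
      have h1 := aeval_smul_of_hom hf.hom w (fun i => (x i : ℂ) + if i = m then z else 0)
      rw [hz0, mul_zero] at h1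
      refine hf.ne_zero _ ?_ ?_ h1
      · intro i
        have : (w * (x i : ℂ)).re = x i := by simp [hw]
        simp only [mul_add, Complex.add_re, this]
        split_ifs
        · linarith [hx i]
        · simp [hx i]
      · obtain ⟨i, hi⟩ := hx'
        refine ⟨i, ?_⟩
        have : (w * (x i : ℂ)).re = x i := by simp [hw]
        simp only [mul_add, Complex.add_re, this]
        split_ifs
        · linarith
        · simp [hi]
    have him : z.im = 0 := by
      by_contra him
      refine key (1 + ((z.re / z.im : ℝ) : ℂ) * Complex.I) (by simp) ?_
      simp only [Complex.mul_re, Complex.add_re, Complex.one_re, Complex.ofReal_re, Complex.I_re,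
        Complex.ofReal_im, Complex.I_im, Complex.add_im, Complex.one_im, Complex.mul_im]
      apply le_of_eq
      field_simp
      ring
    refine ⟨-z.re, ?_, ?_⟩
    · by_contra hc
      exact key 1 (by simp) (by simp; linarith)
    · apply Complex.ext <;> simp [him]
  obtain ⟨q, L, hq, h0, h1, h2⟩ := prod_neg_roots G.roots hroots
  have hfac : G = Polynomial.C G.leadingCoeff *
      (G.roots.map fun r => Polynomial.X - Polynomial.C r).prod :=
    (Polynomial.C_leadingCoeff_mul_prod_multiset_X_sub_C
      ((IsAlgClosed.splits G).natDegree_eq_card_roots.symm)).symm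
  set Q := (G.roots.map fun r => Polynomial.X - Polynomial.C r).prod with hQ
  obtain ⟨y, hy, hy1, hy2⟩ := h2 t ht
  set lc := G.leadingCoeff with hlc
  clear_value lc Q
  have hq' : (q : ℂ) ≠ 0 := by exact_mod_cast hq.ne'
  have e0 : lc = ((MvPolynomial.eval x f / q : ℝ) : ℂ) := by
    rw [hfac, Polynomial.eval_mul, Polynomial.eval_C, h0] at hG0
    push_cast
    rw [← hG0]; field_simp
  set F := MvPolynomial.eval x f
  have e1 : MvPolynomial.eval x (MvPolynomial.pderiv m f) = F / q * (L * q) := by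
    rw [hfac, Polynomial.derivative_mul, Polynomial.eval_add, Polynomial.eval_mul,
      Polynomial.eval_mul, h1, e0] at hGd
    simp only [Polynomial.derivative_C, Polynomial.eval_zero, zero_mul, Polynomial.eval_C,
      zero_add] at hGd
    exact_mod_cast hGd.symm
  have e2 : MvPolynomial.eval (fun i => x i + if i = m then t else 0) f = F / q * y := by
    rw [hfac, Polynomial.eval_mul, Polynomial.eval_C, hy1, e0] at hGt
    exact_mod_cast hGt.symm
  rw [e2, e1]
  have e3 : F / q * (L * q) / F = L := by field_simp
  rw [e3]
  calc F / q * y ≤ F / q * (q * Real.exp (t * L)) := by gcongr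
    _ = F * Real.exp (t * L) := by field_simp

lemma HStable.le_eval_pderiv {k : ℕ} {f : MvPolynomial (Fin n) ℝ} (hf : HStable (k + 1) f)
    (x : Fin n → ℝ) (hx : ∀ i, 0 ≤ x i) (hx' : ∃ i, 0 < x i) (m : Fin n) (K : ℝ)
    (hK : ∀ t : ℝ, 0 < t → K * t ≤ MvPolynomial.eval (fun i => x i + if i = m then t else 0) f) :
    K * Real.exp (-1) ≤ MvPolynomial.eval x (MvPolynomial.pderiv m f) := by
  have hF := hf.eval_pos x hx hx'
  have hD : 0 < MvPolynomial.eval x (MvPolynomial.pderiv m f) := (hf.pderiv m).eval_pos x hx hx'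
  have h := (hK _ (div_pos hF hD)).trans (hf.eval_line_le x hx hx' m _ (div_pos hF hD).le)
  set F := MvPolynomial.eval x f
  set D := MvPolynomial.eval x (MvPolynomial.pderiv m f)
  have e : F / D * (D / F) = 1 := by field_simp
  rw [e] at h
  have h2 : K ≤ D * Real.exp 1 := by
    have : K * (F / D) * (D / F) ≤ F * Real.exp 1 * (D / F) := by gcongr
    rw [mul_assoc, e, mul_one] at this
    calc K ≤ _ := this
      _ = D * Real.exp 1 := by field_simp
  calc K * Real.exp (-1) ≤ D * Real.exp 1 * Real.exp (-1) := by gcongr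
    _ = D := by rw [mul_assoc, ← Real.exp_add]; simp

/-- Successive partial derivatives in the first `j` variables. -/
def iterPderiv (p : MvPolynomial (Fin n) ℝ) : ℕ → MvPolynomial (Fin n) ℝ
  | 0 => p
  | j + 1 => if h : j < n then MvPolynomial.pderiv ⟨j, h⟩ (iterPderiv p j) else iterPderiv p j

lemma HStable.hstable_iterPderiv {p : MvPolynomial (Fin n) ℝ} (hp : HStable n p) (j : ℕ)
    (hj : j ≤ n) :
    HStable (n - j) (iterPderiv p j) := by
  induction j with
  | zero => exact hp
  | succ j ih =>
    have h : j < n := hj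
    simp only [iterPderiv, h, dite_true]
    have := ih h.le
    rw [show n - j = n - (j + 1) + 1 by omega] at this
    exact this.pderiv _

lemma coeff_iterPderiv (p : MvPolynomial (Fin n) ℝ) (j : ℕ) (hj : j ≤ n) (m : Fin n →₀ ℕ)
    (hm : ∀ i : Fin n, (i : ℕ) < j → m i = 0) :
    (iterPderiv p j).coeff m = p.coeff (Finsupp.equivFunOnFinite.symm
      fun i : Fin n => m i + if (i : ℕ) < j then 1 else 0) := by
  induction j generalizing m with
  | zero => simp [iterPderiv]
  | succ j ih =>
    have h : j < n := hj
    simp only [iterPderiv, h, dite_true, MvPolynomial.coeff_pderiv]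
    rw [ih h.le, hm ⟨j, h⟩ (by simp)]
    · simp only [Nat.cast_zero, zero_add, mul_one]
      congr 1
      ext i
      simp only [Finsupp.equivFunOnFinite_symm_apply_apply, Finsupp.add_apply, Finsupp.single_apply]
      by_cases h1 : (⟨j, h⟩ : Fin n) = i
      · subst h1; simp
      · have : (i : ℕ) ≠ j := fun h => h1 (Fin.ext h.symm)
        have h2 : ((i : ℕ) < j) ↔ (i : ℕ) < j + 1 := by omega
        simp [h1, h2]
    · intro i hi
      have : (⟨j, h⟩ : Fin n) ≠ i := fun h => by
        subst h; simp at hi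
      simp [this, hm i (by omega)]

/-- Gurvits' capacity inequality. -/
lemma HStable.exp_neg_le_coeff {p : MvPolynomial (Fin n) ℝ} (hn : 0 < n) (hp : HStable n p)
    (hcap : ∀ x : Fin n → ℝ, (∀ i, 0 ≤ x i) → ∏ i, x i ≤ MvPolynomial.eval x p) :
    Real.exp (-n) ≤ p.coeff (Finsupp.equivFunOnFinite.symm fun _ => 1) := by
  have key : ∀ j ≤ n, ∀ x : Fin n → ℝ, (∀ i, 0 ≤ x i) → (∃ i, 0 < x i) →
      Real.exp (-j) * ∏ i ∈ Finset.univ.filter (fun i : Fin n => j ≤ (i : ℕ)), x i ≤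
        MvPolynomial.eval x (iterPderiv p j) := by
    intro j
    induction j with
    | zero => intro _ x hx _; simpa [iterPderiv] using hcap x hx
    | succ j ih =>
      intro hj x hx hx'
      have h : j < n := hj
      simp only [iterPderiv, h, dite_true]
      have hs := hp.hstable_iterPderiv j h.le
      rw [show n - j = n - (j + 1) + 1 by omega] at hs
      have := hs.le_eval_pderiv x hx hx' ⟨j, h⟩
        (Real.exp (-j) * ∏ i ∈ Finset.univ.filter (fun i : Fin n => j + 1 ≤ (i : ℕ)), x i) ?_
      · refine le_trans (le_of_eq ?_) this
        push_cast
        rw [neg_add, Real.exp_add]; ring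
      · intro t ht
        refine le_trans ?_ (ih h.le _ (fun i => ?_) ?_)
        · have e : (Finset.univ.filter fun i : Fin n => j ≤ (i : ℕ)) =
              insert ⟨j, h⟩ (Finset.univ.filter fun i : Fin n => j + 1 ≤ (i : ℕ)) := by
            ext i
            simp only [Finset.mem_filter, Finset.mem_univ, true_and, Finset.mem_insert, Fin.ext_iff]
            omega
          rw [e, Finset.prod_insert (by simp)]
          have e2 : ∏ i ∈ Finset.univ.filter (fun i : Fin n => j + 1 ≤ (i : ℕ)),
              (x i + if i = ⟨j, h⟩ then t else 0) =
              ∏ i ∈ Finset.univ.filter (fun i : Fin n => j + 1 ≤ (i : ℕ)), x i := by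
            refine Finset.prod_congr rfl fun i hi => ?_
            have : i ≠ ⟨j, h⟩ := fun hh => by subst hh; simp at hi
            simp [this]
          rw [e2]
          have hP : 0 ≤ ∏ i ∈ Finset.univ.filter (fun i : Fin n => j + 1 ≤ (i : ℕ)), x i :=
            Finset.prod_nonneg fun i _ => hx i
          simp only [if_true]
          calc _ = Real.exp (-j) *
                (t * ∏ i ∈ Finset.univ.filter (fun i : Fin n => j + 1 ≤ (i : ℕ)), x i) := by ring
            _ ≤ _ := by
              gcongr
              linarith [hx ⟨j, h⟩]
        · split_ifs <;> linarith [hx i]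
        · exact ⟨⟨j, h⟩, by simp; linarith [hx ⟨j, h⟩]⟩
  have h1 := key n le_rfl (fun _ => 1) (by simp) ⟨⟨0, hn⟩, by simp⟩
  have h2 := coeff_iterPderiv p n le_rfl 0 (by simp)
  simp only [Finsupp.coe_zero, Pi.zero_apply, Fin.is_lt, if_true, zero_add] at h2
  rw [← h2]
  have h3 := (hp.hstable_iterPderiv n le_rfl).hom
  rw [Nat.sub_self] at h3
  rw [← MvPolynomial.totalDegree_zero_iff_isHomogeneous,
    MvPolynomial.totalDegree_eq_zero_iff_eq_C] at h3
  have h4 : MvPolynomial.eval (fun _ => (1 : ℝ)) (iterPderiv p n) =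
      (iterPderiv p n).coeff 0 := by
    conv_lhs => rw [h3]
    simp
  rw [h4] at h1
  refine le_trans (le_of_eq ?_) h1
  have : (Finset.univ.filter fun i : Fin n => n ≤ (i : ℕ)) = ∅ := by
    ext i; simp
  rw [this]; simp

end Capacity

section Permanent

variable {n : ℕ}

/-- The product of the linear forms given by the rows of `a`. -/
def rowProd (a : Fin n → Fin n → ℝ) : MvPolynomial (Fin n) ℝ :=
  ∏ i, ∑ j, MvPolynomial.C (a i j) * MvPolynomial.X j

lemma coeff_rowProd (a : Fin n → Fin n → ℝ) (m : Fin n →₀ ℕ) :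
    (rowProd a).coeff m = ∑ g : Fin n → Fin n,
      if (∑ i, Finsupp.single (g i) 1) = m then ∏ i, a i (g i) else 0 := by
  unfold rowProd
  rw [Finset.prod_univ_sum, MvPolynomial.coeff_sum, Fintype.piFinset_univ]
  refine Finset.sum_congr rfl fun g _ => ?_
  have : ∏ i, (MvPolynomial.C (a i (g i)) * MvPolynomial.X (g i)) =
      MvPolynomial.monomial (∑ i, Finsupp.single (g i) 1) (∏ i, a i (g i)) := by
    rw [MvPolynomial.monomial_sum_prod]
    exact Finset.prod_congr rfl fun i _ => MvPolynomial.C_mul_X_eq_monomial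
  rw [this, MvPolynomial.coeff_monomial]

lemma sum_single_eq_one_iff (g : Fin n → Fin n) :
    (∑ i, Finsupp.single (g i) 1 : Fin n →₀ ℕ) = (Finsupp.equivFunOnFinite.symm fun _ => 1) ↔
      Function.Bijective g := by
  rw [Finsupp.ext_iff]
  have h : ∀ k, (∑ i, Finsupp.single (g i) 1 : Fin n →₀ ℕ) k =
      (Finset.univ.filter fun i => g i = k).card := by
    intro k
    rw [Finsupp.finsetSum_apply]
    simp [Finsupp.single_apply]
  simp only [h, Finsupp.equivFunOnFinite_symm_apply_apply]
  constructor
  · intro hk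
    rw [← Finite.surjective_iff_bijective]
    intro k
    have : 0 < (Finset.univ.filter fun i => g i = k).card := by rw [hk]; exact one_pos
    obtain ⟨i, hi⟩ := Finset.card_pos.1 this
    exact ⟨i, (Finset.mem_filter.1 hi).2⟩
  · intro hg k
    obtain ⟨i, rfl⟩ := hg.2 k
    rw [Finset.card_eq_one]
    exact ⟨i, by ext j; simp [hg.1.eq_iff]⟩

lemma coeff_rowProd_one (a : Fin n → Fin n → ℝ) :
    (rowProd a).coeff (Finsupp.equivFunOnFinite.symm fun _ => 1) =
      ∑ σ : Equiv.Perm (Fin n), ∏ i, a i (σ i) := by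
  rw [coeff_rowProd]
  simp only [sum_single_eq_one_iff]
  rw [← Finset.sum_filter]
  symm
  refine Finset.sum_bij (fun σ _ => (σ : Fin n → Fin n)) ?_ ?_ ?_ ?_
  · intro σ _; exact Finset.mem_filter.2 ⟨Finset.mem_univ _, σ.bijective⟩
  · intro σ _ τ _ h; exact Equiv.ext fun i => congrFun h i
  · intro g hg
    exact ⟨Equiv.ofBijective g (Finset.mem_filter.1 hg).2, Finset.mem_univ _, rfl⟩
  · intro σ _; rfl

lemma hstable_rowProd {a : Fin n → Fin n → ℝ} (ha : ∀ i j, 0 < a i j) : HStable n (rowProd a) := by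
  refine ⟨?_, ?_, ?_⟩
  · have := MvPolynomial.IsHomogeneous.prod Finset.univ
      (fun i => ∑ j, MvPolynomial.C (a i j) * MvPolynomial.X (R := ℝ) j) (fun _ => 1)
      fun i _ => MvPolynomial.IsHomogeneous.sum _ _ _ fun j _ => by
        simpa using (MvPolynomial.isHomogeneous_C (Fin n) (a i j)).mul
          (MvPolynomial.isHomogeneous_X ℝ j)
    simpa [rowProd] using this
  · intro m
    rw [coeff_rowProd]
    refine Finset.sum_nonneg fun g _ => ?_
    split_ifs
    · exact Finset.prod_nonneg fun i _ => (ha _ _).le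
    · exact le_rfl
  · rintro x hx ⟨k, hk⟩
    unfold rowProd
    rw [map_prod, Finset.prod_ne_zero_iff]
    intro i _ h
    have h1 := congrArg Complex.re h
    simp only [map_sum, map_mul, MvPolynomial.aeval_C, MvPolynomial.aeval_X, Complex.re_sum,
      Complex.coe_algebraMap, Complex.re_ofReal_mul, Complex.zero_re] at h1
    have : 0 < ∑ j, a i j * (x j).re :=
      Finset.sum_pos' (fun j _ => mul_nonneg (ha i j).le (hx j))
        ⟨k, Finset.mem_univ _, mul_pos (ha i k) hk⟩
    linarith

lemma exp_neg_le_permanent_of_pos (hn : 0 < n) {a : Fin n → Fin n → ℝ} (ha : ∀ i j, 0 < a i j)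
    (hr : ∀ i, ∑ j, a i j = 1) (hc : ∀ j, ∑ i, a i j = 1) :
    Real.exp (-n) ≤ ∑ σ : Equiv.Perm (Fin n), ∏ i, a i (σ i) := by
  rw [← coeff_rowProd_one]
  refine (hstable_rowProd ha).exp_neg_le_coeff hn fun x hx => ?_
  unfold rowProd
  simp only [map_prod, map_sum, map_mul, MvPolynomial.eval_C, MvPolynomial.eval_X]
  calc ∏ j, x j = ∏ j, ∏ i, x j ^ a i j := by
        refine Finset.prod_congr rfl fun j _ => ?_
        rw [← Real.rpow_sum_of_nonneg (hx j) fun i _ => (ha i j).le, hc j, Real.rpow_one]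
    _ = ∏ i, ∏ j, x j ^ a i j := Finset.prod_comm
    _ ≤ _ := Finset.prod_le_prod
        (fun i _ => Finset.prod_nonneg fun j _ => Real.rpow_nonneg (hx j) _)
        fun i _ => Real.geom_mean_le_arith_mean_weighted _ _ _ (fun j _ => (ha i j).le) (hr i)
          fun j _ => hx j

/-- A doubly stochastic matrix has permanent at least `exp (-n)`. -/
lemma exp_neg_le_permanent (hn : 0 < n) {a : Fin n → Fin n → ℝ} (ha : ∀ i j, 0 ≤ a i j)
    (hr : ∀ i, ∑ j, a i j = 1) (hc : ∀ j, ∑ i, a i j = 1) :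
    Real.exp (-n) ≤ ∑ σ : Equiv.Perm (Fin n), ∏ i, a i (σ i) := by
  have hn' : (0 : ℝ) < n := by exact_mod_cast hn
  have hcont : Continuous fun t : ℝ =>
      ∑ σ : Equiv.Perm (Fin n), ∏ i, ((1 - t) * a i (σ i) + t / n) := by fun_prop
  have ht := (hcont.tendsto 0).mono_left (nhdsWithin_le_nhds (s := Set.Ioi 0))
  simp only [sub_zero, one_mul, zero_div, add_zero] at ht
  refine ge_of_tendsto ht ?_
  filter_upwards [Ioo_mem_nhdsGT (show (0 : ℝ) < 1 by norm_num)] with t ht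
  refine exp_neg_le_permanent_of_pos hn (a := fun i j => (1 - t) * a i j + t / n) ?_ ?_ ?_
  · intro i j
    have := mul_nonneg (sub_nonneg.2 ht.2.le) (ha i j)
    have := div_pos ht.1 hn'
    linarith
  · intro i
    rw [Finset.sum_add_distrib, ← Finset.mul_sum, hr i]
    simp; field_simp; ring
  · intro i
    rw [Finset.sum_add_distrib, ← Finset.mul_sum, hc i]
    simp; field_simp; ring

theorem le_card_perm_of_regular (R : Fin n → Finset (Fin n)) (d : ℕ) (hd : 0 < d)
    (hr : ∀ i, (R i).card = d) (hc : ∀ j, (Finset.univ.filter fun i => j ∈ R i).card = d) :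
    ((d : ℝ) * Real.exp (-1)) ^ n ≤
      (Finset.univ.filter fun σ : Equiv.Perm (Fin n) => ∀ i, σ i ∈ R i).card := by
  have hd' : (0 : ℝ) < d := by exact_mod_cast hd
  rcases Nat.eq_zero_or_pos n with rfl | hn
  · simp
  have h := exp_neg_le_permanent hn (a := fun i j => if j ∈ R i then (d : ℝ)⁻¹ else 0)
    (fun i j => by split_ifs <;> positivity)
    (fun i => by rw [← Finset.sum_filter]; simp [hr i, hd'.ne'])
    (fun j => by rw [← Finset.sum_filter]; simp [hc j, hd'.ne'])
  have e : ∀ σ : Equiv.Perm (Fin n), (∏ i, if σ i ∈ R i then (d : ℝ)⁻¹ else 0) =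
      if ∀ i, σ i ∈ R i then ((d : ℝ)⁻¹) ^ n else 0 := by
    intro σ
    split_ifs with hσ
    · rw [Finset.prod_congr rfl fun i _ => if_pos (hσ i)]; simp
    · push Not at hσ
      obtain ⟨i, hi⟩ := hσ
      exact Finset.prod_eq_zero (Finset.mem_univ i) (if_neg hi)
  simp only [e] at h
  rw [← Finset.sum_filter, Finset.sum_const, nsmul_eq_mul] at h
  have h2 : Real.exp (-n) = Real.exp (-1) ^ n := by
    rw [← Real.exp_nat_mul]; congr 1; ring
  rw [mul_pow, ← h2]
  calc (d : ℝ) ^ n * Real.exp (-n) ≤ (d : ℝ) ^ n * (_ * (d : ℝ)⁻¹ ^ n) := by gcongr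
    _ = _ := by rw [mul_comm, mul_assoc, ← mul_pow, inv_mul_cancel₀ hd'.ne', one_pow, mul_one]

end Permanent

/-! ### Counting sequences of permutations -/

lemma card_le_prod_of_image_le {n : ℕ} {α : Type*} [DecidableEq α] (key : Fin n → ℕ)
    (hkey : Function.Injective key) (S : Finset (Fin n → α)) (M : Fin n → ℝ) (hM : ∀ f, 0 ≤ M f)
    (h : ∀ s ∈ S, ∀ f, (((S.filter fun s' => ∀ l, key l < key f → s' l = s l).image
      fun s' => s' f).card : ℝ) ≤ M f) :
    (S.card : ℝ) ≤ ∏ f, M f := by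
  set T := (Finset.univ.sup key) + 1 with hT
  have hlt : ∀ f, key f < T := fun f => Nat.lt_succ_of_le (Finset.le_sup (Finset.mem_univ f))
  have main : ∀ k, ∀ s ∈ S, (((S.filter fun s' => ∀ l, key l < T - k → s' l = s l)).card : ℝ) ≤
      ∏ f ∈ Finset.univ.filter (fun f => T - k ≤ key f), M f := by
    intro k
    induction k with
    | zero =>
      intro s hs
      have h1 : (Finset.univ.filter (fun f => T - 0 ≤ key f)) = ∅ := by
        ext f; simpa using hlt f
      rw [h1, Finset.prod_empty]
      have : (S.filter fun s' => ∀ l, key l < T - 0 → s' l = s l).card ≤ 1 := by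
        refine Finset.card_le_one.2 fun a ha b hb => ?_
        funext l
        rw [(Finset.mem_filter.1 ha).2 l (hlt l), (Finset.mem_filter.1 hb).2 l (hlt l)]
      exact_mod_cast this
    | succ k ih =>
      intro s hs
      by_cases hk : T ≤ k
      · have e : T - (k + 1) = T - k := by omega
        rw [e]; exact ih s hs
      have e : T - k = T - (k + 1) + 1 := by omega
      rw [e] at ih
      set t := T - (k + 1)
      clear_value t
      by_cases hf : ∃ f, key f = t
      · obtain ⟨f, rfl⟩ := hf
        have e1 : Finset.univ.filter (fun g => key f ≤ key g) =
            insert f (Finset.univ.filter (fun g => key f + 1 ≤ key g)) := by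
          ext g
          simp only [Finset.mem_filter, Finset.mem_univ, true_and, Finset.mem_insert]
          have : g = f ↔ key g = key f := hkey.eq_iff.symm
          rw [this]; omega
        rw [e1, Finset.prod_insert (by simp)]
        set P := ∏ f ∈ Finset.univ.filter (fun g => key f + 1 ≤ key g), M f with hP
        have hP0 : 0 ≤ P := Finset.prod_nonneg fun g _ => hM g
        set B := S.filter fun s' => ∀ l, key l < key f → s' l = s l with hB
        have h2 : (B.card : ℝ) =
            ∑ x ∈ B.image (fun s' => s' f), ((B.filter fun s' => s' f = x).card : ℝ) := by
          rw [Finset.card_eq_sum_card_image (fun s' => s' f) B]; push_cast; rfl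
        rw [h2]
        calc _ ≤ ∑ x ∈ B.image (fun s' => s' f), P := by
              refine Finset.sum_le_sum fun x hx => ?_
              obtain ⟨s₁, hs₁, rfl⟩ := Finset.mem_image.1 hx
              have hs₁' := Finset.mem_filter.1 hs₁
              refine le_trans ?_ (ih s₁ hs₁'.1)
              have : (B.filter fun s' => s' f = s₁ f) ⊆
                  S.filter fun s' => ∀ l, key l < key f + 1 → s' l = s₁ l := by
                intro s' hs'
                obtain ⟨hs'B, he⟩ := Finset.mem_filter.1 hs'
                have hb := Finset.mem_filter.1 hs'B
                refine Finset.mem_filter.2 ⟨hb.1, fun l hl => ?_⟩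
                rcases Nat.lt_succ_iff_lt_or_eq.1 hl with h4 | h4
                · rw [hb.2 l h4, hs₁'.2 l h4]
                · rw [hkey h4, he]
              exact_mod_cast Finset.card_le_card this
          _ = ((B.image fun s' => s' f).card : ℝ) * P := by rw [Finset.sum_const, nsmul_eq_mul]
          _ ≤ M f * P := by
              gcongr
              exact h s hs f
      · have e1 : ∀ g, t ≤ key g ↔ t + 1 ≤ key g := fun g => by
          have : key g ≠ t := fun h => hf ⟨g, h⟩
          omega
        have e2 : ∀ g, key g < t ↔ key g < t + 1 := fun g => by
          have : key g ≠ t := fun h => hf ⟨g, h⟩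
          omega
        simp only [e1, e2]
        exact ih s hs
  rcases S.eq_empty_or_nonempty with rfl | ⟨s, hs⟩
  · simp; exact Finset.prod_nonneg fun g _ => hM g
  · simpa using main T s hs

lemma sum_rank {n : ℕ} (key : Fin n → ℕ) (hkey : Function.Injective key) (g : ℕ → ℝ) :
    ∑ f, g (Finset.univ.filter fun l => key l < key f).card = ∑ t ∈ Finset.range n, g t := by
  set r : Fin n → ℕ := fun f => (Finset.univ.filter fun l => key l < key f).card with hr
  have hmono : ∀ f f', key f < key f' → r f < r f' := by
    intro f f' h
    refine Finset.card_lt_card ⟨fun l hl => ?_, fun hc => ?_⟩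
    · simp only [Finset.mem_filter, Finset.mem_univ, true_and] at hl ⊢
      omega
    · have := hc (show f ∈ _ by simpa using h)
      simp at this
  have hinj : Function.Injective r := by
    intro f f' h
    rcases lt_trichotomy (key f) (key f') with h1 | h1 | h1
    · have := hmono _ _ h1; omega
    · exact hkey h1
    · have := hmono _ _ h1; omega
  have hsub : Finset.univ.image r ⊆ Finset.range n := by
    intro t ht
    obtain ⟨f, -, rfl⟩ := Finset.mem_image.1 ht
    rw [Finset.mem_range]
    have : (Finset.univ.filter fun l => key l < key f).card < (Finset.univ : Finset (Fin n)).card :=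
      Finset.card_lt_card ⟨Finset.filter_subset _ _, fun hc => by
        have := hc (Finset.mem_univ f)
        simp at this⟩
    simpa using this
  have himg : Finset.univ.image r = Finset.range n :=
    Finset.eq_of_subset_of_card_le hsub (by
      rw [Finset.card_image_of_injective _ hinj]; simp)
  rw [← himg, Finset.sum_image hinj.injOn]

/-- Sequences of pairwise disjoint permutations. -/
def latinSeqs (m n : ℕ) : Finset (Fin m → Equiv.Perm (Fin n)) :=
  Finset.univ.filter fun s => ∀ f g i, s f i = s g i → f = g

lemma mem_latinSeqs {m n : ℕ} {s : Fin m → Equiv.Perm (Fin n)} :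
    s ∈ latinSeqs m n ↔ ∀ f g i, s f i = s g i → f = g := by simp [latinSeqs]

lemma card_latinSeqs_succ {n t : ℕ} (ht : t < n) :
    ((latinSeqs t n).card : ℝ) * (((n - t : ℕ) : ℝ) * Real.exp (-1)) ^ n ≤
      (latinSeqs (t + 1) n).card := by
  set F : (Fin (t + 1) → Equiv.Perm (Fin n)) → (Fin t → Equiv.Perm (Fin n)) := Fin.init with hF
  have hmaps : ∀ s ∈ latinSeqs (t + 1) n, F s ∈ latinSeqs t n := by
    intro s hs
    rw [mem_latinSeqs] at hs ⊢
    intro f g i h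
    have := hs f.castSucc g.castSucc i h
    exact Fin.castSucc_injective _ this
  rw [Finset.card_eq_sum_card_fiberwise hmaps, Nat.cast_sum, ← nsmul_eq_mul, ← Finset.sum_const]
  refine Finset.sum_le_sum fun p hp => ?_
  rw [mem_latinSeqs] at hp
  set R : Fin n → Finset (Fin n) := fun i => (Finset.univ.image fun l => p l i)ᶜ with hR
  have h1 := le_card_perm_of_regular R (n - t) (by omega) ?_ ?_
  · refine h1.trans ?_
    norm_cast
    refine Finset.card_le_card_of_injOn
      (fun σ => Fin.snoc (α := fun _ => Equiv.Perm (Fin n)) p σ) ?_ ?_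
    · intro σ hσ
      have hσ' : ∀ i l, p l i ≠ σ i := by
        have := (Finset.mem_filter.1 hσ).2
        simpa [hR] using this
      rw [Finset.mem_coe, Finset.mem_filter, mem_latinSeqs]
      refine ⟨?_, by simp [hF]⟩
      intro f g i h
      induction f using Fin.lastCases with
      | last =>
        induction g using Fin.lastCases with
        | last => rfl
        | cast g => simp at h; exact absurd h.symm (hσ' i g)
      | cast f =>
        induction g using Fin.lastCases with
        | last => simp at h; exact absurd h (hσ' i f)
        | cast g => simp at h; rw [hp f g i h]
    · intro σ _ τ _ h
      have := congrFun h (Fin.last t)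
      simpa using this
  · intro i
    rw [hR, Finset.card_compl, Finset.card_image_of_injective _ fun f g h => hp f g i h]
    simp
  · intro j
    have : (Finset.univ.filter fun i => j ∈ R i) = (Finset.univ.image fun l => (p l).symm j)ᶜ := by
      ext i
      simp only [hR, Finset.mem_filter, Finset.mem_univ, true_and, Finset.mem_compl,
        Finset.mem_image, not_exists]
      refine forall_congr' fun l => not_congr ?_
      rw [Equiv.symm_apply_eq]; exact eq_comm
    rw [this, Finset.card_compl, Finset.card_image_of_injective]
    · simp
    · intro f g h
      refine hp f g ((p f).symm j) ?_
      simp only at h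
      rw [Equiv.apply_symm_apply, h, Equiv.apply_symm_apply]

lemma prod_le_card_latinSeqs {n : ℕ} (t : ℕ) (ht : t ≤ n) :
    ∏ k ∈ Finset.range t, (((n - k : ℕ) : ℝ) * Real.exp (-1)) ^ n ≤ (latinSeqs t n).card := by
  induction t with
  | zero => simp [latinSeqs]
  | succ t ih =>
    rw [Finset.prod_range_succ]
    refine le_trans ?_ (card_latinSeqs_succ ht)
    gcongr
    exact ih (by omega)

lemma log_factorial_le (d : ℕ) (hd : 0 < d) :
    Real.log d.factorial ≤ d * Real.log d - d + 1 + Real.log d := by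
  induction d, hd using Nat.le_induction with
  | base => simp
  | succ d hd ih =>
    have h0 : (0 : ℝ) < d := by exact_mod_cast hd
    rw [Nat.factorial_succ, Nat.cast_mul, Real.log_mul (by positivity) (by positivity)]
    have h1 : 1 - ((d + 1 : ℝ) / d)⁻¹ ≤ Real.log ((d + 1) / d) :=
      Real.one_sub_inv_le_log_of_pos (by positivity)
    rw [Real.log_div (by positivity) (by positivity)] at h1
    have h2 : ((d + 1 : ℝ) / d)⁻¹ = 1 - 1 / (d + 1) := by field_simp; ring
    rw [h2] at h1
    have h3 : (d + 1 : ℝ) * (1 / (d + 1)) = 1 := by field_simp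
    push_cast
    nlinarith

lemma lb_le {d n : ℕ} (hd : 0 < d) (hdn : d ≤ n) :
    lb d ≤ Real.log d - 1 + (1 + Real.log n) * (1 / d) := by
  have h0 : (0 : ℝ) < d := by exact_mod_cast hd
  have h1 := log_factorial_le d hd
  have h2 : Real.log d ≤ Real.log n := Real.log_le_log h0 (by exact_mod_cast hdn)
  unfold lb
  rw [div_le_iff₀ h0]
  have : (Real.log d - 1 + (1 + Real.log n) * (1 / d)) * d =
      d * Real.log d - d + 1 + Real.log n := by
    field_simp; ring
  linarith

lemma le_lb {d : ℕ} (hd : 0 < d) : Real.log d - 1 ≤ lb d := by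
  have h0 : (0 : ℝ) < d := by exact_mod_cast hd
  unfold lb
  rw [le_div_iff₀ h0]
  induction d, hd using Nat.le_induction with
  | base => simp
  | succ d hd ih =>
    have h0 : (0 : ℝ) < d := by exact_mod_cast hd
    rw [Nat.factorial_succ, Nat.cast_mul, Real.log_mul (by positivity) (by positivity)]
    have h1 : Real.log ((d + 1) / d) ≤ (d + 1 : ℝ) / d - 1 :=
      Real.log_le_sub_one_of_pos (by positivity)
    rw [Real.log_div (by positivity) (by positivity)] at h1
    have h2 : ((d + 1 : ℝ) / d) - 1 = 1 / d := by field_simp; ring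
    rw [h2] at h1
    have h3 : (d : ℝ) * (1 / d) = 1 := by field_simp
    have := ih h0
    push_cast
    nlinarith

lemma exp_sum_lb_le {n : ℕ} (hn : 0 < n) :
    Real.exp (∑ t ∈ Finset.range n, n * lb (n - t)) ≤
      (latinSeqs n n).card * Real.exp (n * (1 + Real.log n) ^ 2) := by
  have hlog : 0 ≤ Real.log n := Real.log_natCast_nonneg n
  have h1 := prod_le_card_latinSeqs (n := n) n le_rfl
  have h2 : ∏ k ∈ Finset.range n, (((n - k : ℕ) : ℝ) * Real.exp (-1)) ^ n =
      Real.exp (∑ t ∈ Finset.range n, n * (Real.log ((n - t : ℕ) : ℝ) - 1)) := by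
    rw [Real.exp_sum]
    refine Finset.prod_congr rfl fun k hk => ?_
    have : (0 : ℝ) < ((n - k : ℕ) : ℝ) := by
      have := Finset.mem_range.1 hk
      exact_mod_cast (by omega : 0 < n - k)
    rw [Real.exp_nat_mul, sub_eq_add_neg, Real.exp_add, Real.exp_log this]
  rw [h2] at h1
  have h3 : ∑ t ∈ Finset.range n, (n : ℝ) * lb (n - t) ≤
      ∑ t ∈ Finset.range n, n * (Real.log ((n - t : ℕ) : ℝ) - 1) + n * (1 + Real.log n) ^ 2 := by
    have h4 : ∀ t ∈ Finset.range n, (n : ℝ) * lb (n - t) ≤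
        n * (Real.log ((n - t : ℕ) : ℝ) - 1) + n * (1 + Real.log n) * (1 / ((n - t : ℕ) : ℝ)) := by
      intro t ht
      have := Finset.mem_range.1 ht
      have h5 := lb_le (d := n - t) (n := n) (by omega) (by omega)
      have h6 : (0 : ℝ) ≤ n := by positivity
      have := mul_le_mul_of_nonneg_left h5 h6
      linarith
    refine (Finset.sum_le_sum h4).trans ?_
    rw [Finset.sum_add_distrib, ← Finset.mul_sum (a := (n : ℝ) * (1 + Real.log n))]
    have h7 : ∑ t ∈ Finset.range n, (1 : ℝ) / ((n - t : ℕ) : ℝ) ≤ 1 + Real.log n := by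
      have e := Finset.sum_range_reflect (fun k => (1 : ℝ) / ((k + 1 : ℕ) : ℝ)) n
      have h8 := harmonic_le_one_add_log n
      unfold harmonic at h8
      push_cast at h8
      calc _ = ∑ j ∈ Finset.range n, (1 : ℝ) / ((n - 1 - j + 1 : ℕ) : ℝ) := by
            refine Finset.sum_congr rfl fun t ht => ?_
            have := Finset.mem_range.1 ht
            rw [show n - t = n - 1 - t + 1 by omega]
        _ = _ := e
        _ ≤ _ := by
          refine le_trans (le_of_eq ?_) h8
          refine Finset.sum_congr rfl fun t _ => ?_
          push_cast; rw [one_div]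
    have h9 : 0 ≤ n * (1 + Real.log n) := by positivity
    have := mul_le_mul_of_nonneg_left h7 h9
    nlinarith
  calc _ ≤ Real.exp (_ + n * (1 + Real.log n) ^ 2) := Real.exp_le_exp.2 h3
    _ = _ := Real.exp_add _ _
    _ ≤ _ := by gcongr

/-- If every colour in `J` has a restricted set of possible extensions, then there are few
sequences in `S`. -/
theorem card_le_of_restricted {n : ℕ} (hn : 0 < n) (key : Fin n → ℕ)
    (hkey : Function.Injective key) (S : Finset (Fin n → Equiv.Perm (Fin n)))
    (hS : S ⊆ latinSeqs n n) (J : Finset (Fin n)) (η : ℝ)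
    (h : ∀ s ∈ S, ∀ f ∈ J, (((S.filter fun s' => ∀ l, key l < key f → s' l = s l).image
      fun s' => s' f).card : ℝ) ≤
        Real.exp (n * lb (n - (Finset.univ.filter fun l => key l < key f).card)) *
          Real.exp (-η)) :
    (S.card : ℝ) ≤ (latinSeqs n n).card *
      Real.exp (n * (1 + Real.log n) ^ 2 - η * J.card) := by
  have h1 := card_le_prod_of_image_le key hkey S (fun f =>
    Real.exp (n * lb (n - (Finset.univ.filter fun l => key l < key f).card)) *
      (if f ∈ J then Real.exp (-η) else 1)) (fun f => by split_ifs <;> positivity) ?_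
  · refine h1.trans ?_
    rw [Finset.prod_mul_distrib, ← Real.exp_sum, sum_rank key hkey fun t => (n : ℝ) * lb (n - t),
      Finset.prod_ite_mem, Finset.univ_inter, Finset.prod_const, ← Real.exp_nat_mul]
    refine (mul_le_mul_of_nonneg_right (exp_sum_lb_le hn) (by positivity)).trans ?_
    rw [mul_assoc, ← Real.exp_add]
    apply le_of_eq
    congr 2; ring
  · intro s hs f
    split_ifs with hf
    · exact h s hs f hf
    · rw [mul_one]
      have hl := mem_latinSeqs.1 (hS hs)
      set R : Fin n → Finset (Fin n) := fun i =>
        ((Finset.univ.filter fun l => key l < key f).image fun l => s l i)ᶜ with hR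
      have hc : ∀ i, (R i).card = n - (Finset.univ.filter fun l => key l < key f).card := by
        intro i
        rw [hR, Finset.card_compl, Finset.card_image_of_injective _ fun f g h => hl f g i h]
        simp
      have h2 := card_perm_le R
      simp only [hc, Finset.sum_const, Finset.card_univ, Fintype.card_fin, nsmul_eq_mul] at h2
      refine le_trans ?_ h2
      norm_cast
      refine Finset.card_le_card fun σ hσ => ?_
      obtain ⟨s', hs', rfl⟩ := Finset.mem_image.1 hσ
      obtain ⟨hs'S, hag⟩ := Finset.mem_filter.1 hs'
      have hl' := mem_latinSeqs.1 (hS hs'S)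
      refine Finset.mem_filter.2 ⟨Finset.mem_univ _, fun i => ?_⟩
      simp only [hR, Finset.mem_compl, Finset.mem_image, Finset.mem_filter, Finset.mem_univ,
        true_and, not_exists, not_and]
      intro l hlt he
      rw [← hag l hlt] at he
      have := hl' l f i he
      subst this
      exact lt_irrefl _ hlt

lemma card_perm_many_hits_le {n m : ℕ} (hn : 0 < n) (W : Fin n → Finset (Fin n))
    (hW : ∀ i, (W i).card ≤ m) (hm : 1024 * m ≤ n) :
    ((Finset.univ.filter fun σ : Equiv.Perm (Fin n) =>
      n < 2 * (Finset.univ.filter fun i => σ i ∈ W i).card).card : ℝ) ≤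
      Real.exp (n * Real.log n - 4 * n * Real.log 2) := by
  have h1 : ∀ S : Finset (Fin n), n < 2 * S.card →
      (Finset.univ.filter fun σ : Equiv.Perm (Fin n) => ∀ i ∈ S, σ i ∈ W i).card * 2 ^ (5 * n) ≤
        n ^ n := by
    intro S hS
    have h2 : (Finset.univ.filter fun σ : Equiv.Perm (Fin n) => ∀ i ∈ S, σ i ∈ W i).card ≤
        m ^ S.card * n ^ (n - S.card) := by
      have h3 : (Fintype.piFinset fun i => if i ∈ S then W i else Finset.univ).card ≤
          m ^ S.card * n ^ (n - S.card) := by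
        rw [Fintype.card_piFinset]
        have h4 : ∀ i, (if i ∈ S then W i else Finset.univ).card ≤ if i ∈ S then m else n := by
          intro i; split_ifs
          · exact hW i
          · simp
        refine (Finset.prod_le_prod' fun i _ => h4 i).trans (le_of_eq ?_)
        rw [Finset.prod_ite, Finset.prod_const, Finset.prod_const]
        congr 2
        · simp
        · rw [show (Finset.univ.filter fun i => i ∉ S) = Sᶜ by ext; simp, Finset.card_compl]; simp
      refine le_trans ?_ h3
      refine Finset.card_le_card_of_injOn (fun σ => (σ : Fin n → Fin n)) ?_ ?_
      · intro σ hσ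
        have hσ' := (Finset.mem_filter.1 hσ).2
        rw [Finset.mem_coe, Fintype.mem_piFinset]
        intro i
        split_ifs with h
        · exact hσ' i h
        · simp
      · intro σ _ τ _ h; exact Equiv.ext fun i => congrFun h i
    have hSn : S.card ≤ n := by simpa using Finset.card_le_univ S
    calc _ ≤ m ^ S.card * n ^ (n - S.card) * 2 ^ (10 * S.card) := by
          refine Nat.mul_le_mul h2 (Nat.pow_le_pow_right (by norm_num) (by omega))
      _ = (1024 * m) ^ S.card * n ^ (n - S.card) := by
          rw [pow_mul, mul_pow]; norm_num; ring
      _ ≤ n ^ S.card * n ^ (n - S.card) := by gcongr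
      _ = n ^ n := by rw [← pow_add]; congr 1; omega
  have h5 : (Finset.univ.filter fun σ : Equiv.Perm (Fin n) =>
      n < 2 * (Finset.univ.filter fun i => σ i ∈ W i).card).card * 2 ^ (5 * n) ≤ 2 ^ n * n ^ n := by
    have h6 : (Finset.univ.filter fun σ : Equiv.Perm (Fin n) =>
        n < 2 * (Finset.univ.filter fun i => σ i ∈ W i).card) ⊆
        ((Finset.univ : Finset (Finset (Fin n))).filter fun S => n < 2 * S.card).biUnion fun S =>
          Finset.univ.filter fun σ : Equiv.Perm (Fin n) => ∀ i ∈ S, σ i ∈ W i := by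
      intro σ hσ
      rw [Finset.mem_biUnion]
      refine ⟨Finset.univ.filter fun i => σ i ∈ W i, ?_, ?_⟩
      · simpa using hσ
      · simp
    calc _ ≤ _ := Nat.mul_le_mul_right _ ((Finset.card_le_card h6).trans Finset.card_biUnion_le)
      _ = ∑ S ∈ (Finset.univ : Finset (Finset (Fin n))).filter (fun S => n < 2 * S.card),
          (Finset.univ.filter fun σ : Equiv.Perm (Fin n) => ∀ i ∈ S, σ i ∈ W i).card *
            2 ^ (5 * n) := Finset.sum_mul _ _ _
      _ ≤ ∑ S ∈ (Finset.univ : Finset (Finset (Fin n))).filter (fun S => n < 2 * S.card), n ^ n :=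
          Finset.sum_le_sum fun S hS => h1 S (Finset.mem_filter.1 hS).2
      _ ≤ _ := by
          rw [Finset.sum_const, smul_eq_mul]
          gcongr
          refine (Finset.card_filter_le _ _).trans (by simp)
  have h7 : ((Finset.univ.filter fun σ : Equiv.Perm (Fin n) =>
      n < 2 * (Finset.univ.filter fun i => σ i ∈ W i).card).card : ℝ) * 2 ^ (5 * n) ≤
      2 ^ n * n ^ n := by exact_mod_cast h5
  have e : Real.exp (n * Real.log n - 4 * n * Real.log 2) = (n : ℝ) ^ n / 2 ^ (4 * n) := by
    rw [Real.exp_sub, Real.exp_nat_mul, Real.exp_log (by exact_mod_cast hn)]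
    congr 1
    rw [show (4 : ℝ) * n * Real.log 2 = ((4 * n : ℕ) : ℝ) * Real.log 2 by push_cast; ring,
      Real.exp_nat_mul, Real.exp_log (by norm_num)]
  rw [e, le_div_iff₀ (by positivity)]
  have h8 : (2 : ℝ) ^ (5 * n) = 2 ^ n * 2 ^ (4 * n) := by rw [← pow_add]; congr 1; ring
  rw [h8] at h7
  have h9 : (0 : ℝ) < 2 ^ n := by positivity
  refine le_of_mul_le_mul_left ?_ h9
  linarith

lemma card_small_subsets_le {n : ℕ} (r L : ℝ) (hL : 0 ≤ L) :
    ((Finset.univ.filter fun S : Finset (Fin n) => (S.card : ℝ) ≤ r).card : ℝ) ≤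
      Real.exp (r * L + n * Real.exp (-L)) := by
  have h1 : ∀ S ∈ Finset.univ.filter (fun S : Finset (Fin n) => (S.card : ℝ) ≤ r),
      (1 : ℝ) ≤ Real.exp (r * L) * Real.exp (-L) ^ S.card := by
    intro S hS
    have := (Finset.mem_filter.1 hS).2
    rw [← Real.exp_nat_mul, ← Real.exp_add, Real.one_le_exp_iff]
    nlinarith
  have h2 : ∑ S : Finset (Fin n), Real.exp (-L) ^ S.card = (1 + Real.exp (-L)) ^ n := by
    have := Finset.sum_pow_mul_eq_add_pow (Real.exp (-L)) 1 (Finset.univ : Finset (Fin n))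
    simpa [add_comm] using this
  calc _ = ∑ S ∈ Finset.univ.filter (fun S : Finset (Fin n) => (S.card : ℝ) ≤ r), (1 : ℝ) := by simp
    _ ≤ _ := Finset.sum_le_sum h1
    _ ≤ ∑ S : Finset (Fin n), Real.exp (r * L) * Real.exp (-L) ^ S.card :=
        Finset.sum_le_sum_of_subset_of_nonneg (Finset.filter_subset _ _) fun _ _ _ => by positivity
    _ = Real.exp (r * L) * (1 + Real.exp (-L)) ^ n := by rw [← Finset.mul_sum, h2]
    _ ≤ Real.exp (r * L) * Real.exp (Real.exp (-L)) ^ n := by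
        gcongr
        rw [add_comm]; exact Real.add_one_le_exp _
    _ = _ := by rw [← Real.exp_nat_mul, ← Real.exp_add]

lemma lb_sub_le {n d t : ℕ} (hn : 0 < n) (hdn : d ≤ n) (ht : n ≤ 4 * (d - t)) :
    lb (d - t) ≤ lb d - t / n + 4 * (1 + Real.log n) / n := by
  have h0 : 0 < d - t := by omega
  have hd : 0 < d := by omega
  have hn' : (0 : ℝ) < n := by exact_mod_cast hn
  have hd' : (0 : ℝ) < d := by exact_mod_cast hd
  have h0' : (0 : ℝ) < ((d - t : ℕ) : ℝ) := by exact_mod_cast h0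
  have hlog : 0 ≤ Real.log n := Real.log_natCast_nonneg n
  have h1 := lb_le h0 ((Nat.sub_le d t).trans hdn)
  have h2 := le_lb hd
  have h3 : Real.log ((d - t : ℕ) : ℝ) - Real.log d ≤ - (t / n) := by
    rw [← Real.log_div h0'.ne' hd'.ne']
    refine (Real.log_le_sub_one_of_pos (by positivity)).trans ?_
    rw [Nat.cast_sub (by omega), sub_div, div_self hd'.ne']
    have : (t : ℝ) / n ≤ t / d := by gcongr
    linarith
  have h4 : (1 + Real.log n) * (1 / ((d - t : ℕ) : ℝ)) ≤ 4 * (1 + Real.log n) / n := by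
    rw [show 4 * (1 + Real.log n) / n = (1 + Real.log n) * (4 / n) by ring]
    have : (n : ℝ) ≤ 4 * ((d - t : ℕ) : ℝ) := by exact_mod_cast ht
    refine mul_le_mul_of_nonneg_left ?_ (by positivity)
    rw [div_le_div_iff₀ h0' hn']
    linarith
  linarith

lemma card_perm_few_hits_le {n d : ℕ} (hn : 0 < n) (R T : Fin n → Finset (Fin n))
    (hR : ∀ i, (R i).card = d) (hdn : d ≤ n) (hTR : ∀ i, T i ⊆ R i)
    (hT : ∀ i, n ≤ 4 * (d - (T i).card)) (τ ρ L : ℝ) (hL : 0 ≤ L)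
    (hsum : τ * n ^ 2 ≤ ∑ i, ((T i).card : ℝ)) :
    ((Finset.univ.filter fun σ : Equiv.Perm (Fin n) => (∀ i, σ i ∈ R i) ∧
      ((Finset.univ.filter fun i => σ i ∈ T i).card : ℝ) ≤ ρ * n).card : ℝ) ≤
      Real.exp (n * lb d) * Real.exp (ρ * n * L + n * Real.exp (-L) - (τ - ρ) * n +
        4 * (1 + Real.log n)) := by
  have hn' : (0 : ℝ) < n := by exact_mod_cast hn
  have hlog : 0 ≤ Real.log n := Real.log_natCast_nonneg n
  set 𝒮 := Finset.univ.filter fun S : Finset (Fin n) => (S.card : ℝ) ≤ ρ * n with h𝒮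
  set B : ℝ := Real.exp (n * lb d - (τ - ρ) * n + 4 * (1 + Real.log n)) with hB
  have h1 : ∀ S ∈ 𝒮, ((Finset.univ.filter fun σ : Equiv.Perm (Fin n) =>
      ∀ i, σ i ∈ if i ∈ S then R i else R i \ T i).card : ℝ) ≤ B := by
    intro S hS
    have hS' := (Finset.mem_filter.1 hS).2
    refine (card_perm_le _).trans (Real.exp_le_exp.2 ?_)
    have h2 : ∀ i, lb (if i ∈ S then R i else R i \ T i).card ≤
        lb d - (T i).card / n + 4 * (1 + Real.log n) / n + if i ∈ S then 1 else 0 := by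
      intro i
      have hti : (T i).card ≤ d := hR i ▸ Finset.card_le_card (hTR i)
      split_ifs with h
      · rw [hR i]
        have : ((T i).card : ℝ) / n ≤ 1 := by
          rw [div_le_one hn']; exact_mod_cast hti.trans hdn
        have : 0 ≤ 4 * (1 + Real.log n) / n := by positivity
        linarith
      · rw [Finset.card_sdiff_of_subset (hTR i), hR i, add_zero]
        exact lb_sub_le hn hdn (hT i)
    refine (Finset.sum_le_sum fun i _ => h2 i).trans ?_
    rw [Finset.sum_add_distrib, Finset.sum_add_distrib, Finset.sum_sub_distrib, ← Finset.sum_div]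
    simp only [Finset.sum_const, Finset.card_univ, Fintype.card_fin, nsmul_eq_mul]
    have h3 : τ * n ≤ (∑ i, ((T i).card : ℝ)) / n := by
      rw [le_div_iff₀ hn']; linarith
    have h4 : (∑ i, if i ∈ S then (1 : ℝ) else 0) = S.card := by simp
    rw [h4]
    have h5 : (n : ℝ) * (4 * (1 + Real.log n) / n) = 4 * (1 + Real.log n) := by field_simp
    rw [h5]
    linarith
  have h6 : (Finset.univ.filter fun σ : Equiv.Perm (Fin n) => (∀ i, σ i ∈ R i) ∧
      ((Finset.univ.filter fun i => σ i ∈ T i).card : ℝ) ≤ ρ * n) ⊆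
      𝒮.biUnion fun S => Finset.univ.filter fun σ : Equiv.Perm (Fin n) =>
        ∀ i, σ i ∈ if i ∈ S then R i else R i \ T i := by
    intro σ hσ
    obtain ⟨-, ha, hb⟩ := Finset.mem_filter.1 hσ
    rw [Finset.mem_biUnion]
    refine ⟨Finset.univ.filter fun i => σ i ∈ T i, by simp [h𝒮, hb], ?_⟩
    simp only [Finset.mem_filter, Finset.mem_univ, true_and]
    intro i
    split_ifs with h
    · exact ha i
    · exact Finset.mem_sdiff.2 ⟨ha i, h⟩
  calc _ ≤ ((∑ S ∈ 𝒮, (Finset.univ.filter fun σ : Equiv.Perm (Fin n) =>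
        ∀ i, σ i ∈ if i ∈ S then R i else R i \ T i).card : ℕ) : ℝ) := by
        exact_mod_cast (Finset.card_le_card h6).trans Finset.card_biUnion_le
    _ ≤ ∑ S ∈ 𝒮, B := by push_cast; exact Finset.sum_le_sum h1
    _ = 𝒮.card * B := by rw [Finset.sum_const, nsmul_eq_mul]
    _ ≤ Real.exp (ρ * n * L + n * Real.exp (-L)) * B := by
        gcongr
        exact card_small_subsets_le _ _ hL
    _ = _ := by rw [hB, ← Real.exp_add, ← Real.exp_add]; congr 1; ring

/-- An order on colours: first by the class `cls`, then by value. -/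
def classKey {n : ℕ} (cls : Fin n → ℕ) (f : Fin n) : ℕ := cls f * n + f

lemma classKey_lt_iff {n : ℕ} (cls : Fin n → ℕ) (l f : Fin n) :
    classKey cls l < classKey cls f ↔ cls l < cls f ∨ cls l = cls f ∧ l < f := by
  unfold classKey
  have hl := l.2
  have hf := f.2
  rcases lt_trichotomy (cls l) (cls f) with h | h | h
  · have : (cls l + 1) * n ≤ cls f * n := Nat.mul_le_mul_right n h
    rw [add_mul] at this
    simp only [h, true_or, iff_true]
    omega
  · simp only [h, lt_self_iff_false, false_or, true_and, Fin.lt_def]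
    omega
  · have : (cls f + 1) * n ≤ cls l * n := Nat.mul_le_mul_right n h
    rw [add_mul] at this
    simp only [h.not_gt, h.ne', false_or, false_and, iff_false]
    omega

lemma classKey_injective {n : ℕ} (cls : Fin n → ℕ) : Function.Injective (classKey cls) := by
  intro l f h
  have h1 := (classKey_lt_iff cls l f).not.1 h.not_lt
  have h2 := (classKey_lt_iff cls f l).not.1 h.not_gt
  push Not at h1 h2
  have h3 := le_antisymm h2.1 h1.1
  exact le_antisymm (h2.2 h3.symm) (h1.2 h3)

/-- The pairs `(x₄, x₆)` which, joined by an arc coloured like `x₁ → v`, would close a gadget with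
colours `f₂ ∈ F₂` and `f₃ ∈ F₃`. -/
def closingPairs {n : ℕ} (s : Fin n → Equiv.Perm (Fin n)) (v c : Fin n) (F₂ F₃ : Finset (Fin n))
    (x₁ : Fin n) : Finset (Fin n × Fin n) :=
  Finset.univ.filter fun p => ∃ f₂ ∈ F₂, ∃ f₃ ∈ F₃, s f₃ x₁ = s f₂ v ∧
    ∃ x₃, p.1 = s f₃ x₃ ∧ p.2 = s c (s f₂ x₃)

lemma closingPairs_congr {n : ℕ} {s s' : Fin n → Equiv.Perm (Fin n)} {v c : Fin n}
    {F₂ F₃ : Finset (Fin n)} (hc : s c = s' c) (h₂ : ∀ f ∈ F₂, s f = s' f)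
    (h₃ : ∀ f ∈ F₃, s f = s' f) (x₁ : Fin n) :
    closingPairs s v c F₂ F₃ x₁ = closingPairs s' v c F₂ F₃ x₁ := by
  ext p
  simp only [closingPairs, Finset.mem_filter, Finset.mem_univ, true_and]
  constructor
  · rintro ⟨f₂, hf₂, f₃, hf₃, h, x₃, h4, h6⟩
    exact ⟨f₂, hf₂, f₃, hf₃, by rw [← h₂ _ hf₂, ← h₃ _ hf₃, h], x₃, by rw [← h₃ _ hf₃, h4],
      by rw [← hc, ← h₂ _ hf₂, h6]⟩
  · rintro ⟨f₂, hf₂, f₃, hf₃, h, x₃, h4, h6⟩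
    exact ⟨f₂, hf₂, f₃, hf₃, by rw [h₂ _ hf₂, h₃ _ hf₃, h], x₃, by rw [h₃ _ hf₃, h4],
      by rw [hc, h₂ _ hf₂, h6]⟩

lemma card_closingPairs_fst_le {n : ℕ} {s : Fin n → Equiv.Perm (Fin n)} (hs : s ∈ latinSeqs n n)
    (v c : Fin n) (F₂ F₃ : Finset (Fin n)) (x₁ x₆ : Fin n) :
    (Finset.univ.filter fun x₄ => (x₄, x₆) ∈ closingPairs s v c F₂ F₃ x₁).card ≤ F₂.card := by
  have h : ∀ x₄, ∃ f₂, (x₄, x₆) ∈ closingPairs s v c F₂ F₃ x₁ → f₂ ∈ F₂ ∧ ∃ f₃ ∈ F₃,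
      s f₃ x₁ = s f₂ v ∧ ∃ x₃, x₄ = s f₃ x₃ ∧ x₆ = s c (s f₂ x₃) := by
    intro x₄
    by_cases h : (x₄, x₆) ∈ closingPairs s v c F₂ F₃ x₁
    · obtain ⟨f₂, hf₂, h'⟩ := (Finset.mem_filter.1 h).2
      exact ⟨f₂, fun _ => ⟨hf₂, h'⟩⟩
    · exact ⟨x₄, fun h' => absurd h' h⟩
  choose g hg using h
  refine Finset.card_le_card_of_injOn g (fun x hx => (hg x (Finset.mem_filter.1 hx).2).1) ?_
  intro x hx y hy hxy
  obtain ⟨-, f₃, -, h1, x₃, h2, h3⟩ := hg x (Finset.mem_filter.1 hx).2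
  obtain ⟨-, f₃', -, h1', x₃', h2', h3'⟩ := hg y (Finset.mem_filter.1 hy).2
  rw [← hxy] at h1' h3'
  have e1 : f₃ = f₃' := mem_latinSeqs.1 hs _ _ x₁ (h1.trans h1'.symm)
  have e2 : x₃ = x₃' := (s (g x)).injective ((s c).injective (h3.symm.trans h3'))
  rw [h2, h2', e1, e2]

lemma card_closingPairs_snd_le {n : ℕ} {s : Fin n → Equiv.Perm (Fin n)} (hs : s ∈ latinSeqs n n)
    (v c : Fin n) (F₂ F₃ : Finset (Fin n)) (x₁ x₄ : Fin n) :
    (Finset.univ.filter fun x₆ => (x₄, x₆) ∈ closingPairs s v c F₂ F₃ x₁).card ≤ F₂.card := by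
  have h : ∀ x₆, ∃ f₂, (x₄, x₆) ∈ closingPairs s v c F₂ F₃ x₁ → f₂ ∈ F₂ ∧ ∃ f₃ ∈ F₃,
      s f₃ x₁ = s f₂ v ∧ ∃ x₃, x₄ = s f₃ x₃ ∧ x₆ = s c (s f₂ x₃) := by
    intro x₆
    by_cases h : (x₄, x₆) ∈ closingPairs s v c F₂ F₃ x₁
    · obtain ⟨f₂, hf₂, h'⟩ := (Finset.mem_filter.1 h).2
      exact ⟨f₂, fun _ => ⟨hf₂, h'⟩⟩
    · exact ⟨x₄, fun h' => absurd h' h⟩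
  choose g hg using h
  refine Finset.card_le_card_of_injOn g (fun x hx => (hg x (Finset.mem_filter.1 hx).2).1) ?_
  intro x hx y hy hxy
  obtain ⟨-, f₃, -, h1, x₃, h2, h3⟩ := hg x (Finset.mem_filter.1 hx).2
  obtain ⟨-, f₃', -, h1', x₃', h2', h3'⟩ := hg y (Finset.mem_filter.1 hy).2
  rw [← hxy] at h1' h3'
  have e1 : f₃ = f₃' := mem_latinSeqs.1 hs _ _ x₁ (h1.trans h1'.symm)
  subst e1
  have e2 : x₃ = x₃' := (s f₃).injective (h2.symm.trans h2')
  rw [h3, h3', e2]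

/-- The colour class `f` creates many repetitions among the closing pairs of smaller colours. -/
def Repetitive {n : ℕ} (s : Fin n → Equiv.Perm (Fin n)) (v c : Fin n) (F₂ F₃ : Finset (Fin n))
    (f : Fin n) : Prop :=
  ∃ x₁, ∃ f₂ ∈ F₂, n < 2 * (Finset.univ.filter fun x₃ =>
    (s f x₃, s c (s f₂ x₃)) ∈ closingPairs s v c F₂ (F₃.filter (· < f)) x₁).card

theorem card_repetitive_le {n m : ℕ} (hn : 0 < n) (hm : 1024 * m ≤ n) (hm0 : 0 < m)
    (hlog : 4 * Real.log n ≤ n) (v c : Fin n) (F₂ F₃ J : Finset (Fin n)) (hc₂ : c ∉ F₂)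
    (hc₃ : c ∉ F₃) (hF : Disjoint F₂ F₃) (hJ : J ⊆ F₃) (h₂ : F₂.card ≤ m) (h₃ : F₃.card ≤ m) :
    (((latinSeqs n n).filter fun s => ∀ f ∈ J, Repetitive s v c F₂ F₃ f).card : ℝ) ≤
      (latinSeqs n n).card * Real.exp (n * (1 + Real.log n) ^ 2 - (n / 2 : ℝ) * J.card) := by
  have hn' : (0 : ℝ) < n := by exact_mod_cast hn
  set cls : Fin n → ℕ := fun f => if f = c then 0 else if f ∈ F₂ then 1 else if f ∈ F₃ then 2
    else 3 with hcls
  obtain ⟨S, hS⟩ : ∃ S, S = (latinSeqs n n).filter fun s => ∀ f ∈ J, Repetitive s v c F₂ F₃ f :=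
    ⟨_, rfl⟩
  have hmem : ∀ s, s ∈ S ↔ s ∈ latinSeqs n n ∧ ∀ f ∈ J, Repetitive s v c F₂ F₃ f := by
    intro s; rw [hS, Finset.mem_filter]
  rw [← hS]
  refine card_le_of_restricted hn (classKey cls) (classKey_injective cls) S
    (fun s hs => ((hmem s).1 hs).1) J (n / 2) ?_
  intro s hs f hf
  have hsl := ((hmem s).1 hs).1
  have hfF := hJ hf
  have hfc : f ≠ c := fun h => hc₃ (h ▸ hfF)
  have hf2 : f ∉ F₂ := Finset.disjoint_right.1 hF hfF
  have hclsf : cls f = 2 := by simp [hcls, hfc, hf2, hfF]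
  have hc_lt : classKey cls c < classKey cls f := by
    rw [classKey_lt_iff, hclsf]; left; simp [hcls]
  have h2_lt : ∀ l ∈ F₂, classKey cls l < classKey cls f := by
    intro l hl
    rw [classKey_lt_iff, hclsf]; left
    have : l ≠ c := fun h => hc₂ (h ▸ hl)
    simp [hcls, this, hl]
  have h3_lt : ∀ l ∈ F₃.filter (· < f), classKey cls l < classKey cls f := by
    intro l hl
    rw [Finset.mem_filter] at hl
    rw [classKey_lt_iff, hclsf]; right
    have h1 : l ≠ c := fun h => hc₃ (h ▸ hl.1)
    have h2 : l ∉ F₂ := Finset.disjoint_right.1 hF hl.1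
    exact ⟨by simp [hcls, h1, h2, hl.1], hl.2⟩
  have ht : (Finset.univ.filter fun l => classKey cls l < classKey cls f).card ≤ 1 + 2 * m := by
    have hsub : (Finset.univ.filter fun l => classKey cls l < classKey cls f) ⊆
        insert c (F₂ ∪ F₃) := by
      intro l hl
      rw [Finset.mem_filter, classKey_lt_iff, hclsf] at hl
      by_contra h
      simp only [Finset.mem_insert, Finset.mem_union, not_or] at h
      have : cls l = 3 := by simp [hcls, h]
      omega
    refine (Finset.card_le_card hsub).trans ((Finset.card_insert_le _ _).trans ?_)
    have := Finset.card_union_le F₂ F₃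
    omega
  set t := (Finset.univ.filter fun l => classKey cls l < classKey cls f).card
  set W : Fin n → Fin n → Fin n → Finset (Fin n) := fun x₁ f₂ x₃ => Finset.univ.filter fun x₄ =>
    (x₄, s c (s f₂ x₃)) ∈ closingPairs s v c F₂ (F₃.filter (· < f)) x₁ with hW
  have hsub : (S.filter fun s' =>
      ∀ l, classKey cls l < classKey cls f → s' l = s l).image (fun s' => s' f) ⊆
      (Finset.univ : Finset (Fin n × Fin n)).biUnion fun q =>
        Finset.univ.filter fun σ : Equiv.Perm (Fin n) =>
          n < 2 * (Finset.univ.filter fun i => σ i ∈ W q.1 q.2 i).card := by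
    intro σ hσ
    obtain ⟨s', hs', rfl⟩ := Finset.mem_image.1 hσ
    obtain ⟨hs', hhist⟩ := Finset.mem_filter.1 hs'
    obtain ⟨x₁, f₂, hf₂, hlt⟩ := ((hmem s').1 hs').2 f hf
    refine Finset.mem_biUnion.2 ⟨(x₁, f₂), Finset.mem_univ _, Finset.mem_filter.2
      ⟨Finset.mem_univ _, ?_⟩⟩
    rw [closingPairs_congr (hhist c hc_lt) (fun l hl => hhist l (h2_lt l hl))
      (fun l hl => hhist l (h3_lt l hl)), hhist c hc_lt, hhist f₂ (h2_lt f₂ hf₂)] at hlt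
    simpa [hW] using hlt
  have hcard : ((S.filter fun s' =>
      ∀ l, classKey cls l < classKey cls f → s' l = s l).image (fun s' => s' f)).card ≤
      (n : ℝ) ^ 2 * Real.exp (n * Real.log n - 4 * n * Real.log 2) := by
    refine (Nat.cast_le.2 (Finset.card_le_card hsub)).trans ?_
    refine (Nat.cast_le.2 Finset.card_biUnion_le).trans ?_
    rw [Nat.cast_sum]
    refine (Finset.sum_le_card_nsmul _ _ (Real.exp (n * Real.log n - 4 * n * Real.log 2))
      fun q _ => ?_).trans (le_of_eq ?_)
    · have hWq : ∀ i, (W q.1 q.2 i).card ≤ m :=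
        fun i => (card_closingPairs_fst_le hsl v c F₂ _ q.1 _).trans h₂
      exact card_perm_many_hits_le hn (W q.1 q.2) hWq hm
    · rw [Finset.card_univ, Fintype.card_prod, Fintype.card_fin, nsmul_eq_mul, Nat.cast_mul, sq]
  refine hcard.trans ?_
  have hd : n ≤ 2 * (n - t) := by omega
  have hd0 : 0 < n - t := by omega
  have hlb := le_lb hd0
  have hd' : (n : ℝ) / 2 ≤ ((n - t : ℕ) : ℝ) := by
    rw [div_le_iff₀ (by norm_num)]
    exact_mod_cast (mul_comm 2 (n - t)) ▸ hd
  have hlogd := Real.log_le_log (by positivity) hd'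
  rw [Real.log_div hn'.ne' (by norm_num)] at hlogd
  have h1 : (n : ℝ) * (Real.log n - Real.log 2 - 1) ≤ n * lb (n - t) := by gcongr; linarith
  have h2 : (n : ℝ) ^ 2 = Real.exp (2 * Real.log n) := by
    rw [two_mul, Real.exp_add, Real.exp_log hn']; ring
  rw [h2, ← Real.exp_add, ← Real.exp_add, Real.exp_le_exp]
  have := Real.log_two_gt_d9
  nlinarith

/-- The vertices determined by `x₁`, `x₃` and the colours `f₂`, `f₃` are those of a
`(v, c)`-absorbing gadget lacking only the arc `x₄ → x₆`, and they avoid `U`. -/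
def IsNearGadget {n : ℕ} (s : Fin n → Equiv.Perm (Fin n)) (v c : Fin n) (U : Finset (Fin n))
    (x₁ f₂ f₃ x₃ : Fin n) : Prop :=
  s f₃ x₁ = s f₂ v ∧
  ([v, x₁, s f₂ v, x₃, s f₃ x₃, s f₂ x₃, s c (s f₂ x₃)] : List (Fin n)).Nodup ∧
  ∀ u ∈ ([x₁, s f₂ v, x₃, s f₃ x₃, s f₂ x₃, s c (s f₂ x₃)] : List (Fin n)), u ∉ U

/-- The pairs `(x₄, x₆)` which close a gadget avoiding `U` and which are not yet covered by arcs
with a colour in `F₂ ∪ F₃ ∪ {c}`. -/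
def gadgetPairs {n : ℕ} (s : Fin n → Equiv.Perm (Fin n)) (v c : Fin n) (U F₂ F₃ : Finset (Fin n))
    (x₁ : Fin n) : Finset (Fin n × Fin n) :=
  Finset.univ.filter fun p => (∃ f₂ ∈ F₂, ∃ f₃ ∈ F₃, ∃ x₃, IsNearGadget s v c U x₁ f₂ f₃ x₃ ∧
    p.1 = s f₃ x₃ ∧ p.2 = s c (s f₂ x₃)) ∧ ∀ l, l = c ∨ l ∈ F₂ ∨ l ∈ F₃ → s l p.1 ≠ p.2

lemma gadgetPairs_congr {n : ℕ} {s s' : Fin n → Equiv.Perm (Fin n)} {v c : Fin n}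
    {U F₂ F₃ : Finset (Fin n)} (h : ∀ l, l = c ∨ l ∈ F₂ ∨ l ∈ F₃ → s l = s' l) (x₁ : Fin n) :
    gadgetPairs s v c U F₂ F₃ x₁ = gadgetPairs s' v c U F₂ F₃ x₁ := by
  have hc := h c (Or.inl rfl)
  have h₂ : ∀ f ∈ F₂, s f = s' f := fun f hf => h f (Or.inr (Or.inl hf))
  have h₃ : ∀ f ∈ F₃, s f = s' f := fun f hf => h f (Or.inr (Or.inr hf))
  ext p
  simp only [gadgetPairs, Finset.mem_filter, Finset.mem_univ, true_and]
  refine and_congr ⟨?_, ?_⟩ (forall_congr' fun l => forall_congr' fun hl => by rw [h l hl])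
  · rintro ⟨f₂, hf₂, f₃, hf₃, x₃, hx, hp⟩
    refine ⟨f₂, hf₂, f₃, hf₃, x₃, ?_⟩
    unfold IsNearGadget at hx ⊢
    rw [← hc, ← h₂ _ hf₂, ← h₃ _ hf₃]
    exact ⟨hx, hp⟩
  · rintro ⟨f₂, hf₂, f₃, hf₃, x₃, hx, hp⟩
    refine ⟨f₂, hf₂, f₃, hf₃, x₃, ?_⟩
    unfold IsNearGadget at hx ⊢
    rw [hc, h₂ _ hf₂, h₃ _ hf₃]
    exact ⟨hx, hp⟩

lemma gadgetPairs_subset {n : ℕ} (s : Fin n → Equiv.Perm (Fin n)) (v c : Fin n)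
    (U F₂ F₃ : Finset (Fin n)) (x₁ : Fin n) :
    gadgetPairs s v c U F₂ F₃ x₁ ⊆ closingPairs s v c F₂ F₃ x₁ := by
  intro p hp
  obtain ⟨⟨f₂, hf₂, f₃, hf₃, x₃, hx, h4, h6⟩, -⟩ := (Finset.mem_filter.1 hp).2
  exact Finset.mem_filter.2 ⟨Finset.mem_univ _, f₂, hf₂, f₃, hf₃, hx.1, x₃, h4, h6⟩

/-- There are many pairs closing a gadget, but few are joined by an arc of colour `f`. -/
def Deficient {n : ℕ} (s : Fin n → Equiv.Perm (Fin n)) (v c : Fin n) (U F₂ F₃ : Finset (Fin n))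
    (f : Fin n) : Prop :=
  (2⁻¹ : ℝ) ^ 26 * n ^ 2 ≤ (gadgetPairs s v c U F₂ F₃ ((s f).symm v)).card ∧
  ((Finset.univ.filter fun x₄ => (x₄, s f x₄) ∈
    gadgetPairs s v c U F₂ F₃ ((s f).symm v)).card : ℝ) ≤ (2⁻¹ : ℝ) ^ 60 * n

lemma card_eq_sum_card_row {n : ℕ} (P : Finset (Fin n × Fin n)) :
    P.card = ∑ i, (Finset.univ.filter fun j => (i, j) ∈ P).card := by
  simp_rw [Finset.card_filter]
  rw [← Finset.sum_product', ← Finset.card_filter]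
  congr 1
  ext ⟨i, j⟩
  simp

theorem card_deficient_le {n m : ℕ} (hn : 0 < n) (hm : 1024 * m ≤ n) (hm0 : 0 < m)
    (hlog : 4 + 5 * Real.log n ≤ (2⁻¹ : ℝ) ^ 28 * n) (v c : Fin n) (U F₂ F₃ J : Finset (Fin n))
    (hc : c ∉ J) (hJ₂ : Disjoint F₂ J) (hJ₃ : Disjoint F₃ J) (h₂ : F₂.card ≤ m)
    (h₃ : F₃.card ≤ m) (hJ : (J.card : ℝ) ≤ (2⁻¹ : ℝ) ^ 29 * n) :
    (((latinSeqs n n).filter fun s => ∀ f ∈ J, Deficient s v c U F₂ F₃ f).card : ℝ) ≤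
      (latinSeqs n n).card *
        Real.exp (n * (1 + Real.log n) ^ 2 - ((2⁻¹ : ℝ) ^ 28 * n) * J.card) := by
  have hn' : (0 : ℝ) < n := by exact_mod_cast hn
  have hJ' : 4 * J.card ≤ n := by
    have : (4 * J.card : ℝ) ≤ n := by linarith
    exact_mod_cast this
  set cls : Fin n → ℕ := fun f => if f = c ∨ f ∈ F₂ ∨ f ∈ F₃ then 0 else if f ∈ J then 1
    else 2 with hcls
  obtain ⟨S, hS⟩ : ∃ S, S = (latinSeqs n n).filter fun s => ∀ f ∈ J, Deficient s v c U F₂ F₃ f :=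
    ⟨_, rfl⟩
  have hmem : ∀ s, s ∈ S ↔ s ∈ latinSeqs n n ∧ ∀ f ∈ J, Deficient s v c U F₂ F₃ f := by
    intro s; rw [hS, Finset.mem_filter]
  rw [← hS]
  refine card_le_of_restricted hn (classKey cls) (classKey_injective cls) S
    (fun s hs => ((hmem s).1 hs).1) J ((2⁻¹ : ℝ) ^ 28 * n) ?_
  intro s hs f hf
  have hsl := ((hmem s).1 hs).1
  have hclsf : cls f = 1 := by
    have h1 : f ≠ c := fun h => hc (h ▸ hf)
    have h2 : f ∉ F₂ := Finset.disjoint_right.1 hJ₂ hf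
    have h3 : f ∉ F₃ := Finset.disjoint_right.1 hJ₃ hf
    simp [hcls, h1, h2, h3, hf]
  have h_lt : ∀ l, l = c ∨ l ∈ F₂ ∨ l ∈ F₃ → classKey cls l < classKey cls f := by
    intro l hl
    rw [classKey_lt_iff, hclsf]; left; simp only [hcls, if_pos hl]; norm_num
  have hsubE : ∀ l, classKey cls l < classKey cls f → (l = c ∨ l ∈ F₂ ∨ l ∈ F₃) ∨ l ∈ J := by
    intro l hl
    rw [classKey_lt_iff, hclsf] at hl
    by_contra h
    rw [not_or] at h
    have : cls l = 2 := by simp only [hcls, if_neg h.1, if_neg h.2]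
    omega
  obtain ⟨E, hE⟩ : ∃ E, E = Finset.univ.filter fun l => classKey cls l < classKey cls f :=
    ⟨_, rfl⟩
  have hEmem : ∀ l, l ∈ E ↔ classKey cls l < classKey cls f := by simp [hE]
  have ht : E.card ≤ 1 + 2 * m + J.card := by
    have hsub : E ⊆ insert c (F₂ ∪ F₃) ∪ J := by
      intro l hl
      have := hsubE l ((hEmem l).1 hl)
      simp only [Finset.mem_insert, Finset.mem_union]
      tauto
    refine (Finset.card_le_card hsub).trans ((Finset.card_union_le _ _).trans ?_)
    have h1 := Finset.card_insert_le c (F₂ ∪ F₃)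
    have h2 := Finset.card_union_le F₂ F₃
    omega
  rw [← hE]
  set d := n - E.card with hd
  have hdn : d ≤ n := Nat.sub_le _ _
  set R : Fin n → Finset (Fin n) := fun i => (E.image fun l => s l i)ᶜ with hR
  have hRcard : ∀ i, (R i).card = d := by
    intro i
    rw [hR, Finset.card_compl, Fintype.card_fin, Finset.card_image_of_injective]
    exact fun l l' h => mem_latinSeqs.1 hsl _ _ i h
  obtain ⟨T, hT⟩ : ∃ T : Fin n → Fin n → Finset (Fin n), ∀ x₁ i, T x₁ i =
    R i ∩ Finset.univ.filter fun j => (i, j) ∈ gadgetPairs s v c U F₂ F₃ x₁ :=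
    ⟨_, fun _ _ => rfl⟩
  have hTcard : ∀ x₁ i, (T x₁ i).card ≤ m := by
    intro x₁ i
    refine le_trans (Finset.card_le_card ?_)
      ((card_closingPairs_snd_le hsl v c F₂ F₃ x₁ i).trans h₂)
    rw [hT]
    refine Finset.inter_subset_right.trans ?_
    intro j hj
    exact Finset.mem_filter.2
      ⟨Finset.mem_univ _, gadgetPairs_subset _ _ _ _ _ _ _ (Finset.mem_filter.1 hj).2⟩
  have hTsum : ∀ x₁, ((2⁻¹ : ℝ) ^ 26 * n ^ 2 ≤ (gadgetPairs s v c U F₂ F₃ x₁).card) →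
      ((2⁻¹ : ℝ) ^ 26 - (2⁻¹ : ℝ) ^ 29) * n ^ 2 ≤ ∑ i, ((T x₁ i).card : ℝ) := by
    intro x₁ hx₁
    have h1 : ∀ i, (Finset.univ.filter fun j => (i, j) ∈ gadgetPairs s v c U F₂ F₃ x₁).card ≤
        (T x₁ i).card + J.card := by
      intro i
      have : (Finset.univ.filter fun j => (i, j) ∈ gadgetPairs s v c U F₂ F₃ x₁) ⊆
          T x₁ i ∪ J.image fun l => s l i := by
        intro j hj
        by_cases hjR : j ∈ R i
        · rw [Finset.mem_union, hT, Finset.mem_inter]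
          exact Or.inl ⟨hjR, hj⟩
        · rw [hR, Finset.mem_compl, not_not, Finset.mem_image] at hjR
          obtain ⟨l, hl, rfl⟩ := hjR
          rcases hsubE l ((hEmem l).1 hl) with h | h
          · exact absurd rfl ((Finset.mem_filter.1 (Finset.mem_filter.1 hj).2).2.2 l h)
          · exact Finset.mem_union_right _ (Finset.mem_image_of_mem _ h)
      refine (Finset.card_le_card this).trans ((Finset.card_union_le _ _).trans ?_)
      exact Nat.add_le_add_left Finset.card_image_le _
    have h2 : (gadgetPairs s v c U F₂ F₃ x₁).card ≤ ∑ i, (T x₁ i).card + n * J.card := by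
      rw [card_eq_sum_card_row]
      refine (Finset.sum_le_sum fun i _ => h1 i).trans ?_
      rw [Finset.sum_add_distrib]
      simp
    have h3 : ((gadgetPairs s v c U F₂ F₃ x₁).card : ℝ) ≤
        ∑ i, ((T x₁ i).card : ℝ) + n * J.card := by exact_mod_cast h2
    nlinarith
  obtain ⟨X, hX⟩ : ∃ X, X = Finset.univ.filter fun x₁ =>
    (2⁻¹ : ℝ) ^ 26 * n ^ 2 ≤ (gadgetPairs s v c U F₂ F₃ x₁).card := ⟨_, rfl⟩
  have hsub : (S.filter fun s' => ∀ l, classKey cls l < classKey cls f → s' l = s l).image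
      (fun s' => s' f) ⊆ X.biUnion fun x₁ =>
        Finset.univ.filter fun σ : Equiv.Perm (Fin n) => (∀ i, σ i ∈ R i) ∧
          ((Finset.univ.filter fun i => σ i ∈ T x₁ i).card : ℝ) ≤ (2⁻¹ : ℝ) ^ 60 * n := by
    intro σ hσ
    obtain ⟨s', hs', rfl⟩ := Finset.mem_image.1 hσ
    obtain ⟨hs', hhist⟩ := Finset.mem_filter.1 hs'
    obtain ⟨hs'l, hdef⟩ := (hmem s').1 hs'
    obtain ⟨hlarge, hfew⟩ := hdef f hf
    rw [gadgetPairs_congr fun l hl => hhist l (h_lt l hl)] at hlarge hfew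
    refine Finset.mem_biUnion.2 ⟨(s' f).symm v, ?_, Finset.mem_filter.2
      ⟨Finset.mem_univ _, ?_, ?_⟩⟩
    · rw [hX]; exact Finset.mem_filter.2 ⟨Finset.mem_univ _, hlarge⟩
    · intro i
      rw [hR, Finset.mem_compl, Finset.mem_image]
      rintro ⟨l, hl, h⟩
      have hl' := (hEmem l).1 hl
      rw [← hhist l hl'] at h
      have := mem_latinSeqs.1 hs'l _ _ i h
      rw [this] at hl'
      exact lt_irrefl _ hl'
    · refine le_trans (Nat.cast_le.2 (Finset.card_le_card ?_)) hfew
      intro i hi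
      have h := (Finset.mem_filter.1 hi).2
      rw [hT, Finset.mem_inter] at h
      exact Finset.mem_filter.2 ⟨Finset.mem_univ _, (Finset.mem_filter.1 h.2).2⟩
  have hL : Real.exp (-(40 * Real.log 2)) = (2⁻¹ : ℝ) ^ 40 := by
    rw [inv_pow, ← Real.exp_log (show (0 : ℝ) < 2 ^ 40 by positivity), ← Real.exp_neg,
      Real.log_pow]
    norm_num
  set B : ℝ := Real.exp (n * lb d) * Real.exp ((2⁻¹ : ℝ) ^ 60 * n * (40 * Real.log 2) +
    n * Real.exp (-(40 * Real.log 2)) -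
      (((2⁻¹ : ℝ) ^ 26 - (2⁻¹ : ℝ) ^ 29) - (2⁻¹ : ℝ) ^ 60) * n + 4 * (1 + Real.log n)) with hB
  have hcard : (((S.filter fun s' => ∀ l, classKey cls l < classKey cls f → s' l = s l).image
      (fun s' => s' f)).card : ℝ) ≤ n * B := by
    refine (Nat.cast_le.2 (Finset.card_le_card hsub)).trans ?_
    refine (Nat.cast_le.2 Finset.card_biUnion_le).trans ?_
    rw [Nat.cast_sum]
    refine (Finset.sum_le_card_nsmul _ _ B fun x₁ hx₁ => ?_).trans ?_
    · rw [hX] at hx₁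
      have hTR : ∀ i, T x₁ i ⊆ R i := fun i => by rw [hT]; exact Finset.inter_subset_left
      have hT4 : ∀ i, n ≤ 4 * (d - (T x₁ i).card) := by
        intro i
        have := hTcard x₁ i
        omega
      exact card_perm_few_hits_le hn R (T x₁) hRcard hdn hTR hT4 _ _ (40 * Real.log 2)
        (by positivity) (hTsum x₁ (Finset.mem_filter.1 hx₁).2)
    · rw [nsmul_eq_mul]
      gcongr
      exact (Finset.card_le_univ X).trans (by simp)
  refine hcard.trans ?_
  have h1 : (n : ℝ) * B = Real.exp (n * lb d) * (Real.exp (Real.log n) *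
      Real.exp ((2⁻¹ : ℝ) ^ 60 * n * (40 * Real.log 2) + n * Real.exp (-(40 * Real.log 2)) -
      (((2⁻¹ : ℝ) ^ 26 - (2⁻¹ : ℝ) ^ 29) - (2⁻¹ : ℝ) ^ 60) * n + 4 * (1 + Real.log n))) := by
    rw [hB, Real.exp_log hn']; ring
  rw [h1, ← Real.exp_add]
  refine mul_le_mul_of_nonneg_left (Real.exp_le_exp.2 ?_) (Real.exp_pos _).le
  rw [hL]
  have h2 : Real.log 2 ≤ 1 := by have := Real.log_two_lt_d9; linarith
  have h3 : (2⁻¹ : ℝ) ^ 60 * n * (40 * Real.log 2) ≤ (2⁻¹ : ℝ) ^ 60 * n * 40 :=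
    mul_le_mul_of_nonneg_left (by linarith) (by positivity)
  norm_num at h3 hlog ⊢
  linarith

lemma card_filter_mem_le {n k : ℕ} {g : Fin n → Fin n} (hg : Function.Injective g)
    {A : Finset (Fin n)} (hA : A.card ≤ k) :
    (Finset.univ.filter fun a => g a ∈ A).card ≤ k :=
  (Finset.card_le_card_of_injOn g (fun _ ha => (Finset.mem_filter.1 ha).2) hg.injOn).trans hA

lemma card_filter_or_le {α : Type*} [Fintype α] (P Q : α → Prop) [DecidablePred P]
    [DecidablePred Q] [DecidablePred fun a => P a ∨ Q a] {k l : ℕ}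
    (hP : (Finset.univ.filter P).card ≤ k) (hQ : (Finset.univ.filter Q).card ≤ l) :
    (Finset.univ.filter fun a => P a ∨ Q a).card ≤ k + l := by
  refine le_trans (le_of_eq ?_) ((Finset.card_union_le _ _).trans (add_le_add hP hQ))
  rw [← Finset.filter_or]
  congr

lemma card_filter_prod_le {α β : Type*} [Fintype α] [Fintype β] (P : α → β → Prop)
    [∀ a, DecidablePred (P a)] [DecidablePred fun t : α × β => P t.1 t.2] {k : ℕ}
    (h : ∀ a, (Finset.univ.filter fun b => P a b).card ≤ k) :
    (Finset.univ.filter fun t : α × β => P t.1 t.2).card ≤ Fintype.card α * k := by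
  rw [Finset.card_filter, Fintype.sum_prod_type]
  refine (Finset.sum_le_card_nsmul _ _ k fun a _ => ?_).trans (by simp)
  rw [← Finset.card_filter]
  refine le_trans (le_of_eq ?_) (h a)
  congr

lemma card_block_le (n i : ℕ) :
    (Finset.univ.filter fun f : Fin n => f.val % 2048 = i).card ≤ n / 2048 + 1 := by
  rw [← Finset.card_range (n / 2048 + 1)]
  refine Finset.card_le_card_of_injOn (fun f => f.val / 2048) (fun f _ => ?_) ?_
  · have := Nat.div_le_div_right (c := 2048) f.2.le
    simp only [Finset.coe_range, Set.mem_Iio]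
    omega
  · intro f hf g hg h
    simp only [Finset.coe_filter, Finset.mem_univ, true_and, Set.mem_ofPred_eq] at hf hg h
    ext
    omega

section Triples

variable {n : ℕ} (s : Fin n → Equiv.Perm (Fin n)) (φ : Fin n → Fin n → Fin n) (v c : Fin n)
  (U D : Finset (Fin n))

/-- The colours `f₂`, `f₃` and the vertex `x₃` determine an incomplete gadget avoiding the
vertices in `U` and the colours in `D`, such that the colours of `x₁ → v` and of `x₄ → x₆`
lie in blocks different from those of `f₂` and `f₃`. -/
def IsGoodTriple (f₂ f₃ x₃ : Fin n) : Prop :=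
  f₂ ∉ insert c D ∧ f₃ ∉ insert c D ∧ f₃.val % 2048 ≠ f₂.val % 2048 ∧
  φ ((s f₃).symm (s f₂ v)) v ∉ insert c D ∧
  (φ ((s f₃).symm (s f₂ v)) v).val % 2048 ≠ f₂.val % 2048 ∧
  (φ ((s f₃).symm (s f₂ v)) v).val % 2048 ≠ f₃.val % 2048 ∧
  (φ (s f₃ x₃) (s c (s f₂ x₃))).val % 2048 ≠ f₂.val % 2048 ∧
  (φ (s f₃ x₃) (s c (s f₂ x₃))).val % 2048 ≠ f₃.val % 2048 ∧
  IsNearGadget s v c U ((s f₃).symm (s f₂ v)) f₂ f₃ x₃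

variable {s φ v c U D}

lemma card_bad_triples_le (hs : s ∈ latinSeqs n n) (hφ : ∀ f i j, φ i j = f ↔ s f i = j)
    {u δ m : ℕ} (hU : (insert v U).card ≤ u) (hD : (insert c D).card ≤ δ)
    (hm : n / 2048 + 1 ≤ m) :
    (Finset.univ.filter fun t : Fin n × Fin n × Fin n =>
      ¬ IsGoodTriple s φ v c U D t.1 t.2.1 t.2.2).card ≤
      n * n * (3 * δ + 5 * m + 6 * u + 13 + (Finset.univ.filter fun i => s c i = i).card) := by
  have hcol : ∀ f g i, s f i = s g i → f = g := mem_latinSeqs.1 hs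
  have hinj₁ : ∀ j, Function.Injective fun i => φ i j := by
    intro j i i' h
    have h1 := (hφ _ i j).1 rfl
    have h2 := (hφ _ i' j).1 rfl
    simp only at h
    rw [h] at h1
    exact (s _).injective (h1.trans h2.symm)
  have hinj₂ : ∀ i, Function.Injective fun j => φ i j := by
    intro i j j' h
    have h1 := (hφ _ i j).1 rfl
    have h2 := (hφ _ i j').1 rfl
    simp only at h
    rw [h] at h1
    exact h1.symm.trans h2
  have happ : ∀ i, Function.Injective fun f => s f i := fun i f g h => hcol f g i h
  have hsymm : ∀ j, Function.Injective fun f => (s f).symm j := by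
    intro j f g h
    refine hcol f g ((s f).symm j) ?_
    simp only at h
    conv_rhs => rw [h]
    simp
  have hblk : ∀ (i : ℕ) {g : Fin n → Fin n}, Function.Injective g →
      (Finset.univ.filter fun a => (g a).val % 2048 = i).card ≤ m := by
    intro i g hg
    refine le_trans (le_of_eq ?_) (card_filter_mem_le hg ((card_block_le n i).trans hm))
    congr 1
    ext a
    simp
  have hone : ∀ (i : Fin n) {g : Fin n → Fin n}, Function.Injective g →
      (Finset.univ.filter fun a => g a = i).card ≤ 1 := by
    intro i g hg
    refine le_trans (le_of_eq ?_) (card_filter_mem_le hg (Finset.card_singleton i).le)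
    congr 1
    ext a
    simp
  obtain ⟨V, hV⟩ : ∃ V : Fin n → Fin n → Finset (Fin n), ∀ f₂ f₃, V f₂ f₃ =
    insert ((s f₃).symm (s f₂ v)) (insert (s f₂ v) (insert v U)) := ⟨_, fun _ _ => rfl⟩
  have hVcard : ∀ f₂ f₃, (V f₂ f₃).card ≤ u + 2 := by
    intro f₂ f₃
    rw [hV]
    refine (Finset.card_insert_le _ _).trans (add_le_add_left ?_ 1)
    exact (Finset.card_insert_le _ _).trans (add_le_add_left hU 1)
  -- the three families of bad triples, according to the variable that is left free
  let P₁ : Fin n → Fin n → Fin n → Prop := fun f₂ x₃ f₃ =>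
    f₃ ∈ insert c D ∨ f₃.val % 2048 = f₂.val % 2048 ∨
    φ ((s f₃).symm (s f₂ v)) v ∈ insert c D ∨
    (φ ((s f₃).symm (s f₂ v)) v).val % 2048 = f₂.val % 2048 ∨
    (φ (s f₃ x₃) (s c (s f₂ x₃))).val % 2048 = f₂.val % 2048 ∨
    (s f₃).symm (s f₂ v) ∈ insert v U ∨ s f₃ (s f₂ v) = s f₂ v ∨
    s f₃ x₃ = x₃ ∨ s f₃ x₃ = s c (s f₂ x₃)
  let P₂ : Fin n → Fin n → Fin n → Prop := fun f₃ x₃ f₂ =>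
    f₂ ∈ insert c D ∨ (φ ((s f₃).symm (s f₂ v)) v).val % 2048 = f₃.val % 2048 ∨
    (φ (s f₃ x₃) (s c (s f₂ x₃))).val % 2048 = f₃.val % 2048 ∨
    s f₂ v ∈ insert v U ∨ s f₂ x₃ = x₃ ∨ s c (s f₂ x₃) = x₃
  let P₃ : Fin n → Fin n → Fin n → Prop := fun f₂ f₃ x₃ =>
    x₃ ∈ V f₂ f₃ ∨ s f₃ x₃ ∈ V f₂ f₃ ∨ s f₂ x₃ ∈ V f₂ f₃ ∨ s c (s f₂ x₃) ∈ V f₂ f₃ ∨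
    s c (s f₂ x₃) = s f₂ x₃
  have h₁ : ∀ q : Fin n × Fin n, (Finset.univ.filter fun f₃ => P₁ q.1 q.2 f₃).card ≤
      δ + (m + (δ + (m + (m + (u + (1 + (1 + 1))))))) := by
    rintro ⟨f₂, x₃⟩
    have e1 : Function.Injective fun f₃ => φ ((s f₃).symm (s f₂ v)) v :=
      (hinj₁ v).comp (hsymm (s f₂ v))
    have e2 : Function.Injective fun f₃ => φ (s f₃ x₃) (s c (s f₂ x₃)) :=
      (hinj₁ _).comp (happ x₃)
    refine card_filter_or_le _ _ (card_filter_mem_le Function.injective_id hD) ?_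
    refine card_filter_or_le _ _ (hblk _ Function.injective_id) ?_
    refine card_filter_or_le _ _ (card_filter_mem_le e1 hD) ?_
    refine card_filter_or_le _ _ (hblk _ e1) ?_
    refine card_filter_or_le _ _ (hblk _ e2) ?_
    refine card_filter_or_le _ _ (card_filter_mem_le (hsymm _) hU) ?_
    refine card_filter_or_le _ _ (hone _ (happ _)) ?_
    exact card_filter_or_le _ _ (hone _ (happ _)) (hone _ (happ _))
  have h₂ : ∀ q : Fin n × Fin n, (Finset.univ.filter fun f₂ => P₂ q.1 q.2 f₂).card ≤
      δ + (m + (m + (u + (1 + 1)))) := by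
    rintro ⟨f₃, x₃⟩
    have e1 : Function.Injective fun f₂ => φ ((s f₃).symm (s f₂ v)) v :=
      (hinj₁ v).comp ((s f₃).symm.injective.comp (happ v))
    have e2 : Function.Injective fun f₂ => φ (s f₃ x₃) (s c (s f₂ x₃)) :=
      (hinj₂ _).comp ((s c).injective.comp (happ x₃))
    refine card_filter_or_le _ _ (card_filter_mem_le Function.injective_id hD) ?_
    refine card_filter_or_le _ _ (hblk _ e1) ?_
    refine card_filter_or_le _ _ (hblk _ e2) ?_
    refine card_filter_or_le _ _ (card_filter_mem_le (happ v) hU) ?_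
    exact card_filter_or_le _ _ (hone _ (happ _))
      (hone _ ((s c).injective.comp (happ x₃)))
  have h₃ : ∀ q : Fin n × Fin n, (Finset.univ.filter fun x₃ => P₃ q.1 q.2 x₃).card ≤
      (u + 2) + ((u + 2) + ((u + 2) + ((u + 2) +
        (Finset.univ.filter fun i => s c i = i).card))) := by
    rintro ⟨f₂, f₃⟩
    refine card_filter_or_le _ _ (card_filter_mem_le Function.injective_id (hVcard _ _)) ?_
    refine card_filter_or_le _ _ (card_filter_mem_le (s f₃).injective (hVcard _ _)) ?_
    refine card_filter_or_le _ _ (card_filter_mem_le (s f₂).injective (hVcard _ _)) ?_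
    refine card_filter_or_le _ _
      (card_filter_mem_le ((s c).injective.comp (s f₂).injective) (hVcard _ _)) ?_
    refine le_trans (le_of_eq ?_) (card_filter_mem_le (s f₂).injective le_rfl)
    congr 1
    ext a
    simp
  have hb₁ := card_filter_prod_le (fun (q : Fin n × Fin n) f₃ => P₁ q.1 q.2 f₃) h₁
  have hb₂ := card_filter_prod_le (fun (q : Fin n × Fin n) f₂ => P₂ q.1 q.2 f₂) h₂
  have hb₃ := card_filter_prod_le (fun (q : Fin n × Fin n) x₃ => P₃ q.1 q.2 x₃) h₃
  simp only [Fintype.card_prod, Fintype.card_fin] at hb₁ hb₂ hb₃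
  have hc₁ : (Finset.univ.filter fun t : Fin n × Fin n × Fin n => P₁ t.1 t.2.2 t.2.1).card ≤ _ :=
    le_trans (Finset.card_le_card_of_injOn (fun t => ((t.1, t.2.2), t.2.1))
      (fun t ht => by simpa using ht) (by
        rintro ⟨a, b, c⟩ - ⟨a', b', c'⟩ - h
        simp only [Prod.mk.injEq] at h ⊢
        tauto)) hb₁
  have hc₂ : (Finset.univ.filter fun t : Fin n × Fin n × Fin n => P₂ t.2.1 t.2.2 t.1).card ≤ _ :=
    le_trans (Finset.card_le_card_of_injOn (fun t => ((t.2.1, t.2.2), t.1))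
      (fun t ht => by simpa using ht) (by
        rintro ⟨a, b, c⟩ - ⟨a', b', c'⟩ - h
        simp only [Prod.mk.injEq] at h ⊢
        tauto)) hb₂
  have hc₃ : (Finset.univ.filter fun t : Fin n × Fin n × Fin n => P₃ t.1 t.2.1 t.2.2).card ≤ _ :=
    le_trans (Finset.card_le_card_of_injOn (fun t => ((t.1, t.2.1), t.2.2))
      (fun t ht => by simpa using ht) (by
        rintro ⟨a, b, c⟩ - ⟨a', b', c'⟩ - h
        simp only [Prod.mk.injEq] at h ⊢
        tauto)) hb₃
  have hcover : (Finset.univ.filter fun t : Fin n × Fin n × Fin n =>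
      ¬ IsGoodTriple s φ v c U D t.1 t.2.1 t.2.2) ⊆ Finset.univ.filter
        fun t : Fin n × Fin n × Fin n =>
          P₁ t.1 t.2.2 t.2.1 ∨ P₂ t.2.1 t.2.2 t.1 ∨ P₃ t.1 t.2.1 t.2.2 := by
    rintro ⟨f₂, f₃, x₃⟩ ht
    rw [Finset.mem_filter] at ht ⊢
    refine ⟨Finset.mem_univ _, ?_⟩
    by_contra hcon
    refine ht.2 ?_
    simp only [not_or] at hcon
    obtain ⟨q₁, q₂, q₃⟩ := hcon
    simp only [P₁, P₂, P₃, hV, not_or, Finset.mem_insert] at q₁ q₂ q₃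
    obtain ⟨a1, a2, a3, a4, a5, a6, a7, a8, a9⟩ := q₁
    obtain ⟨b1, b2, b3, b4, b5, b6⟩ := q₂
    obtain ⟨c1, c2, c3, c4, c5⟩ := q₃
    have hne : s f₃ x₃ ≠ s f₂ x₃ := fun h => a2 (by rw [hcol _ _ _ h])
    have h12 : (s f₃).symm (s f₂ v) ≠ s f₂ v := by
      intro h
      rw [Equiv.symm_apply_eq] at h
      exact a7 h.symm
    simp only [IsGoodTriple, IsNearGadget, Finset.mem_insert, not_or]
    refine ⟨b1, a1, a2, a3, a4, b2, a5, b3, by simp, ?_, ?_⟩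
    · simp only [List.nodup_cons, List.mem_cons, List.not_mem_nil, or_false, not_or,
        List.nodup_nil, and_true, not_false_eq_true]
      grind
    · simp only [List.mem_cons, List.not_mem_nil, or_false]
      grind
  have htot := card_filter_or_le _ _ hc₁ (card_filter_or_le _ _ hc₂ hc₃)
  refine (Finset.card_le_card hcover).trans (htot.trans (le_of_eq ?_))
  ring

end Triples

section Triples

variable {n : ℕ} {s : Fin n → Equiv.Perm (Fin n)} {φ : Fin n → Fin n → Fin n} {v c : Fin n}
  {U D : Finset (Fin n)}

lemma exists_block_pair (hn : (2 : ℝ) ^ 60 ≤ n) (hs : s ∈ latinSeqs n n)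
    (hφ : ∀ f i j, φ i j = f ↔ s f i = j) (hU : (U.card : ℝ) ≤ (2⁻¹ : ℝ) ^ 40 * n)
    (hD : (D.card : ℝ) ≤ (2⁻¹ : ℝ) ^ 40 * n)
    (hloop : ((Finset.univ.filter fun i => s c i = i).card : ℝ) ≤ (2⁻¹ : ℝ) ^ 20 * n) :
    ∃ i₂ i₃ : ℕ, i₂ ≠ i₃ ∧ (0.9 : ℝ) * n ^ 3 / 2 ^ 22 ≤ (Finset.univ.filter
      fun t : Fin n × Fin n × Fin n => IsGoodTriple s φ v c U D t.1 t.2.1 t.2.2 ∧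
        t.1.val % 2048 = i₂ ∧ t.2.1.val % 2048 = i₃).card := by
  have hn0 : (0 : ℝ) < n := lt_of_lt_of_le (by positivity) hn
  have hbad := card_bad_triples_le (c := c) (v := v) (U := U) (D := D) hs hφ
    (Finset.card_insert_le _ _) (Finset.card_insert_le _ _) le_rfl
  set Ω := Finset.univ.filter fun t : Fin n × Fin n × Fin n =>
    IsGoodTriple s φ v c U D t.1 t.2.1 t.2.2 with hΩ
  have htot : n * (n * n) = Ω.card + (Finset.univ.filter fun t : Fin n × Fin n × Fin n =>
      ¬ IsGoodTriple s φ v c U D t.1 t.2.1 t.2.2).card := by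
    rw [hΩ, Finset.card_filter_add_card_filter_not]
    simp
  have hM : ((n / 2048 + 1 : ℕ) : ℝ) ≤ n / 2048 + 1 := by
    push_cast
    have := @Nat.cast_div_le ℝ _ _ _ n 2048
    push_cast at this
    linarith
  have hbad' : ((Finset.univ.filter fun t : Fin n × Fin n × Fin n =>
      ¬ IsGoodTriple s φ v c U D t.1 t.2.1 t.2.2).card : ℝ) ≤ n * n * (0.1 * n) := by
    refine (Nat.cast_le.2 hbad).trans ?_
    push_cast at hM ⊢
    refine mul_le_mul_of_nonneg_left ?_ (by positivity)
    have hn1 : (10000 : ℝ) ≤ n := le_trans (by norm_num) hn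
    norm_num at hU hD hloop ⊢
    linarith
  have htot' : (n : ℝ) * (n * n) = Ω.card + (Finset.univ.filter fun t : Fin n × Fin n × Fin n =>
      ¬ IsGoodTriple s φ v c U D t.1 t.2.1 t.2.2).card := by exact_mod_cast htot
  have hΩcard : (0.9 : ℝ) * n ^ 3 ≤ Ω.card := by nlinarith
  obtain ⟨⟨i₂, i₃⟩, -, h⟩ := Finset.exists_le_card_fiber_of_nsmul_le_card_of_maps_to
    (s := Ω) (t := Finset.range 2048 ×ˢ Finset.range 2048)
    (f := fun t => (t.1.val % 2048, t.2.1.val % 2048)) (b := (0.9 : ℝ) * n ^ 3 / 2 ^ 22)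
    (fun t _ => by
      simp only [Finset.mem_product, Finset.mem_range]
      exact ⟨Nat.mod_lt _ (by norm_num), Nat.mod_lt _ (by norm_num)⟩)
    ⟨(0, 0), by simp⟩ (by
      rw [Finset.card_product, Finset.card_range, nsmul_eq_mul]
      push_cast
      linarith)
  refine ⟨i₂, i₃, ?_, h.trans (le_of_eq ?_)⟩
  · have hpos : (0 : ℝ) < (Ω.filter fun t => (t.1.val % 2048, t.2.1.val % 2048) = (i₂, i₃)).card :=
      lt_of_lt_of_le (by positivity) h
    obtain ⟨t, ht⟩ := Finset.card_pos.1 (Nat.cast_pos.1 hpos)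
    obtain ⟨ht, hti⟩ := Finset.mem_filter.1 ht
    rw [Prod.mk.injEq] at hti
    rw [← hti.1, ← hti.2]
    exact ((Finset.mem_filter.1 ht).2.2.2.1).symm
  rw [hΩ, Finset.filter_filter]
  congr 2
  ext t
  simp

lemma sum_card_gadgetPairs_ge {m i₂ i₃ : ℕ} {F₂ F₃ : Finset (Fin n)} (hs : s ∈ latinSeqs n n)
    (hφ : ∀ f i j, φ i j = f ↔ s f i = j)
    (hF₂ : ∀ f, f ∈ F₂ ↔ f.val % 2048 = i₂ ∧ f ∉ insert c D)
    (hF₃ : ∀ f, f ∈ F₃ ↔ f.val % 2048 = i₃ ∧ f ∉ insert c D)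
    (h₂ : F₂.card ≤ m) (h₃ : F₃.card ≤ m) :
    2 * (Finset.univ.filter
      fun t : Fin n × Fin n × Fin n => IsGoodTriple s φ v c U D t.1 t.2.1 t.2.2 ∧
        t.1.val % 2048 = i₂ ∧ t.2.1.val % 2048 = i₃).card ≤
    2 * ∑ f ∈ Finset.univ.filter fun f => f ∉ insert c D ∧ f ∉ F₂ ∧ f ∉ F₃,
      (gadgetPairs s v c U F₂ F₃ ((s f).symm v)).card +
    2 * ((F₃.filter fun f => Repetitive s v c F₂ F₃ f).card * m * n) + m * m * n := by
  have hcol : ∀ f g i, s f i = s g i → f = g := mem_latinSeqs.1 hs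
  set Ω := Finset.univ.filter
      fun t : Fin n × Fin n × Fin n => IsGoodTriple s φ v c U D t.1 t.2.1 t.2.2 ∧
        t.1.val % 2048 = i₂ ∧ t.2.1.val % 2048 = i₃ with hΩ
  set J := F₃.filter fun f => Repetitive s v c F₂ F₃ f with hJ
  let Q : Fin n → Fin n → Fin n → Prop := fun f₂ f₃ x₃ => (s f₃ x₃, s c (s f₂ x₃)) ∈
    closingPairs s v c F₂ (F₃.filter (· < f₃)) ((s f₃).symm (s f₂ v))
  set B₁ := J ×ˢ F₂ ×ˢ (Finset.univ : Finset (Fin n)) with hB₁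
  set B₂ := ((F₂ ×ˢ (F₃ \ J)) ×ˢ (Finset.univ : Finset (Fin n))).filter
    fun q => Q q.1.1 q.1.2 q.2 with hB₂
  set G := (Finset.univ.filter fun f => f ∉ insert c D ∧ f ∉ F₂ ∧ f ∉ F₃).sigma
    fun f => gadgetPairs s v c U F₂ F₃ ((s f).symm v) with hG
  have hΩF : ∀ t ∈ Ω, t.1 ∈ F₂ ∧ t.2.1 ∈ F₃ := by
    intro t ht
    obtain ⟨hg, h2, h3⟩ := (Finset.mem_filter.1 ht).2
    exact ⟨(hF₂ _).2 ⟨h2, hg.1⟩, (hF₃ _).2 ⟨h3, hg.2.1⟩⟩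
  set Ω₁ := Ω.filter fun t => t.2.1 ∈ J with hΩ₁
  set Ω₂ := Ω.filter fun t => t.2.1 ∉ J ∧ Q t.1 t.2.1 t.2.2 with hΩ₂
  set Ω₃ := Ω.filter fun t => ¬ Q t.1 t.2.1 t.2.2 with hΩ₃
  have hcov : Ω ⊆ Ω₁ ∪ (Ω₂ ∪ Ω₃) := by
    intro t ht
    simp only [hΩ₁, hΩ₂, hΩ₃, Finset.mem_union, Finset.mem_filter, ht, true_and]
    tauto
  have hc₁ : Ω₁.card ≤ J.card * m * n := by
    have : Ω₁.card ≤ B₁.card := by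
      refine Finset.card_le_card_of_injOn (fun t => (t.2.1, t.1, t.2.2)) ?_ ?_
      · intro t ht
        obtain ⟨ht, htJ⟩ := Finset.mem_filter.1 ht
        simp only [hB₁, Finset.coe_product, Set.mem_prod, Finset.mem_coe]
        exact ⟨htJ, (hΩF t ht).1, Finset.mem_univ _⟩
      · rintro ⟨a, b, d⟩ - ⟨a', b', d'⟩ - h
        simp only [Prod.mk.injEq] at h ⊢
        tauto
    refine this.trans ?_
    rw [hB₁, Finset.card_product, Finset.card_product, Finset.card_univ, Fintype.card_fin,
      ← mul_assoc]
    gcongr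
  have hc₂ : 2 * Ω₂.card ≤ m * m * n := by
    have h1 : Ω₂.card ≤ ∑ q ∈ F₂ ×ˢ (F₃ \ J),
        (Finset.univ.filter fun x₃ => Q q.1 q.2 x₃).card := by
      rw [← Finset.card_sigma]
      refine Finset.card_le_card_of_injOn (fun t => ⟨(t.1, t.2.1), t.2.2⟩) ?_ ?_
      · intro t ht
        obtain ⟨ht, htJ, htQ⟩ := Finset.mem_filter.1 ht
        have := hΩF t ht
        simp only [Finset.coe_sigma, Set.mem_sigma_iff, Finset.coe_product, Finset.mem_coe,
          Set.mem_prod, Finset.mem_sdiff, Finset.mem_filter, Finset.mem_univ, true_and]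
        exact ⟨⟨this.1, this.2, htJ⟩, htQ⟩
      · rintro ⟨a, b, d⟩ - ⟨a', b', d'⟩ - h
        simp only [Sigma.mk.injEq, Prod.mk.injEq, heq_eq_eq] at h ⊢
        tauto
    have h2 : ∀ q ∈ F₂ ×ˢ (F₃ \ J), 2 * (Finset.univ.filter fun x₃ => Q q.1 q.2 x₃).card ≤ n := by
      intro q hq
      obtain ⟨hq2, hq3⟩ := Finset.mem_product.1 hq
      obtain ⟨hq3, hqJ⟩ := Finset.mem_sdiff.1 hq3
      by_contra! hcon
      exact hqJ (Finset.mem_filter.2 ⟨hq3, _, q.1, hq2, hcon⟩)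
    calc 2 * Ω₂.card ≤ 2 * ∑ q ∈ F₂ ×ˢ (F₃ \ J),
          (Finset.univ.filter fun x₃ => Q q.1 q.2 x₃).card := by gcongr
      _ ≤ (F₂ ×ˢ (F₃ \ J)).card * n := by
        rw [Finset.mul_sum]
        simpa using Finset.sum_le_card_nsmul _ _ n h2
      _ ≤ m * m * n := by
        rw [Finset.card_product]
        gcongr
        exact (Finset.card_le_card Finset.sdiff_subset).trans h₃
  have hc₃ : Ω₃.card ≤ ∑ f ∈ Finset.univ.filter fun f => f ∉ insert c D ∧ f ∉ F₂ ∧ f ∉ F₃,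
      (gadgetPairs s v c U F₂ F₃ ((s f).symm v)).card := by
    rw [← Finset.card_sigma]
    have hx₁ : ∀ f₂ f₃, (s (φ ((s f₃).symm (s f₂ v)) v)).symm v = (s f₃).symm (s f₂ v) := by
      intro f₂ f₃
      rw [Equiv.symm_apply_eq]
      exact ((hφ _ _ _).1 rfl).symm
    refine Finset.card_le_card_of_injOn (fun t => ⟨φ ((s t.2.1).symm (s t.1 v)) v,
      (s t.2.1 t.2.2, s c (s t.1 t.2.2))⟩) ?_ ?_
    · intro t ht
      obtain ⟨ht, -⟩ := Finset.mem_filter.1 ht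
      obtain ⟨hg, h2, h3⟩ := (Finset.mem_filter.1 ht).2
      have htF := hΩF t ht
      obtain ⟨g1, g2, g3, g4, g5, g6, g7, g8, g9⟩ := hg
      rw [Finset.mem_coe, Finset.mem_sigma]
      refine ⟨Finset.mem_filter.2 ⟨Finset.mem_univ _, g4, ?_, ?_⟩, Finset.mem_filter.2
        ⟨Finset.mem_univ _, ⟨t.1, htF.1, t.2.1, htF.2, t.2.2, ?_, rfl, rfl⟩, ?_⟩⟩
      · exact fun h => g5 (((hF₂ _).1 h).1.trans h2.symm)
      · exact fun h => g6 (((hF₃ _).1 h).1.trans h3.symm)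
      · rw [hx₁]; exact g9
      · intro l hl heq
        have hl' := (hφ l _ _).2 heq
        rcases hl with h | h | h
        · subst h
          have h5 : s t.2.1 t.2.2 = s t.1 t.2.2 := (s _).injective heq
          exact g3 (by rw [hcol _ _ _ h5])
        · rw [hl'] at g7
          exact g7 (((hF₂ _).1 h).1.trans h2.symm)
        · rw [hl'] at g8
          exact g8 (((hF₃ _).1 h).1.trans h3.symm)
    · have key : ∀ t ∈ Ω₃, ∀ t' ∈ Ω₃, (s t.2.1).symm (s t.1 v) = (s t'.2.1).symm (s t'.1 v) →
          s t.2.1 t.2.2 = s t'.2.1 t'.2.2 → s c (s t.1 t.2.2) = s c (s t'.1 t'.2.2) →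
          ¬ t'.2.1 < t.2.1 := by
        intro t ht t' ht' e1 e2 e3 hlt
        obtain ⟨ht, htQ⟩ := Finset.mem_filter.1 ht
        obtain ⟨ht', -⟩ := Finset.mem_filter.1 ht'
        refine htQ (Finset.mem_filter.2 ⟨Finset.mem_univ _, t'.1, (hΩF t' ht').1, t'.2.1,
          Finset.mem_filter.2 ⟨(hΩF t' ht').2, hlt⟩, ?_, t'.2.2, e2, e3⟩)
        rw [e1]; simp
      intro t ht t' ht' h
      simp only [Sigma.mk.injEq, heq_eq_eq, Prod.mk.injEq] at h
      obtain ⟨e1, e2, e3⟩ := h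
      have e1 : (s t.2.1).symm (s t.1 v) = (s t'.2.1).symm (s t'.1 v) := by
        rw [← hx₁, e1, hx₁]
      have hf3 : t.2.1 = t'.2.1 := le_antisymm
        (not_lt.1 (key t ht t' ht' e1 e2 e3)) (not_lt.1 (key t' ht' t ht e1.symm e2.symm e3.symm))
      rw [hf3] at e1 e2
      have hf2 : t.1 = t'.1 := hcol _ _ v ((s _).symm.injective e1)
      have hx3 : t.2.2 = t'.2.2 := (s _).injective e2
      exact Prod.ext hf2 (Prod.ext hf3 hx3)
  have := (Finset.card_le_card hcov).trans ((Finset.card_union_le _ _).trans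
    (Nat.add_le_add_left (Finset.card_union_le _ _) _))
  omega

end Triples

/-- A gadget whose vertices other than `v` avoid `U` and whose colours other than `c` avoid `D`. -/
def IsFreeGadget {n : ℕ} (φ : Fin n → Fin n → Fin n) (v c : Fin n) (U D : Finset (Fin n))
    (x : Fin 6 → Fin n) : Prop :=
  IsAbsGadget φ v c x ∧ (∀ k, x k ∉ U) ∧ φ (x 0) v ∉ D ∧ φ v (x 1) ∉ D ∧ φ (x 0) (x 1) ∉ D

section Triples

variable {n : ℕ} {s : Fin n → Equiv.Perm (Fin n)} {φ : Fin n → Fin n → Fin n} {v c : Fin n}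
  {U D : Finset (Fin n)}

lemma exists_isFreeGadget {F₂ F₃ : Finset (Fin n)} (hφ : ∀ f i j, φ i j = f ↔ s f i = j)
    (hF : Disjoint F₂ F₃) (h₂ : ∀ f ∈ F₂, f ∉ insert c D) (h₃ : ∀ f ∈ F₃, f ∉ insert c D)
    {f x₄ : Fin n} (hf : f ∉ insert c D) (hf₂ : f ∉ F₂) (hf₃ : f ∉ F₃)
    (hp : (x₄, s f x₄) ∈ gadgetPairs s v c U F₂ F₃ ((s f).symm v)) :
    ∃ x, IsFreeGadget φ v c U D x ∧ φ (x 0) v = f ∧ x 3 = x₄ := by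
  obtain ⟨⟨f₂, hf₂', f₃, hf₃', x₃, ⟨hx, hnd, hU⟩, h4, h6⟩, -⟩ := (Finset.mem_filter.1 hp).2
  simp only at h4 h6
  have h2 := h₂ f₂ hf₂'
  have h3 := h₃ f₃ hf₃'
  have h23 : f₂ ≠ f₃ := fun h => Finset.disjoint_left.1 hF hf₂' (h ▸ hf₃')
  have hff2 : f ≠ f₂ := fun h => hf₂ (h ▸ hf₂')
  have hff3 : f ≠ f₃ := fun h => hf₃ (h ▸ hf₃')
  have e1 : φ ((s f).symm v) v = f := (hφ _ _ _).2 (by simp)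
  have e2 : φ v (s f₂ v) = f₂ := (hφ _ _ _).2 rfl
  have e3 : φ ((s f).symm v) (s f₂ v) = f₃ := (hφ _ _ _).2 hx
  have e4 : φ x₃ (s f₃ x₃) = f₃ := (hφ _ _ _).2 rfl
  have e5 : φ x₃ (s f₂ x₃) = f₂ := (hφ _ _ _).2 rfl
  have e6 : φ (s f₃ x₃) (s c (s f₂ x₃)) = f := (hφ _ _ _).2 (by rw [← h6, ← h4])
  have e7 : φ (s f₂ x₃) (s c (s f₂ x₃)) = c := (hφ _ _ _).2 rfl
  refine ⟨![(s f).symm v, s f₂ v, x₃, s f₃ x₃, s f₂ x₃, s c (s f₂ x₃)],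
    ⟨⟨hnd, e1.trans e6.symm, e2.trans e5.symm, e3.trans e4.symm, e7, ?_⟩, ?_, ?_, ?_, ?_⟩,
    e1, h4.symm⟩
  · simp only [Finset.mem_insert, not_or] at h2 h3 hf
    change ([φ ((s f).symm v) v, φ v (s f₂ v), φ ((s f).symm v) (s f₂ v), c] : List _).Nodup
    rw [e1, e2, e3]
    simp only [List.nodup_cons, List.mem_cons, List.not_mem_nil, or_false, not_or,
      List.nodup_nil, and_true, not_false_eq_true]
    exact ⟨⟨hff2, hff3, hf.1⟩, ⟨h23, h2.1⟩, h3.1⟩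
  · intro k
    refine hU _ ?_
    fin_cases k <;> simp
  · change φ ((s f).symm v) v ∉ D
    rw [e1]; exact fun h => hf (Finset.mem_insert_of_mem h)
  · change φ v (s f₂ v) ∉ D
    rw [e2]; exact fun h => h2 (Finset.mem_insert_of_mem h)
  · change φ ((s f).symm v) (s f₂ v) ∉ D
    rw [e3]; exact fun h => h3 (Finset.mem_insert_of_mem h)

lemma exists_deficient_set {F₂ F₃ : Finset (Fin n)} (hn : (2 : ℝ) ^ 60 ≤ n)
    (hφ : ∀ f i j, φ i j = f ↔ s f i = j)
    (hF : Disjoint F₂ F₃) (h₂ : ∀ f ∈ F₂, f ∉ insert c D) (h₃ : ∀ f ∈ F₃, f ∉ insert c D)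
    (hgad : ∀ 𝒢 : Finset (Fin 6 → Fin n), (∀ x ∈ 𝒢, IsFreeGadget φ v c U D x) →
      (𝒢.card : ℝ) ≤ (2⁻¹ : ℝ) ^ 100 * n ^ 2)
    (hsum : (0.3 : ℝ) * n ^ 3 / 2 ^ 22 ≤
      ((∑ f ∈ Finset.univ.filter fun f => f ∉ insert c D ∧ f ∉ F₂ ∧ f ∉ F₃,
        (gadgetPairs s v c U F₂ F₃ ((s f).symm v)).card : ℕ) : ℝ)) :
    ∃ J : Finset (Fin n), c ∉ J ∧ Disjoint F₂ J ∧ Disjoint F₃ J ∧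
      (J.card : ℝ) ≤ (2⁻¹ : ℝ) ^ 29 * n ∧ (2⁻¹ : ℝ) ^ 31 * n ≤ J.card ∧
      ∀ f ∈ J, Deficient s v c U F₂ F₃ f := by
  have hn0 : (0 : ℝ) < n := lt_of_lt_of_le (by positivity) hn
  set Q := Finset.univ.filter fun f => f ∉ insert c D ∧ f ∉ F₂ ∧ f ∉ F₃ with hQ
  set w : Fin n → ℕ := fun f => (gadgetPairs s v c U F₂ F₃ ((s f).symm v)).card with hw
  set R := Q.filter fun f => (2⁻¹ : ℝ) ^ 26 * n ^ 2 ≤ w f with hR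
  have hwle : ∀ f, (w f : ℝ) ≤ n ^ 2 := by
    intro f
    have : w f ≤ n * n := (Finset.card_le_univ _).trans (by simp)
    rw [sq]; exact_mod_cast this
  have hRcard : (2⁻¹ : ℝ) ^ 29 * n ≤ R.card := by
    have h1 : ∀ f ∈ Q, (w f : ℝ) ≤ (if f ∈ R then (n : ℝ) ^ 2 else 0) + (2⁻¹ : ℝ) ^ 26 * n ^ 2 := by
      intro f hf
      split_ifs with h
      · have := hwle f
        have : (0 : ℝ) ≤ (2⁻¹ : ℝ) ^ 26 * n ^ 2 := by positivity
        linarith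
      · by_contra! hcon
        rw [zero_add] at hcon
        exact h (Finset.mem_filter.2 ⟨hf, hcon.le⟩)
    have h2 : ((∑ f ∈ Q, w f : ℕ) : ℝ) ≤ R.card * n ^ 2 + n * ((2⁻¹ : ℝ) ^ 26 * n ^ 2) := by
      push_cast
      refine (Finset.sum_le_sum h1).trans ?_
      rw [Finset.sum_add_distrib, Finset.sum_const, nsmul_eq_mul, ← Finset.sum_filter,
        Finset.sum_const, nsmul_eq_mul, Finset.filter_mem_eq_inter,
        Finset.inter_eq_right.2 (Finset.filter_subset _ _)]
      gcongr
      exact (Finset.card_le_univ Q).trans (by simp)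
    have h3 := hsum.trans h2
    have h4 : (2⁻¹ : ℝ) ^ 29 * n * n ^ 2 ≤ R.card * n ^ 2 := by
      have : (0 : ℝ) < n ^ 3 := by positivity
      norm_num at h3 ⊢
      nlinarith
    exact le_of_mul_le_mul_right h4 (by positivity)
  set k := ⌊(2⁻¹ : ℝ) ^ 29 * n⌋₊ with hk
  have hkle : (k : ℝ) ≤ (2⁻¹ : ℝ) ^ 29 * n := Nat.floor_le (by positivity)
  have hklt : (2⁻¹ : ℝ) ^ 29 * n < k + 1 := Nat.lt_floor_add_one _
  obtain ⟨G, hGR, hGk⟩ := Finset.exists_subset_card_eq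
    (show k ≤ R.card by exact_mod_cast hkle.trans hRcard)
  set h : Fin n → Finset (Fin n) := fun f => Finset.univ.filter fun x₄ => (x₄, s f x₄) ∈
    gadgetPairs s v c U F₂ F₃ ((s f).symm v) with hh
  have hGQ : ∀ f ∈ G, f ∉ insert c D ∧ f ∉ F₂ ∧ f ∉ F₃ := fun f hf =>
    (Finset.mem_filter.1 (Finset.mem_filter.1 (hGR hf)).1).2
  have hits : ((∑ f ∈ G, (h f).card : ℕ) : ℝ) ≤ (2⁻¹ : ℝ) ^ 100 * n ^ 2 := by
    have hex : ∀ p : (_ : Fin n) × Fin n, ∃ x, p ∈ G.sigma h →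
        IsFreeGadget φ v c U D x ∧ φ (x 0) v = p.1 ∧ x 3 = p.2 := by
      intro p
      by_cases hp : p ∈ G.sigma h
      · obtain ⟨hp1, hp2⟩ := Finset.mem_sigma.1 hp
        obtain ⟨q1, q2, q3⟩ := hGQ _ hp1
        obtain ⟨x, hx⟩ := exists_isFreeGadget hφ hF h₂ h₃ q1 q2 q3 (Finset.mem_filter.1 hp2).2
        exact ⟨x, fun _ => hx⟩
      · exact ⟨fun _ => v, fun h => absurd h hp⟩
    choose x hx using hex
    rw [← Finset.card_sigma, ← Finset.card_image_of_injOn (f := x)]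
    · refine hgad _ fun y hy => ?_
      obtain ⟨p, hp, rfl⟩ := Finset.mem_image.1 hy
      exact (hx p hp).1
    · rintro ⟨a, b⟩ hp ⟨a', b'⟩ hp' heq
      have e1 := hx _ hp
      have e2 := hx _ hp'
      rw [heq] at e1
      have h1 : a = a' := e1.2.1.symm.trans e2.2.1
      have h2 : b = b' := e1.2.2.symm.trans e2.2.2
      rw [h1, h2]
  set J := G.filter fun f => ((h f).card : ℝ) ≤ (2⁻¹ : ℝ) ^ 60 * n with hJ
  set J' := G.filter fun f => ¬ ((h f).card : ℝ) ≤ (2⁻¹ : ℝ) ^ 60 * n with hJ'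
  have hJJ : J.card + J'.card = k := by
    rw [hJ, hJ', Finset.card_filter_add_card_filter_not, hGk]
  have hJ'card : (J'.card : ℝ) ≤ (2⁻¹ : ℝ) ^ 40 * n := by
    have h1 : (J'.card : ℝ) * ((2⁻¹ : ℝ) ^ 60 * n) ≤ (2⁻¹ : ℝ) ^ 40 * n * ((2⁻¹ : ℝ) ^ 60 * n) :=
      calc (J'.card : ℝ) * ((2⁻¹ : ℝ) ^ 60 * n) ≤ ∑ f ∈ J', ((h f).card : ℝ) := by
            rw [← nsmul_eq_mul]
            exact Finset.card_nsmul_le_sum _ _ _ fun f hf =>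
              (not_le.1 (Finset.mem_filter.1 hf).2).le
        _ ≤ ∑ f ∈ G, ((h f).card : ℝ) := Finset.sum_le_sum_of_subset_of_nonneg
            (Finset.filter_subset _ _) fun _ _ _ => by positivity
        _ ≤ (2⁻¹ : ℝ) ^ 100 * n ^ 2 := by exact_mod_cast hits
        _ = _ := by ring
    exact le_of_mul_le_mul_right h1 (by positivity)
  have hJG : ∀ f ∈ J, f ∈ G := fun f hf => (Finset.mem_filter.1 hf).1
  have hJk : (J.card : ℝ) + J'.card = k := by exact_mod_cast hJJ
  refine ⟨J, fun hc => (hGQ c (hJG c hc)).1 (Finset.mem_insert_self _ _),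
    Finset.disjoint_right.2 fun f hf => (hGQ f (hJG f hf)).2.1,
    Finset.disjoint_right.2 fun f hf => (hGQ f (hJG f hf)).2.2, ?_, ?_, ?_⟩
  · have : (0 : ℝ) ≤ J'.card := by positivity
    linarith
  · have : (2 : ℝ) ^ 40 ≤ n := le_trans (by norm_num) hn
    norm_num at this hJ'card hklt ⊢
    have h40 : (1099511627776 : ℝ) ≤ n := le_trans (by norm_num) hn
    linarith
  · intro f hf
    exact ⟨(Finset.mem_filter.1 (hGR (hJG f hf))).2, (Finset.mem_filter.1 hf).2⟩

theorem exists_repetitive_or_deficient (hn : (2 : ℝ) ^ 60 ≤ n) (hs : s ∈ latinSeqs n n)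
    (hφ : ∀ f i j, φ i j = f ↔ s f i = j) (hU : (U.card : ℝ) ≤ (2⁻¹ : ℝ) ^ 40 * n)
    (hD : (D.card : ℝ) ≤ (2⁻¹ : ℝ) ^ 40 * n)
    (hloop : ((Finset.univ.filter fun i => s c i = i).card : ℝ) ≤ (2⁻¹ : ℝ) ^ 20 * n)
    (hgad : ∀ 𝒢 : Finset (Fin 6 → Fin n), (∀ x ∈ 𝒢, IsFreeGadget φ v c U D x) →
      (𝒢.card : ℝ) ≤ (2⁻¹ : ℝ) ^ 100 * n ^ 2) :
    ∃ F₂ F₃ J : Finset (Fin n), c ∉ F₂ ∧ c ∉ F₃ ∧ Disjoint F₂ F₃ ∧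
      F₂.card ≤ n / 2048 + 1 ∧ F₃.card ≤ n / 2048 + 1 ∧
      ((J ⊆ F₃ ∧ (2⁻¹ : ℝ) ^ 18 * n ≤ J.card ∧ ∀ f ∈ J, Repetitive s v c F₂ F₃ f) ∨
       (c ∉ J ∧ Disjoint F₂ J ∧ Disjoint F₃ J ∧ (J.card : ℝ) ≤ (2⁻¹ : ℝ) ^ 29 * n ∧
        (2⁻¹ : ℝ) ^ 31 * n ≤ J.card ∧ ∀ f ∈ J, Deficient s v c U F₂ F₃ f)) := by
  have hn0 : (0 : ℝ) < n := lt_of_lt_of_le (by positivity) hn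
  obtain ⟨i₂, i₃, hi, hcard⟩ := exists_block_pair (v := v) hn hs hφ hU hD hloop
  obtain ⟨F₂, hF₂⟩ : ∃ F : Finset (Fin n), ∀ f, f ∈ F ↔ f.val % 2048 = i₂ ∧ f ∉ insert c D :=
    ⟨Finset.univ.filter fun f => f.val % 2048 = i₂ ∧ f ∉ insert c D, by simp⟩
  obtain ⟨F₃, hF₃⟩ : ∃ F : Finset (Fin n), ∀ f, f ∈ F ↔ f.val % 2048 = i₃ ∧ f ∉ insert c D :=
    ⟨Finset.univ.filter fun f => f.val % 2048 = i₃ ∧ f ∉ insert c D, by simp⟩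
  have h₂ : F₂.card ≤ n / 2048 + 1 := (Finset.card_le_card fun f hf =>
    Finset.mem_filter.2 ⟨Finset.mem_univ _, ((hF₂ f).1 hf).1⟩).trans (card_block_le n i₂)
  have h₃ : F₃.card ≤ n / 2048 + 1 := (Finset.card_le_card fun f hf =>
    Finset.mem_filter.2 ⟨Finset.mem_univ _, ((hF₃ f).1 hf).1⟩).trans (card_block_le n i₃)
  have hdisj : Disjoint F₂ F₃ := Finset.disjoint_left.2 fun f hf hf' =>
    hi (((hF₂ f).1 hf).1.symm.trans ((hF₃ f).1 hf').1)
  have hc₂ : c ∉ F₂ := fun h => ((hF₂ c).1 h).2 (Finset.mem_insert_self _ _)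
  have hc₃ : c ∉ F₃ := fun h => ((hF₃ c).1 h).2 (Finset.mem_insert_self _ _)
  by_cases hrep : (2⁻¹ : ℝ) ^ 18 * n ≤ (F₃.filter fun f => Repetitive s v c F₂ F₃ f).card
  · exact ⟨F₂, F₃, _, hc₂, hc₃, hdisj, h₂, h₃, Or.inl ⟨Finset.filter_subset _ _, hrep,
      fun f hf => (Finset.mem_filter.1 hf).2⟩⟩
  · have hsum := sum_card_gadgetPairs_ge (v := v) (U := U) hs hφ hF₂ hF₃ h₂ h₃
    have hM : ((n / 2048 + 1 : ℕ) : ℝ) ≤ n / 2047 := by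
      push_cast
      have := @Nat.cast_div_le ℝ _ _ _ n 2048
      push_cast at this
      have h40 : (1099511627776 : ℝ) ≤ n := le_trans (by norm_num) hn
      linarith
    obtain ⟨m, hm⟩ : ∃ m, m = n / 2048 + 1 := ⟨_, rfl⟩
    rw [← hm] at hsum hM
    have hsum' : (0.3 : ℝ) * n ^ 3 / 2 ^ 22 ≤
      ((∑ f ∈ Finset.univ.filter fun f => f ∉ insert c D ∧ f ∉ F₂ ∧ f ∉ F₃,
        (gadgetPairs s v c U F₂ F₃ ((s f).symm v)).card : ℕ) : ℝ) := by
      have hsumR := (Nat.cast_le (α := ℝ)).2 hsum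
      rw [Nat.cast_add, Nat.cast_add, Nat.cast_mul, Nat.cast_mul 2, Nat.cast_mul 2] at hsumR
      generalize ((∑ f ∈ Finset.univ.filter fun f => f ∉ insert c D ∧ f ∉ F₂ ∧ f ∉ F₃,
        (gadgetPairs s v c U F₂ F₃ ((s f).symm v)).card : ℕ) : ℝ) = X at hsumR ⊢
      have hr := not_le.1 hrep
      set r := (F₃.filter fun f => Repetitive s v c F₂ F₃ f).card
      have h1 : ((r * m * n : ℕ) : ℝ) ≤ (2⁻¹ : ℝ) ^ 18 * n * (n / 2047) * n := by
        push_cast; gcongr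
      have h2 : ((m * m * n : ℕ) : ℝ) ≤ (n / 2047) * (n / 2047) * n := by
        push_cast; gcongr
      have h3 : (0 : ℝ) < n ^ 3 := by positivity
      have h1' : (2⁻¹ : ℝ) ^ 18 * n * (n / 2047) * n = (2⁻¹ : ℝ) ^ 18 / 2047 * n ^ 3 := by ring
      have h2' : (n / 2047 : ℝ) * (n / 2047) * n = 1 / 2047 ^ 2 * n ^ 3 := by ring
      rw [h1'] at h1
      rw [h2'] at h2
      norm_num at h1 h2 hcard hsumR ⊢
      linarith
    obtain ⟨J, hJ⟩ := exists_deficient_set hn hφ hdisj (fun f hf => ((hF₂ f).1 hf).2)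
      (fun f hf => ((hF₃ f).1 hf).2) hgad hsum'
    exact ⟨F₂, F₃, J, hc₂, hc₃, hdisj, h₂, h₃, Or.inr hJ⟩

end Triples

lemma card_mul_le_of_incidence {α β : Type*} (U : Finset α) (A : Finset β) (r : α → β → Prop)
    [∀ u x, Decidable (r u x)] {k l : ℕ} (hU : ∀ u ∈ U, k ≤ (A.filter fun x => r u x).card)
    (hA : ∀ x ∈ A, (U.filter fun u => r u x).card ≤ l) : U.card * k ≤ A.card * l := by
  calc U.card * k ≤ ∑ u ∈ U, (A.filter fun x => r u x).card := by
        simpa using Finset.card_nsmul_le_sum U _ k hU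
    _ = ∑ x ∈ A, (U.filter fun u => r u x).card :=
        Finset.sum_card_bipartiteAbove_eq_sum_card_bipartiteBelow r
    _ ≤ A.card * l := by simpa using Finset.sum_le_card_nsmul A _ l hA

lemma le_of_mul_le_seven_mul {a w x : ℝ} (hx : 0 < x) (ha : a < x ^ 2 / 2 ^ 100)
    (h : w * x ≤ a * 7) : w ≤ (2⁻¹ : ℝ) ^ 40 * x := by
  refine le_of_mul_le_mul_right ?_ hx
  have h2 : (0 : ℝ) < x ^ 2 := by positivity
  norm_num at ha ⊢
  nlinarith

lemma card_filter_absGadgetVerts_le {n : ℕ} (U : Finset (Fin n)) (v : Fin n) (x : Fin 6 → Fin n) :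
    (U.filter fun u => u ∈ absGadgetVerts v x).card ≤ 7 := by
  have h₁ : (absGadgetVerts v x).card ≤ 7 := by
    have := Finset.card_image_le (s := (Finset.univ : Finset (Fin 6))) (f := x)
    rw [Finset.card_univ, Fintype.card_fin] at this
    exact (Finset.card_insert_le _ _).trans (by omega)
  refine (Finset.card_le_card ?_).trans h₁
  intro u hu
  exact (Finset.mem_filter.1 hu).2

lemma card_filter_absGadgetHasColour_le {n : ℕ} (D : Finset (Fin n)) (φ : Fin n → Fin n → Fin n)
    (v : Fin n) (x : Fin 6 → Fin n) :
    (D.filter fun d => absGadgetHasColour φ v x d).card ≤ 7 := by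
  have h₁ := List.toFinset_card_le [φ (x 0) v, φ v (x 1), φ (x 0) (x 1), φ (x 2) (x 3),
    φ (x 2) (x 4), φ (x 3) (x 5), φ (x 4) (x 5)]
  refine (Finset.card_le_card ?_).trans h₁
  intro d hd
  have := (Finset.mem_filter.1 hd).2
  simpa only [absGadgetHasColour, List.mem_toFinset, List.mem_cons, List.not_mem_nil,
    or_false] using this

lemma exists_max_wellSpreadAbsGadgets {n : ℕ} (φ : Fin n → Fin n → Fin n) (v c : Fin n) :
    ∃ 𝒜 : Finset (Fin 6 → Fin n), (∀ x ∈ 𝒜, IsAbsGadget φ v c x) ∧ WellSpreadAbsGadgets φ v c 𝒜 ∧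
      ∀ ℬ : Finset (Fin 6 → Fin n), (∀ x ∈ ℬ, IsAbsGadget φ v c x) →
        WellSpreadAbsGadgets φ v c ℬ → ℬ.card ≤ 𝒜.card := by
  obtain ⟨𝒜, h𝒜, hmax⟩ := Set.exists_max_image
    {𝒜 : Finset (Fin 6 → Fin n) | (∀ x ∈ 𝒜, IsAbsGadget φ v c x) ∧ WellSpreadAbsGadgets φ v c 𝒜}
    Finset.card (Set.toFinite _) ⟨∅, by simp [WellSpreadAbsGadgets]⟩
  exact ⟨𝒜, h𝒜.1, h𝒜.2, fun ℬ h₁ h₂ => hmax ℬ ⟨h₁, h₂⟩⟩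

lemma WellSpreadAbsGadgets.insert {n : ℕ} {φ : Fin n → Fin n → Fin n} {v c : Fin n}
    {𝒜 : Finset (Fin 6 → Fin n)} (h : WellSpreadAbsGadgets φ v c 𝒜) {x : Fin 6 → Fin n}
    (hx : IsAbsGadget φ v c x)
    (hU : ∀ k, x k ≠ v → (𝒜.filter fun y => x k ∈ absGadgetVerts v y).card < n)
    (h₁ : φ (x 0) v ≠ c → (𝒜.filter fun y => absGadgetHasColour φ v y (φ (x 0) v)).card < n)
    (h₂ : φ v (x 1) ≠ c → (𝒜.filter fun y => absGadgetHasColour φ v y (φ v (x 1))).card < n)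
    (h₃ : φ (x 0) (x 1) ≠ c →
      (𝒜.filter fun y => absGadgetHasColour φ v y (φ (x 0) (x 1))).card < n) :
    WellSpreadAbsGadgets φ v c (insert x 𝒜) := by
  refine ⟨fun u hu => ?_, fun d hd => ?_⟩
  · rw [Finset.filter_insert]
    split_ifs with hux
    · refine (Finset.card_insert_le _ _).trans ?_
      obtain ⟨k, -, rfl⟩ := Finset.mem_image.1 ((Finset.mem_insert.1 hux).resolve_left hu)
      exact hU k hu
    · exact h.1 u hu
  · rw [Finset.filter_insert]
    split_ifs with hdx
    · refine (Finset.card_insert_le _ _).trans ?_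
      obtain ⟨-, e1, e2, e3, e4, -⟩ := hx
      rcases hdx with rfl | rfl | rfl | h' | h' | h' | h'
      · exact h₁ hd
      · exact h₂ hd
      · exact h₃ hd
      · rw [← e3] at h'; subst h'; exact h₃ hd
      · rw [← e2] at h'; subst h'; exact h₂ hd
      · rw [← e1] at h'; subst h'; exact h₁ hd
      · exact absurd (h'.trans e4) hd
    · exact h.2 d hd

lemma exists_maximal_wellSpread {n : ℕ} (hn : 0 < n) {φ : Fin n → Fin n → Fin n}
    (h : ¬ HasAbsGadgets φ) :
    ∃ (v c : Fin n) (U D : Finset (Fin n)), (U.card : ℝ) ≤ (2⁻¹ : ℝ) ^ 40 * n ∧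
      (D.card : ℝ) ≤ (2⁻¹ : ℝ) ^ 40 * n ∧
      ∀ 𝒢 : Finset (Fin 6 → Fin n), (∀ x ∈ 𝒢, IsFreeGadget φ v c U D x) →
        (𝒢.card : ℝ) ≤ (2⁻¹ : ℝ) ^ 100 * n ^ 2 := by
  have hn0 : (0 : ℝ) < n := by exact_mod_cast hn
  unfold HasAbsGadgets at h
  push Not at h
  obtain ⟨v, c, hvc⟩ := h
  obtain ⟨𝒜, hgad, hspread, hmax⟩ := exists_max_wellSpreadAbsGadgets φ v c
  have hlt := hvc 𝒜 hgad hspread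
  have hsmall : ∀ W : Finset (Fin n), W.card * n ≤ 𝒜.card * 7 →
      (W.card : ℝ) ≤ (2⁻¹ : ℝ) ^ 40 * n := fun W hW =>
    le_of_mul_le_seven_mul hn0 hlt (by exact_mod_cast hW)
  obtain ⟨U, hU⟩ : ∃ U : Finset (Fin n), ∀ u, u ∈ U ↔
      u ≠ v ∧ n ≤ (𝒜.filter fun x => u ∈ absGadgetVerts v x).card :=
    ⟨(Set.toFinite {u | _}).toFinset, fun _ => Set.Finite.mem_toFinset _⟩
  obtain ⟨D, hD⟩ : ∃ D : Finset (Fin n), ∀ d, d ∈ D ↔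
      d ≠ c ∧ n ≤ (𝒜.filter fun x => absGadgetHasColour φ v x d).card :=
    ⟨(Set.toFinite {u | _}).toFinset, fun _ => Set.Finite.mem_toFinset _⟩
  have hUcard : U.card * n ≤ 𝒜.card * 7 :=
    card_mul_le_of_incidence U 𝒜 (fun u x => u ∈ absGadgetVerts v x)
      (fun u hu => ((hU u).1 hu).2) fun x _ => card_filter_absGadgetVerts_le U v x
  have hDcard : D.card * n ≤ 𝒜.card * 7 :=
    card_mul_le_of_incidence D 𝒜 (fun d x => absGadgetHasColour φ v x d)
      (fun d hd => ((hD d).1 hd).2) fun x _ => card_filter_absGadgetHasColour_le D φ v x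
  refine ⟨v, c, U, D, hsmall U hUcard, hsmall D hDcard, ?_⟩
  intro 𝒢 h𝒢
  have hsub : 𝒢 ⊆ 𝒜 := by
    intro x hx
    obtain ⟨hxg, hxU, hx1, hx2, hx3⟩ := h𝒢 x hx
    simp only [hU, hD, not_and, not_le] at hxU hx1 hx2 hx3
    by_contra hxA
    have hnew := hmax (insert x 𝒜) ?_ (hspread.insert hxg (fun k hk => ?_) ?_ ?_ ?_)
    · rw [Finset.card_insert_of_notMem hxA] at hnew
      omega
    · intro y hy
      rcases Finset.mem_insert.1 hy with rfl | hy
      exacts [hxg, hgad y hy]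
    exacts [hxU k hk, hx1, hx2, hx3]
  have := (Nat.cast_le (α := ℝ)).2 (Finset.card_le_card hsub)
  refine (this.trans_lt hlt).le.trans_eq ?_
  rw [div_eq_inv_mul, inv_pow]

lemma exists_colouring_encoding (n : ℕ) :
    ∃ F : Colouring n → Fin n → Equiv.Perm (Fin n), Function.Injective F ∧
      Finset.univ.image F = latinSeqs n n ∧ ∀ G f i j, G.1 i j = f ↔ F G f i = j := by
  have hex : ∀ (x : Colouring n) f i, ∃ j, x.1 i j = f := fun x f i =>
    (Finite.injective_iff_surjective.1 fun j j' h => x.2.1 i j j' h) f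
  choose g hg using hex
  have hginj : ∀ x f, Function.Injective (g x f) := by
    intro x f i i' h
    refine x.2.2 i i' (g x f i) ?_
    rw [hg, h, hg]
  set F : Colouring n → Fin n → Equiv.Perm (Fin n) := fun x f =>
    Equiv.ofBijective (g x f) (Finite.injective_iff_bijective.1 (hginj x f)) with hF
  have hiff : ∀ (x : Colouring n) f i j, x.1 i j = f ↔ F x f i = j := by
    intro x f i j
    simp only [hF, Equiv.ofBijective_apply]
    constructor
    · intro h
      exact x.2.1 i _ _ ((hg x f i).trans h.symm)
    · rintro rfl
      exact hg x f i
  refine ⟨F, ?_, ?_, hiff⟩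
  · intro x y h
    refine Subtype.ext ?_
    funext i j
    have h1 := (hiff x _ i j).1 rfl
    rw [h] at h1
    exact ((hiff y _ i j).2 h1).symm
  · ext s
    simp only [Finset.mem_image, Finset.mem_univ, true_and]
    rw [mem_latinSeqs]
    constructor
    · rintro ⟨x, rfl⟩ f f' i h
      exact ((hiff x f i _).2 rfl).symm.trans ((hiff x f' i _).2 h.symm)
    · intro hs
      have hex : ∀ i j, ∃ f, s f i = j := fun i j =>
        (Finite.injective_iff_surjective.1 fun f f' h => hs f f' i h) j
      choose φ hφ using hex
      refine ⟨⟨φ, fun i j j' h => ?_, fun i i' j h => ?_⟩, ?_⟩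
      · rw [← hφ i j, h, hφ]
      · refine (s (φ i j)).injective ?_
        rw [hφ, h, hφ]
      funext f
      ext1 i
      refine (hiff _ f i _).1 ?_
      exact hs _ _ i (hφ i _)

lemma card_perm_many_fixed_le {n : ℕ} (hn : 0 < n) (hlog : 1 ≤ Real.log n) (r : ℝ) :
    ((Finset.univ.filter fun σ : Equiv.Perm (Fin n) =>
      r ≤ (Finset.univ.filter fun i => σ i = i).card).card : ℝ) ≤
      2 ^ n * Real.exp (-(r * (Real.log n - 1))) * n.factorial := by
  have hfix : ∀ S ∈ Finset.univ.filter fun S : Finset (Fin n) => r ≤ S.card,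
      ((Finset.univ.filter fun σ : Equiv.Perm (Fin n) => ∀ i ∈ S, σ i = i).card : ℝ) ≤
        Real.exp (-(r * (Real.log n - 1))) * n.factorial := by
    intro S hS
    have hSr := (Finset.mem_filter.1 hS).2
    have hR := card_perm_le fun i : Fin n => if i ∈ S then {i} else Finset.univ
    have hset : (Finset.univ.filter fun σ : Equiv.Perm (Fin n) => ∀ i ∈ S, σ i = i) =
        Finset.univ.filter fun σ : Equiv.Perm (Fin n) =>
          ∀ i, σ i ∈ if i ∈ S then ({i} : Finset (Fin n)) else Finset.univ := by
      refine Finset.filter_congr fun σ _ => forall_congr' fun i => ?_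
      split_ifs with h <;> simp [h]
    have hsum : ∑ i : Fin n, lb (if i ∈ S then ({i} : Finset (Fin n)) else Finset.univ).card =
        Real.log n.factorial - S.card * lb n := by
      have h1 : ∀ i : Fin n, lb (if i ∈ S then ({i} : Finset (Fin n)) else Finset.univ).card =
          lb n - if i ∈ S then lb n else 0 := by
        intro i
        split_ifs <;> simp [lb]
      rw [Finset.sum_congr rfl fun i _ => h1 i, Finset.sum_sub_distrib, Finset.sum_ite_mem,
        Finset.univ_inter, Finset.sum_const, Finset.sum_const, Finset.card_univ, Fintype.card_fin,
        nsmul_eq_mul, nsmul_eq_mul, mul_lb]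
    rw [hset]
    have hkey : r * (Real.log n - 1) ≤ S.card * lb n := by
      have h2 := le_lb hn
      calc r * (Real.log n - 1) ≤ S.card * (Real.log n - 1) :=
            mul_le_mul_of_nonneg_right hSr (by linarith)
        _ ≤ S.card * lb n := mul_le_mul_of_nonneg_left h2 (Nat.cast_nonneg _)
    refine hR.trans ?_
    rw [hsum, sub_eq_neg_add, Real.exp_add, Real.exp_log (by exact_mod_cast n.factorial_pos)]
    gcongr
  have hsub : (Finset.univ.filter fun σ : Equiv.Perm (Fin n) =>
      r ≤ (Finset.univ.filter fun i => σ i = i).card) ⊆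
      (Finset.univ.filter fun S : Finset (Fin n) => r ≤ S.card).biUnion fun S =>
        Finset.univ.filter fun σ : Equiv.Perm (Fin n) => ∀ i ∈ S, σ i = i := by
    intro σ hσ
    refine Finset.mem_biUnion.2 ⟨Finset.univ.filter fun i => σ i = i,
      Finset.mem_filter.2 ⟨Finset.mem_univ _, (Finset.mem_filter.1 hσ).2⟩, ?_⟩
    simp
  calc _ ≤ ((∑ S ∈ Finset.univ.filter fun S : Finset (Fin n) => r ≤ S.card,
        (Finset.univ.filter fun σ : Equiv.Perm (Fin n) => ∀ i ∈ S, σ i = i).card : ℕ) : ℝ) := by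
        exact_mod_cast (Finset.card_le_card hsub).trans Finset.card_biUnion_le
    _ ≤ ∑ S ∈ Finset.univ.filter fun S : Finset (Fin n) => r ≤ S.card,
        Real.exp (-(r * (Real.log n - 1))) * n.factorial := by
        rw [Nat.cast_sum]
        exact Finset.sum_le_sum hfix
    _ ≤ ∑ S : Finset (Fin n), Real.exp (-(r * (Real.log n - 1))) * n.factorial :=
        Finset.sum_le_univ_sum_of_nonneg fun _ => by positivity
    _ = _ := by simp [mul_assoc]

lemma card_many_loops_le {n : ℕ} (hn : 0 < n) (hlog : 1 ≤ Real.log n) (r : ℝ) (c : Fin n) :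
    (((latinSeqs n n).filter fun s =>
      r ≤ (Finset.univ.filter fun i => s c i = i).card).card : ℝ) ≤
      2 ^ n * Real.exp (-(r * (Real.log n - 1))) * (latinSeqs n n).card := by
  obtain ⟨M, hM⟩ : ∃ M : Equiv.Perm (Fin n) → Prop, ∀ σ, M σ ↔
      r ≤ (Finset.univ.filter fun i => σ i = i).card := ⟨_, fun _ => Iff.rfl⟩
  have hcount := card_perm_many_fixed_le hn hlog r
  simp only [← hM] at hcount ⊢
  have htrans : ∀ π : Equiv.Perm (Fin n), ((latinSeqs n n).filter fun s => M (s c)).card =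
      ((latinSeqs n n).filter fun s => M (s c * π)).card := by
    intro π
    refine Finset.card_bij' (fun s _ f => s f * π⁻¹) (fun s _ f => s f * π) ?_ ?_ ?_ ?_
    · intro s hs
      obtain ⟨hs, hM⟩ := Finset.mem_filter.1 hs
      refine Finset.mem_filter.2 ⟨mem_latinSeqs.2 fun f g i h => mem_latinSeqs.1 hs f g _ h, ?_⟩
      simpa using hM
    · intro s hs
      obtain ⟨hs, hM⟩ := Finset.mem_filter.1 hs
      exact Finset.mem_filter.2 ⟨mem_latinSeqs.2 fun f g i h => mem_latinSeqs.1 hs f g _ h, hM⟩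
    · intro s _
      simp
    · intro s _
      simp
  have hrow : ∀ σ : Equiv.Perm (Fin n), (Finset.univ.filter fun π => M (σ * π)).card =
      (Finset.univ.filter fun π => M π).card := by
    intro σ
    refine Finset.card_bij' (fun π _ => σ * π) (fun π _ => σ⁻¹ * π) ?_ ?_ ?_ ?_ <;> simp
  have hswap : ∑ π : Equiv.Perm (Fin n), ((latinSeqs n n).filter fun s => M (s c * π)).card =
      ∑ s ∈ latinSeqs n n, (Finset.univ.filter fun π => M (s c * π)).card := by
    simp only [Finset.card_filter]
    exact Finset.sum_comm
  have hdouble : n.factorial * ((latinSeqs n n).filter fun s => M (s c)).card =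
      (latinSeqs n n).card * (Finset.univ.filter fun π => M π).card := by
    calc _ = ∑ π : Equiv.Perm (Fin n), ((latinSeqs n n).filter fun s => M (s c * π)).card := by
          rw [← Finset.sum_congr rfl fun π _ => htrans π, Finset.sum_const, Finset.card_univ,
            Fintype.card_perm, Fintype.card_fin, smul_eq_mul]
      _ = ∑ s ∈ latinSeqs n n, (Finset.univ.filter fun π => M (s c * π)).card :=
          hswap
      _ = _ := by
          rw [Finset.sum_congr rfl fun s _ => hrow (s c), Finset.sum_const, smul_eq_mul]
  have hfac : (0 : ℝ) < n.factorial := by exact_mod_cast n.factorial_pos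
  refine le_of_mul_le_mul_left ?_ hfac
  calc _ = ((latinSeqs n n).card : ℝ) * (Finset.univ.filter fun π => M π).card := by
        exact_mod_cast hdouble
    _ ≤ (latinSeqs n n).card * (2 ^ n * Real.exp (-(r * (Real.log n - 1))) * n.factorial) := by
        gcongr
    _ = _ := by ring

/-- The certificate for failure of the absorber property: a fixed set `J` of linearly many colours
each of which is repetitive, or each of which is deficient. -/
def Obstructed {n : ℕ} (s : Fin n → Equiv.Perm (Fin n)) (v c : Fin n)
    (U F₂ F₃ J : Finset (Fin n)) : Prop :=
  c ∉ F₂ ∧ c ∉ F₃ ∧ Disjoint F₂ F₃ ∧ F₂.card ≤ n / 2048 + 1 ∧ F₃.card ≤ n / 2048 + 1 ∧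
    ((J ⊆ F₃ ∧ (2⁻¹ : ℝ) ^ 18 * n ≤ J.card ∧ ∀ f ∈ J, Repetitive s v c F₂ F₃ f) ∨
      (c ∉ J ∧ Disjoint F₂ J ∧ Disjoint F₃ J ∧ (J.card : ℝ) ≤ (2⁻¹ : ℝ) ^ 29 * n ∧
        (2⁻¹ : ℝ) ^ 31 * n ≤ J.card ∧ ∀ f ∈ J, Deficient s v c U F₂ F₃ f))

section Large

variable {n : ℕ}

lemma ten_pow_mul_log_le (hlog : (10 : ℝ) ^ 11 ≤ Real.log n)
    (hsq : Real.log n ^ 2 ≤ (2⁻¹ : ℝ) ^ 70 * n) : 10 ^ 11 * Real.log n ≤ (2⁻¹ : ℝ) ^ 70 * n := by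
  refine le_trans ?_ hsq
  rw [sq]
  exact mul_le_mul_of_nonneg_right hlog (le_trans (by positivity) hlog)

lemma two_pow_le (hlog : (10 : ℝ) ^ 11 ≤ Real.log n)
    (hsq : Real.log n ^ 2 ≤ (2⁻¹ : ℝ) ^ 70 * n) : (2 : ℝ) ^ 60 ≤ n := by
  have := ten_pow_mul_log_le hlog hsq
  norm_num at hlog this
  linarith

lemma card_obstructed_le (hlog : (10 : ℝ) ^ 11 ≤ Real.log n)
    (hsq : Real.log n ^ 2 ≤ (2⁻¹ : ℝ) ^ 70 * n) (v c : Fin n) (U F₂ F₃ J : Finset (Fin n)) :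
    (((latinSeqs n n).filter fun s => Obstructed s v c U F₂ F₃ J).card : ℝ) ≤
      (latinSeqs n n).card *
        Real.exp (n * (1 + Real.log n) ^ 2 - (2⁻¹ : ℝ) ^ 59 * n ^ 2) := by
  have hn := two_pow_le hlog hsq
  have hlin := ten_pow_mul_log_le hlog hsq
  have hn' : 2 ^ 60 ≤ n := by exact_mod_cast hn
  have hpos : (0 : ℝ) < n := lt_of_lt_of_le (by positivity) hn
  by_cases hv : c ∉ F₂ ∧ c ∉ F₃ ∧ Disjoint F₂ F₃ ∧ F₂.card ≤ n / 2048 + 1 ∧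
      F₃.card ≤ n / 2048 + 1
  swap
  · rw [Finset.filter_false_of_mem]
    · rw [Finset.card_empty, Nat.cast_zero]
      positivity
    · rintro s - ⟨h₁, h₂, h₃, h₄, h₅, -⟩
      exact hv ⟨h₁, h₂, h₃, h₄, h₅⟩
  obtain ⟨hc₂, hc₃, hF, h₂, h₃⟩ := hv
  have hm : 1024 * (n / 2048 + 1) ≤ n := by omega
  by_cases hR : J ⊆ F₃ ∧ (2⁻¹ : ℝ) ^ 18 * n ≤ J.card
  · have hJ : J.Nonempty := by
      rw [← Finset.card_pos, ← Nat.cast_pos (α := ℝ)]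
      exact lt_of_lt_of_le (by positivity) hR.2
    refine le_trans ?_ ((card_repetitive_le (by omega) hm (by omega) ?_ v c F₂ F₃ J hc₂ hc₃ hF
      hR.1 h₂ h₃).trans ?_)
    · refine Nat.cast_le.2 (Finset.card_le_card fun s hs => ?_)
      obtain ⟨hs, -, -, -, -, -, ⟨-, -, h⟩ | ⟨-, -, h, -⟩⟩ := Finset.mem_filter.1 hs
      · exact Finset.mem_filter.2 ⟨hs, h⟩
      · obtain ⟨f, hf⟩ := hJ
        exact absurd hf (Finset.disjoint_left.1 h (hR.1 hf))
    · norm_num at hlin hlog ⊢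
      linarith
    · refine mul_le_mul_of_nonneg_left (Real.exp_le_exp.2 (sub_le_sub_left ?_ _))
        (Nat.cast_nonneg _)
      calc (2⁻¹ : ℝ) ^ 59 * n ^ 2 ≤ (2⁻¹ : ℝ) ^ 19 * n ^ 2 := by
            gcongr ?_ * _
            norm_num
        _ = n / 2 * ((2⁻¹ : ℝ) ^ 18 * n) := by ring
        _ ≤ n / 2 * J.card := by gcongr; exact hR.2
  · by_cases hD : c ∉ J ∧ Disjoint F₂ J ∧ Disjoint F₃ J ∧ (J.card : ℝ) ≤ (2⁻¹ : ℝ) ^ 29 * n ∧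
        (2⁻¹ : ℝ) ^ 31 * n ≤ J.card
    swap
    · rw [Finset.filter_false_of_mem]
      · rw [Finset.card_empty, Nat.cast_zero]
        positivity
      · rintro s - ⟨-, -, -, -, -, ⟨k₁, k₂, -⟩ | ⟨k₁, k₂, k₃, k₄, k₅, -⟩⟩
        exacts [hR ⟨k₁, k₂⟩, hD ⟨k₁, k₂, k₃, k₄, k₅⟩]
    obtain ⟨hcJ, hJ₂, hJ₃, hJ, hJ'⟩ := hD
    refine le_trans ?_ ((card_deficient_le (by omega) hm (by omega) ?_ v c U F₂ F₃ J hcJ hJ₂ hJ₃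
      h₂ h₃ hJ).trans ?_)
    · refine Nat.cast_le.2 (Finset.card_le_card fun s hs => ?_)
      obtain ⟨hs, -, -, -, -, -, ⟨k₁, k₂, -⟩ | ⟨-, -, -, -, -, h⟩⟩ := Finset.mem_filter.1 hs
      · exact absurd ⟨k₁, k₂⟩ hR
      · exact Finset.mem_filter.2 ⟨hs, h⟩
    · norm_num at hlin hlog ⊢
      linarith
    · refine mul_le_mul_of_nonneg_left (Real.exp_le_exp.2 (sub_le_sub_left ?_ _))
        (Nat.cast_nonneg _)
      calc (2⁻¹ : ℝ) ^ 59 * n ^ 2 = (2⁻¹ : ℝ) ^ 28 * n * ((2⁻¹ : ℝ) ^ 31 * n) := by ring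
        _ ≤ (2⁻¹ : ℝ) ^ 28 * n * J.card := by gcongr

lemma card_le_of_forall_obstructed (hlog : (10 : ℝ) ^ 11 ≤ Real.log n)
    (hsq : Real.log n ^ 2 ≤ (2⁻¹ : ℝ) ^ 70 * n) (T : Finset (Fin n → Equiv.Perm (Fin n)))
    (hT : T ⊆ latinSeqs n n) (h : ∀ s ∈ T, ∃ v c U F₂ F₃ J, Obstructed s v c U F₂ F₃ J) :
    (T.card : ℝ) ≤ Real.exp (-((2⁻¹ : ℝ) ^ 60 * n ^ 2)) * (latinSeqs n n).card := by
  have hn := two_pow_le hlog hsq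
  have hlin := ten_pow_mul_log_le hlog hsq
  have hpos : (0 : ℝ) < n := lt_of_lt_of_le (by positivity) hn
  obtain ⟨A, hA⟩ : ∃ A : Fin n × Fin n × Finset (Fin n) × Finset (Fin n) × Finset (Fin n) ×
      Finset (Fin n) → Finset (Fin n → Equiv.Perm (Fin n)), ∀ p,
      A p = (latinSeqs n n).filter fun s =>
        Obstructed s p.1 p.2.1 p.2.2.1 p.2.2.2.1 p.2.2.2.2.1 p.2.2.2.2.2 := ⟨_, fun _ => rfl⟩
  have hAcard : ∀ p, ((A p).card : ℝ) ≤ (latinSeqs n n).card *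
      Real.exp (n * (1 + Real.log n) ^ 2 - (2⁻¹ : ℝ) ^ 59 * n ^ 2) := by
    intro p
    rw [hA]
    exact card_obstructed_le hlog hsq _ _ _ _ _ _
  have hsub : T ⊆ Finset.univ.biUnion A := by
    intro s hs
    obtain ⟨v, c, U, F₂, F₃, J, hO⟩ := h s hs
    refine Finset.mem_biUnion.2 ⟨(v, c, U, F₂, F₃, J), Finset.mem_univ _, ?_⟩
    rw [hA]
    exact Finset.mem_filter.2 ⟨hT hs, hO⟩
  have hcard : (T.card : ℝ) ≤ (n ^ 2 * 2 ^ (4 * n) : ℝ) * ((latinSeqs n n).card *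
      Real.exp (n * (1 + Real.log n) ^ 2 - (2⁻¹ : ℝ) ^ 59 * n ^ 2)) := by
    calc (T.card : ℝ) ≤ ((∑ p, (A p).card : ℕ) : ℝ) := by
          exact_mod_cast (Finset.card_le_card hsub).trans Finset.card_biUnion_le
      _ ≤ ∑ _p : Fin n × Fin n × Finset (Fin n) × Finset (Fin n) × Finset (Fin n) ×
          Finset (Fin n), ((latinSeqs n n).card *
            Real.exp (n * (1 + Real.log n) ^ 2 - (2⁻¹ : ℝ) ^ 59 * n ^ 2)) := by
          rw [Nat.cast_sum]
          exact Finset.sum_le_sum fun p _ => hAcard p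
      _ = _ := by
          rw [Finset.sum_const, Finset.card_univ, nsmul_eq_mul]
          simp only [Fintype.card_prod, Fintype.card_fin, Fintype.card_finset]
          push_cast
          ring
  have hparam : (n ^ 2 * 2 ^ (4 * n) : ℝ) ≤ Real.exp (2 * Real.log n + 4 * n) := by
    have h2 : (2 : ℝ) ≤ Real.exp 1 := by linarith [Real.add_one_le_exp (1 : ℝ)]
    have h4 : Real.exp (4 * n) = Real.exp 1 ^ (4 * n) := by
      rw [← Real.exp_nat_mul]
      push_cast
      ring_nf
    have h5 : Real.exp (2 * Real.log n) = (n : ℝ) ^ 2 := by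
      rw [two_mul, Real.exp_add, Real.exp_log hpos, sq]
    rw [Real.exp_add, h4, h5]
    gcongr
  refine hcard.trans ?_
  calc _ ≤ Real.exp (2 * Real.log n + 4 * n) * ((latinSeqs n n).card *
        Real.exp (n * (1 + Real.log n) ^ 2 - (2⁻¹ : ℝ) ^ 59 * n ^ 2)) := by gcongr
    _ = Real.exp (2 * Real.log n + 4 * n +
        (n * (1 + Real.log n) ^ 2 - (2⁻¹ : ℝ) ^ 59 * n ^ 2)) * (latinSeqs n n).card := by
        rw [Real.exp_add (_ + _) (_ - _)]
        ring
    _ ≤ _ := by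
        gcongr
        have h1 : n * (Real.log n ^ 2) ≤ n * ((2⁻¹ : ℝ) ^ 70 * n) := by gcongr
        have h2 := mul_le_mul_of_nonneg_left hlin hpos.le
        have h3 := mul_le_mul_of_nonneg_left hlog hpos.le
        norm_num at h1 h2 h3 hlog hlin hn ⊢
        nlinarith

lemma card_le_of_many_loops (hlog : (10 : ℝ) ^ 11 ≤ Real.log n)
    (hsq : Real.log n ^ 2 ≤ (2⁻¹ : ℝ) ^ 70 * n) (T : Finset (Fin n → Equiv.Perm (Fin n)))
    (hT : T ⊆ latinSeqs n n)
    (h : ∀ s ∈ T, ∃ c, (n : ℝ) / 10 ^ 9 ≤ (Finset.univ.filter fun i => s c i = i).card) :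
    (T.card : ℝ) ≤ Real.exp (-((10 : ℝ)⁻¹ ^ 10 * n * Real.log n)) * (latinSeqs n n).card := by
  have hn := two_pow_le hlog hsq
  have hpos : (0 : ℝ) < n := lt_of_lt_of_le (by positivity) hn
  have hlog1 : 1 ≤ Real.log n := le_trans (by norm_num) hlog
  have hsub : T ⊆ Finset.univ.biUnion fun c => (latinSeqs n n).filter fun s =>
      (n : ℝ) / 10 ^ 9 ≤ (Finset.univ.filter fun i => s c i = i).card := by
    intro s hs
    obtain ⟨c, hc⟩ := h s hs
    exact Finset.mem_biUnion.2 ⟨c, Finset.mem_univ _, Finset.mem_filter.2 ⟨hT hs, hc⟩⟩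
  have hcard : (T.card : ℝ) ≤ n * (2 ^ n * Real.exp (-(n / 10 ^ 9 * (Real.log n - 1))) *
      (latinSeqs n n).card) := by
    calc (T.card : ℝ) ≤ ((∑ c, ((latinSeqs n n).filter fun s =>
          (n : ℝ) / 10 ^ 9 ≤ (Finset.univ.filter fun i => s c i = i).card).card : ℕ) : ℝ) := by
          exact_mod_cast (Finset.card_le_card hsub).trans Finset.card_biUnion_le
      _ ≤ ∑ _c : Fin n, (2 ^ n * Real.exp (-(n / 10 ^ 9 * (Real.log n - 1))) *
          (latinSeqs n n).card : ℝ) := by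
          rw [Nat.cast_sum]
          exact Finset.sum_le_sum fun c _ =>
            card_many_loops_le (by exact_mod_cast hpos) hlog1 _ c
      _ = _ := by
          rw [Finset.sum_const, Finset.card_univ, Fintype.card_fin, nsmul_eq_mul]
  have h2 : (2 : ℝ) ^ n ≤ Real.exp n := by
    rw [← Real.exp_one_pow]
    gcongr
    linarith [Real.add_one_le_exp (1 : ℝ)]
  refine hcard.trans ?_
  calc _ ≤ Real.exp (Real.log n) * (Real.exp n *
        Real.exp (-(n / 10 ^ 9 * (Real.log n - 1))) * (latinSeqs n n).card) := by
        rw [Real.exp_log hpos]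
        gcongr
    _ = Real.exp (Real.log n + n + -(n / 10 ^ 9 * (Real.log n - 1))) * (latinSeqs n n).card := by
        rw [Real.exp_add, Real.exp_add]
        ring
    _ ≤ _ := by
        gcongr
        have h3 := mul_le_mul_of_nonneg_left hlog hpos.le
        have h4 := Real.log_le_self hpos.le
        norm_num at h3 ⊢
        nlinarith

end Large

lemma natCard_subtype_add_natCard_not {α : Type*} [Finite α] (P : α → Prop) :
    Nat.card {a // P a} + Nat.card {a // ¬ P a} = Nat.card α := by
  rw [← Nat.card_sum]
  exact Nat.card_congr (Equiv.sumCompl P)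

lemma natCard_subtype_le_of_image {α β : Type*} [Fintype α] [DecidableEq β] {F : α → β}
    (hF : Function.Injective F) {S : Finset β} (hS : Finset.univ.image F = S) {P : α → Prop}
    {b : ℝ} (hT : ∀ T ⊆ S, (∀ t ∈ T, ∃ a, P a ∧ F a = t) → (T.card : ℝ) ≤ b * S.card) :
    (Nat.card {a // P a} : ℝ) ≤ b * Nat.card α := by
  have h₁ := hT ((Finset.univ.filter P).image F)
    (hS ▸ Finset.image_subset_image (Finset.filter_subset _ _)) fun t ht => by
      simpa using ht
  rwa [← hS, Finset.card_image_of_injective _ hF, Finset.card_image_of_injective _ hF,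
    Finset.card_univ, ← Fintype.card_subtype, ← Nat.card_eq_fintype_card,
    ← Nat.card_eq_fintype_card] at h₁

lemma natCard_not_hasAbsGadgets_le {n : ℕ} (hlog : (10 : ℝ) ^ 11 ≤ Real.log n)
    (hsq : Real.log n ^ 2 ≤ (2⁻¹ : ℝ) ^ 70 * n) :
    (Nat.card {G : Colouring n // ¬ HasAbsGadgets G.1 ∧
      ∀ c : Fin n, (loopCount G.1 c : ℝ) ≤ n / 10 ^ 9} : ℝ) ≤
      Real.exp (-((2⁻¹ : ℝ) ^ 60 * n ^ 2)) * Nat.card (Colouring n) := by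
  obtain ⟨F, hF, hS, hiff⟩ := exists_colouring_encoding n
  have hn := two_pow_le hlog hsq
  have hn' : 0 < n := by
    have : 2 ^ 60 ≤ n := by exact_mod_cast hn
    omega
  refine natCard_subtype_le_of_image hF hS fun T hT hP =>
    card_le_of_forall_obstructed hlog hsq T hT fun s hs => ?_
  obtain ⟨G, ⟨hgad, hloop⟩, rfl⟩ := hP s hs
  obtain ⟨v, c, U, D, hU, hD, h𝒢⟩ := exists_maximal_wellSpread hn' hgad
  have hloopc : ((Finset.univ.filter fun i => F G c i = i).card : ℝ) ≤ (2⁻¹ : ℝ) ^ 20 * n := by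
    have h₁ := hloop c
    simp only [loopCount, hiff, Nat.card_eq_fintype_card, Fintype.card_subtype] at h₁
    norm_num at h₁ ⊢
    linarith
  obtain ⟨F₂, F₃, J, h⟩ :=
    exists_repetitive_or_deficient hn (hT hs) (hiff G) hU hD hloopc h𝒢
  exact ⟨v, c, U, F₂, F₃, J, h⟩

lemma natCard_many_loops_le {n : ℕ} (hlog : (10 : ℝ) ^ 11 ≤ Real.log n)
    (hsq : Real.log n ^ 2 ≤ (2⁻¹ : ℝ) ^ 70 * n) :
    (Nat.card {G : Colouring n // ¬ ∀ c : Fin n, (loopCount G.1 c : ℝ) ≤ n / 10 ^ 9} : ℝ) ≤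
      Real.exp (-((10 : ℝ)⁻¹ ^ 10 * n * Real.log n)) * Nat.card (Colouring n) := by
  obtain ⟨F, hF, hS, hiff⟩ := exists_colouring_encoding n
  refine natCard_subtype_le_of_image hF hS fun T hT hP =>
    card_le_of_many_loops hlog hsq T hT fun s hs => ?_
  obtain ⟨G, hloop, rfl⟩ := hP s hs
  push Not at hloop
  obtain ⟨c, hc⟩ := hloop
  refine ⟨c, ?_⟩
  simp only [loopCount, hiff, Nat.card_eq_fintype_card, Fintype.card_subtype] at hc
  exact hc.le

lemma eventually_log_large : ∀ᶠ n : ℕ in Filter.atTop, (10 : ℝ) ^ 11 ≤ Real.log n ∧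
    Real.log n ^ 2 ≤ (2⁻¹ : ℝ) ^ 70 * n := by
  have h₁ := (Real.tendsto_log_atTop.comp tendsto_natCast_atTop_atTop).eventually_ge_atTop
    ((10 : ℝ) ^ 11)
  have h₂ := tendsto_natCast_atTop_atTop.eventually
    ((Real.isLittleO_pow_log_id_atTop (n := 2)).bound (by positivity : (0 : ℝ) < (2⁻¹ : ℝ) ^ 70))
  filter_upwards [h₁, h₂] with n hn₁ hn₂
  refine ⟨hn₁, ?_⟩
  simpa [abs_of_nonneg] using hn₂

/-- Let `ℰ` be the event that for all `v, c` there is a well-spread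
collection of at least `n²/2¹⁰⁰` `(v,c)`-absorbing gadgets, and `𝒞` the event that no
colour has more than `n/10⁹` loops.  Then `P[ℰ | 𝒞] ≥ 1 - exp(-a n²)` and
`P[ℰ] ≥ 1 - exp(-a' n log n)`. -/
theorem statement_7 :
    ∃ a a' : ℝ, 0 < a ∧ 0 < a' ∧ ∃ n₀ : ℕ, ∀ n : ℕ, n₀ ≤ n →
      ((1 - Real.exp (-(a * (n : ℝ) ^ 2))) *
          (Nat.card {G : Colouring n //
            ∀ c : Fin n, (loopCount G.1 c : ℝ) ≤ n / 10 ^ 9} : ℝ) ≤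
        (Nat.card {G : Colouring n // HasAbsGadgets G.1 ∧
            ∀ c : Fin n, (loopCount G.1 c : ℝ) ≤ n / 10 ^ 9} : ℝ)) ∧
      ((1 - Real.exp (-(a' * n * Real.log n))) * (Nat.card (Colouring n) : ℝ) ≤
        (Nat.card {G : Colouring n // HasAbsGadgets G.1} : ℝ)) := by
  obtain ⟨n₀, hn₀⟩ := Filter.eventually_atTop.1 eventually_log_large
  refine ⟨(2⁻¹ : ℝ) ^ 61, (10 : ℝ)⁻¹ ^ 10 / 2, by positivity, by positivity, n₀, fun n hnn => ?_⟩
  obtain ⟨hlog, hsq⟩ := hn₀ n hnn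
  have hn := two_pow_le hlog hsq
  have hlin := ten_pow_mul_log_le hlog hsq
  have hpos : (0 : ℝ) < n := lt_of_lt_of_le (by positivity) hn
  have hgad := natCard_not_hasAbsGadgets_le hlog hsq
  have hloops := natCard_many_loops_le hlog hsq
  obtain ⟨𝒞, h𝒞⟩ : ∃ 𝒞 : Colouring n → Prop, ∀ G, 𝒞 G ↔
      ∀ c : Fin n, (loopCount G.1 c : ℝ) ≤ n / 10 ^ 9 := ⟨_, fun _ => Iff.rfl⟩
  obtain ⟨ℰ, hℰ⟩ : ∃ ℰ : Colouring n → Prop, ∀ G, ℰ G ↔ HasAbsGadgets G.1 :=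
    ⟨_, fun _ => Iff.rfl⟩
  simp only [← h𝒞, ← hℰ] at hgad hloops ⊢
  have hsum₁ : (Nat.card {G // 𝒞 G} : ℝ) + Nat.card {G // ¬ 𝒞 G} = Nat.card (Colouring n) := by
    exact_mod_cast natCard_subtype_add_natCard_not 𝒞
  have hsum₂ : (Nat.card {G // 𝒞 G} : ℝ) ≤
      Nat.card {G // ℰ G ∧ 𝒞 G} + Nat.card {G // ¬ ℰ G ∧ 𝒞 G} := by
    simp only [Nat.card_eq_fintype_card, Fintype.card_subtype]
    norm_cast
    refine (Finset.card_le_card fun G hG => ?_).trans (Finset.card_union_le _ _)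
    have := (Finset.mem_filter.1 hG).2
    by_cases h : ℰ G <;> simp [h, this]
  have hsum₃ : (Nat.card {G // ℰ G ∧ 𝒞 G} : ℝ) ≤ Nat.card {G // ℰ G} :=
    Nat.cast_le.2 (Nat.card_le_card_of_injective (fun G => ⟨G.1, G.2.1⟩)
      fun G G' h => Subtype.ext (Subtype.mk.inj h))
  have hNpos : (0 : ℝ) ≤ Nat.card (Colouring n) := Nat.cast_nonneg _
  generalize (Nat.card {G // ¬ ℰ G ∧ 𝒞 G} : ℝ) = x at *
  generalize (Nat.card {G // ¬ 𝒞 G} : ℝ) = y at *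
  generalize (Nat.card {G // ℰ G ∧ 𝒞 G} : ℝ) = u at *
  generalize (Nat.card {G // 𝒞 G} : ℝ) = t at *
  generalize (Nat.card {G // ℰ G} : ℝ) = e at *
  generalize (Nat.card (Colouring n) : ℝ) = N at *
  have hnlog := mul_le_mul hn hlog (by positivity) hpos.le
  have htwo : ∀ z : ℝ, 1 ≤ z → 2 * Real.exp (-(2 * z)) ≤ Real.exp (-z) := by
    intro z hz
    have h₁ := Real.add_one_le_exp z
    calc 2 * Real.exp (-(2 * z)) ≤ Real.exp z * Real.exp (-(2 * z)) := by gcongr; linarith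
      _ = Real.exp (-z) := by rw [← Real.exp_add]; ring_nf
  have hsqn : (2 : ℝ) ^ 60 * 2 ^ 60 ≤ n ^ 2 := by
    rw [sq]
    exact mul_le_mul hn hn (by positivity) hpos.le
  have hz₁ : 1 ≤ (2⁻¹ : ℝ) ^ 61 * n ^ 2 := by
    norm_num at hsqn ⊢
    linarith
  have hz₂ : 1 ≤ (10 : ℝ)⁻¹ ^ 10 / 2 * n * Real.log n := by
    norm_num at hnlog ⊢
    linarith
  have hE₁ := htwo _ hz₁
  have hE₂ := htwo _ hz₂
  have e₁ : 2 * ((2⁻¹ : ℝ) ^ 61 * n ^ 2) = (2⁻¹ : ℝ) ^ 60 * n ^ 2 := by ring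
  have e₂ : 2 * ((10 : ℝ)⁻¹ ^ 10 / 2 * n * Real.log n) = (10 : ℝ)⁻¹ ^ 10 * n * Real.log n := by
    ring
  rw [e₁] at hE₁
  rw [e₂] at hE₂
  have hE₃ : Real.exp (-((2⁻¹ : ℝ) ^ 60 * n ^ 2)) ≤
      Real.exp (-((10 : ℝ)⁻¹ ^ 10 * n * Real.log n)) := by
    refine Real.exp_le_exp.2 (neg_le_neg ?_)
    have := mul_le_mul_of_nonneg_left hlin hpos.le
    norm_num at this ⊢
    nlinarith
  have hhalf : Real.exp (-((10 : ℝ)⁻¹ ^ 10 * n * Real.log n)) ≤ 1 / 2 := by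
    have : Real.exp (-((10 : ℝ)⁻¹ ^ 10 / 2 * n * Real.log n)) ≤ 1 :=
      Real.exp_le_one_iff.2 (by linarith)
    linarith
  have hx0 := Real.exp_pos (-((2⁻¹ : ℝ) ^ 60 * n ^ 2))
  generalize Real.exp (-((2⁻¹ : ℝ) ^ 60 * n ^ 2)) = X at *
  generalize Real.exp (-((10 : ℝ)⁻¹ ^ 10 * n * Real.log n)) = Y at *
  generalize Real.exp (-((2⁻¹ : ℝ) ^ 61 * n ^ 2)) = X' at *
  generalize Real.exp (-((10 : ℝ)⁻¹ ^ 10 / 2 * n * Real.log n)) = Y' at *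
  have hNt : N ≤ 2 * t := by nlinarith
  have ht0 : 0 ≤ t := by linarith
  constructor
  · nlinarith
  · nlinarith

end RandomLatin
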